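/- Let G be a locally finite Borel graph on a standard Borel space X such that no connected component of G is a finite Gallai tree and no infinite connected component of G is a Gallai tree with exactly 2 ends. Then for every Borel probability measure μ on X there is a μ-conull G-invariant Borel set B ⊆ X such that the restriction of G to B is Borel degree-list-colorable: for every Polish space Y and every Borel function L : B → [Y]^{<∞} with |L(x)| equal to the degree of x in G restricted to B for every x ∈ B, there is a Borel map c : B → Y with c(x) ∈ L(x) for all x ∈ B and c(x) ≠ c(y) whenever x, y ∈ B are adjacent. -/

import Mathlib

open MeasureTheory

/-- A partial function `f : B → X` is *one-ended* if there is no infinite sequence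
`x₀, x₁, x₂, …` of points of `B` with `f (x_{i+1}) = x_i` for all `i`. -/
def OneEnded {X : Type*} {B : Set X} (f : B → X) : Prop :=
  ¬ ∃ u : ℕ → B, ∀ i : ℕ, f (u (i + 1)) = (u i : X)

/-- A set of vertices is `G`-invariant if it is a union of connected components of `G`. -/
def GraphInvariant {X : Type*} (G : SimpleGraph X) (A : Set X) : Prop :=
  ∀ ⦃x y : X⦄, G.Reachable x y → x ∈ A → y ∈ A

/-- `[A]_{E_G}`: the union of all connected components of `G` meeting `A`. -/
def EGSat {X : Type*} (G : SimpleGraph X) (A : Set X) : Set X :=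
  {x | ∃ a ∈ A, G.Reachable x a}

/-- `S` is biconnected: the induced subgraph on `S` is connected and remains connected
(in the sense of `Preconnected`) after deleting any single vertex of `S`. -/
def BiconnectedSet {X : Type*} (G : SimpleGraph X) (S : Set X) : Prop :=
  (G.induce S).Connected ∧ ∀ x ∈ S, (G.induce (S \ {x})).Preconnected

/-- A block of `G` is a maximal biconnected set. -/
def GraphBlock {X : Type*} (G : SimpleGraph X) (S : Set X) : Prop :=
  BiconnectedSet G S ∧ ∀ T : Set X, BiconnectedSet G T → S ⊆ T → T = S

/-- The induced subgraph on `S` is a cycle of odd length. -/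
def OddCycleSet {X : Type*} (G : SimpleGraph X) (S : Set X) : Prop :=
  ∃ n : ℕ, Odd n ∧ 3 ≤ n ∧ Nonempty (G.induce S ≃g SimpleGraph.cycleGraph n)

/-- A Gallai tree is a connected graph each of whose blocks induces a complete
graph or an odd cycle. -/
def GallaiTree {X : Type*} (G : SimpleGraph X) : Prop :=
  G.Connected ∧ ∀ S : Set X, GraphBlock G S → G.IsClique S ∨ OddCycleSet G S

/-- A graph is ample if every vertex has degree at least 2 and for every vertex `x`,
every connected component of the restriction of `G` to the complement of `{x}`
contains a vertex of degree at least 3 in that restriction. -/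
def AmpleGraph {X : Type*} (G : SimpleGraph X) : Prop :=
  (∀ x : X, 2 ≤ (G.neighborSet x).encard) ∧
  ∀ x : X, ∀ y : ({x}ᶜ : Set X), ∃ z : ({x}ᶜ : Set X),
    (G.induce ({x}ᶜ : Set X)).Reachable y z ∧
      3 ≤ ((G.induce ({x}ᶜ : Set X)).neighborSet z).encard

/-- `x E^even_G y`: `x` and `y` are joined by a path of even length in `G`. -/
def EvenRel {X : Type*} (G : SimpleGraph X) (x y : X) : Prop :=
  ∃ p : G.Walk x y, p.IsPath ∧ Even p.length

/-- A set is `E^even_G`-invariant if it is a union of `E^even_G`-classes. -/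
def EvenInvariant {X : Type*} (G : SimpleGraph X) (C : Set X) : Prop :=
  ∀ ⦃x y : X⦄, EvenRel G x y → x ∈ C → y ∈ C

section Novikov

open Set

/-- Novikov separability of a countable family of sets. -/
def NovikovSeparable {α : Type*} [MeasurableSpace α] (s : ℕ → Set α) : Prop :=
  ∃ u : ℕ → Set α, (∀ n, s n ⊆ u n) ∧ (∀ n, MeasurableSet (u n)) ∧ ⋂ n, u n = ∅

theorem NovikovSeparable.of_iUnion {α : Type*} [MeasurableSpace α] {s : ℕ → Set α} {m : ℕ}
    {t : ℕ → ℕ → Set α} (hm : s m ⊆ ⋃ i, t i m) (hn : ∀ i n, n ≠ m → s n ⊆ t i n)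
    (h : ∀ i, NovikovSeparable (t i)) : NovikovSeparable s := by
  classical
  choose u hu hum hue using h
  refine ⟨fun n => if n = m then ⋃ i, u i m else ⋂ i, u i n, ?_, ?_, ?_⟩
  · intro n
    by_cases h : n = m
    · subst h
      simp only [if_true]
      exact hm.trans (iUnion_mono fun i => hu i _)
    · simp only [h, if_false]
      exact subset_iInter fun i => (hn i n h).trans (hu i n)
  · intro n
    by_cases h : n = m
    · simp only [h, if_true]
      exact MeasurableSet.iUnion fun i => hum i _
    · simp only [h, if_false]
      exact MeasurableSet.iInter fun i => hum i _
  · rw [eq_empty_iff_forall_notMem]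
    intro x hx
    rw [mem_iInter] at hx
    have h1 := hx m
    simp only [if_true, mem_iUnion] at h1
    obtain ⟨i, hi⟩ := h1
    have : x ∈ ⋂ n, u i n := by
      rw [mem_iInter]
      intro n
      by_cases h : n = m
      · exact h ▸ hi
      · have := hx n
        simp only [h, if_false, mem_iInter] at this
        exact this i
    rw [hue i] at this
    exact this

/-- The image under `f n` of the cylinder coded by the first `j` values of `z`. -/
def novikovCyl {α : Type*} (f : ℕ → (ℕ → ℕ) → α) (z : ℕ → ℕ) (j n : ℕ) : Set α :=
  f n '' {w | ∀ k, Nat.pair n k < j → w k = z (Nat.pair n k)}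

theorem novikovSeparable_range {α : Type*} [TopologicalSpace α] [T2Space α] [MeasurableSpace α]
    [OpensMeasurableSpace α] {f : ℕ → (ℕ → ℕ) → α} (hf : ∀ n, Continuous (f n))
    (h : ⋂ n, range (f n) = ∅) : NovikovSeparable fun n => range (f n) := by
  classical
  by_contra hns
  have step : ∀ (z : ℕ → ℕ) j, ¬ NovikovSeparable (novikovCyl f z j) →
      ∃ i, ¬ NovikovSeparable (novikovCyl f (Function.update z j i) (j + 1)) := by
    intro z j
    contrapose!
    intro H
    refine NovikovSeparable.of_iUnion (m := (Nat.unpair j).1) ?_ ?_ H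
    · rintro _ ⟨w, hw, rfl⟩
      refine mem_iUnion.2 ⟨w (Nat.unpair j).2, w, ?_, rfl⟩
      intro k hk
      rcases Nat.lt_succ_iff_lt_or_eq.1 hk with hk' | hk'
      · rw [Function.update_of_ne hk'.ne]
        exact hw k hk'
      · rw [hk', Function.update_self, ← hk']
        simp
    · rintro i n hn _ ⟨w, hw, rfl⟩
      refine ⟨w, ?_, rfl⟩
      intro k hk
      rcases Nat.lt_succ_iff_lt_or_eq.1 hk with hk' | hk'
      · rw [Function.update_of_ne hk'.ne]
        exact hw k hk'
      · exact absurd (by rw [← hk']; simp) hn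
  choose! I hI using step
  let p : ℕ → ℕ → ℕ := fun j =>
    Nat.rec (fun _ => 0) (fun j z => Function.update z j (I z j)) j
  have pS : ∀ j, p (j + 1) = Function.update (p j) j (I (p j) j) := fun j => rfl
  have hp : ∀ j, ¬ NovikovSeparable (novikovCyl f (p j) j) := by
    intro j
    induction j with
    | zero =>
      convert hns using 2
      funext n
      simp [novikovCyl]
    | succ j ih => rw [pS]; exact hI _ _ ih
  have pstab : ∀ i j, i < j → p j i = p (i + 1) i := by
    intro i j hij
    induction j, hij using Nat.le_induction with
    | base => rfl
    | succ j hj ih =>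
      rw [pS, Function.update_of_ne, ih]
      have : i < j := hj
      exact this.ne
  let z : ℕ → ℕ := fun i => p (i + 1) i
  have hz : ∀ j, ¬ NovikovSeparable (novikovCyl f z j) := by
    intro j
    convert hp j using 2
    funext n
    unfold novikovCyl
    congr 1
    ext w
    refine forall₂_congr fun k hk => ?_
    rw [pstab _ _ hk]
  let x : ℕ → ℕ → ℕ := fun n k => z (Nat.pair n k)
  have key : ∀ n (u : Set α), IsOpen u → f n (x n) ∈ u → ∃ j0, ∀ j ≥ j0,
      novikovCyl f z j n ⊆ u := by
    intro n u hu hxu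
    have hop : IsOpen (f n ⁻¹' u) := hu.preimage (hf n)
    rw [PiNat.isOpen_iff_dist] at hop
    obtain ⟨ε, hε, hsub⟩ := hop (x n) hxu
    obtain ⟨K, hK⟩ := exists_pow_lt_of_lt_one hε (by norm_num : (1/2 : ℝ) < 1)
    refine ⟨(Finset.range K).sup (fun k => Nat.pair n k + 1), fun j hj => ?_⟩
    rintro _ ⟨w, hw, rfl⟩
    apply hsub
    refine lt_of_le_of_lt ?_ hK
    rw [← PiNat.mem_cylinder_iff_dist_le]
    rw [PiNat.mem_cylinder_comm, PiNat.mem_cylinder_iff]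
    intro k hk
    refine hw k ?_
    have := Finset.le_sup (f := fun k => Nat.pair n k + 1) (Finset.mem_range.2 hk)
    omega
  have hall : ∀ n, f n (x n) = f 0 (x 0) := by
    intro n
    by_contra hne
    have hn0 : n ≠ 0 := by rintro rfl; exact hne rfl
    obtain ⟨u, v, hu, hv, hxu, hxv, huv⟩ := t2_separation hne
    obtain ⟨j0, hj0⟩ := key n u hu hxu
    obtain ⟨j1, hj1⟩ := key 0 v hv hxv
    refine hz (max j0 j1) ⟨fun i => if i = n then u else if i = 0 then v else univ, ?_, ?_, ?_⟩
    · intro i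
      by_cases h1 : i = n
      · subst h1; simpa using hj0 _ (le_max_left _ _)
      by_cases h2 : i = 0
      · subst h2; simpa [h1] using hj1 _ (le_max_right _ _)
      simp [h1, h2]
    · intro i
      dsimp only
      split_ifs
      exacts [hu.measurableSet, hv.measurableSet, MeasurableSet.univ]
    · rw [eq_empty_iff_forall_notMem]
      intro y hy
      rw [mem_iInter] at hy
      have a := hy n
      have b := hy 0
      simp only [if_true, hn0.symm, if_false] at a b
      exact huv.le_bot ⟨a, b⟩
  have : f 0 (x 0) ∈ ⋂ n, range (f n) := mem_iInter.2 fun n => ⟨x n, hall n⟩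
  rw [h] at this
  exact this

theorem novikovSeparable_of_analyticSet {α : Type*} [TopologicalSpace α] [T2Space α]
    [MeasurableSpace α] [OpensMeasurableSpace α] {s : ℕ → Set α} (hs : ∀ n, AnalyticSet (s n))
    (h : ⋂ n, s n = ∅) : NovikovSeparable s := by
  by_cases he : ∃ m, s m = ∅
  · obtain ⟨m, hm⟩ := he
    classical
    refine ⟨fun n => if n = m then ∅ else univ, ?_, ?_, ?_⟩
    · intro n
      by_cases h1 : n = m
      · subst h1; simp [hm]
      · simp [h1]
    · intro n
      dsimp only
      split_ifs <;> simp
    · rw [eq_empty_iff_forall_notMem]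
      intro y hy
      simpa using mem_iInter.1 hy m
  · push Not at he
    have : ∀ n, ∃ f : (ℕ → ℕ) → α, Continuous f ∧ range f = s n := by
      intro n
      have := hs n
      rw [AnalyticSet] at this
      exact this.resolve_left (he n).ne_empty
    choose f hf hfs using this
    have := novikovSeparable_range hf (by simpa [hfs] using h)
    simpa [hfs] using this

end Novikov

section LusinNovikov

open Set

variable {X : Type*}

/-- Pairs of a point `x` and a strictly increasing `n`-tuple in the section of `E` at `x`. -/
def tupleSet (E : Set (X × ℝ)) (n : ℕ) : Set (X × (Fin n → ℝ)) :=
  {p | StrictMono p.2 ∧ ∀ i, (p.1, p.2 i) ∈ E}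

theorem exists_tuple_iff {E : Set (X × ℝ)} (hfin : ∀ x, {y | (x, y) ∈ E}.Finite) (x : X) (n : ℕ) :
    (∃ t, (x, t) ∈ tupleSet E n) ↔ n ≤ {y | (x, y) ∈ E}.ncard := by
  constructor
  · rintro ⟨t, ht, hE⟩
    have := Set.ncard_le_ncard (s := range t) (t := {y | (x, y) ∈ E})
      (by rintro _ ⟨i, rfl⟩; exact hE i) (hfin x)
    rw [← Set.image_univ, Set.ncard_image_of_injective _ ht.injective] at this
    simpa using this
  · intro h
    rw [Set.ncard_eq_toFinset_card _ (hfin x)] at h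
    refine ⟨fun i => (hfin x).toFinset.orderEmbOfFin rfl (Fin.castLE h i), ?_, ?_⟩
    · intro i j hij
      exact (OrderEmbedding.strictMono _) (by simpa using hij)
    · intro i
      have := (hfin x).toFinset.orderEmbOfFin_mem rfl (Fin.castLE h i)
      exact ((hfin x).mem_toFinset).1 this

theorem fst_injOn_tupleSet {E : Set (X × ℝ)} (hfin : ∀ x, {y | (x, y) ∈ E}.Finite) (n : ℕ) :
    InjOn Prod.fst (tupleSet E n ∩ {p | {y | (p.1, y) ∈ E}.ncard ≤ n}) := by
  rintro ⟨x, s⟩ ⟨⟨hs, hsE⟩, hn⟩ ⟨x', t⟩ ⟨⟨ht, htE⟩, -⟩ h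
  simp only at h
  subst h
  have hr : ∀ s : Fin n → ℝ, StrictMono s → (∀ i, (x, s i) ∈ E) → range s = {y | (x, y) ∈ E} := by
    intro s hs hsE
    refine Set.eq_of_subset_of_ncard_le (by rintro _ ⟨i, rfl⟩; exact hsE i) ?_ (hfin x)
    rw [← Set.image_univ, Set.ncard_image_of_injective _ hs.injective]
    simpa using hn
  have := (hs.range_inj ht).1 ((hr s hs hsE).trans (hr t ht htE).symm)
  exact Prod.ext rfl this

variable [MeasurableSpace X]

theorem measurableSet_tupleSet {E : Set (X × ℝ)} (hE : MeasurableSet E) (n : ℕ) :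
    MeasurableSet (tupleSet E n) := by
  have : tupleSet E n = (⋂ (i : Fin n) (j : Fin n) (_ : i < j),
      {p : X × (Fin n → ℝ) | p.2 i < p.2 j}) ∩ ⋂ i : Fin n, {p | (p.1, p.2 i) ∈ E} := by
    ext p
    simp [tupleSet, StrictMono]
  rw [this]
  refine MeasurableSet.inter ?_ ?_
  · refine MeasurableSet.iInter fun i => MeasurableSet.iInter fun j => MeasurableSet.iInter fun _ => ?_
    exact measurableSet_lt (by fun_prop) (by fun_prop)
  · refine MeasurableSet.iInter fun i => ?_
    have : Measurable fun p : X × (Fin n → ℝ) => (p.1, p.2 i) := by fun_prop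
    exact this hE

variable [StandardBorelSpace X]

theorem measurableSet_le_ncard_of_bounded {E : Set (X × ℝ)} (hE : MeasurableSet E)
    (hfin : ∀ x, {y | (x, y) ∈ E}.Finite) (N : ℕ) (hN : ∀ x, {y | (x, y) ∈ E}.ncard < N) (n : ℕ) :
    MeasurableSet {x | n ≤ {y | (x, y) ∈ E}.ncard} := by
  by_cases hn : N ≤ n
  · convert MeasurableSet.empty
    rw [eq_empty_iff_forall_notMem]
    intro x hx
    have := hN x
    simp only [mem_ofPred_eq] at hx
    omega
  · push Not at hn
    induction hk : N - n generalizing n with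
    | zero => omega
    | succ k ih =>
      have h1 : MeasurableSet {x | n + 1 ≤ {y | (x, y) ∈ E}.ncard} := by
        by_cases h : N ≤ n + 1
        · convert MeasurableSet.empty
          rw [eq_empty_iff_forall_notMem]
          intro x hx
          have := hN x
          simp only [mem_ofPred_eq] at hx
          omega
        · exact ih (n + 1) (by omega) (by omega)
      have h2 : MeasurableSet (Prod.fst '' (tupleSet E n ∩ {p | {y | (p.1, y) ∈ E}.ncard ≤ n})) := by
        refine MeasurableSet.image_of_measurable_injOn ?_ measurable_fst (fst_injOn_tupleSet hfin n)
        refine (measurableSet_tupleSet hE n).inter ?_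
        have := (measurable_fst : Measurable (Prod.fst : X × (Fin n → ℝ) → X)) h1.compl
        convert this using 1
        ext p
        simp
      convert h1.union h2 using 1
      ext x
      simp only [mem_ofPred_eq, mem_union, mem_image, Prod.exists, exists_and_right, exists_eq_right,
        mem_inter_iff]
      rw [exists_tuple_iff hfin]
      omega

theorem measurableSet_proj_of_finite_real {E : Set (X × ℝ)} (hE : MeasurableSet E)
    (hfin : ∀ x, {y | (x, y) ∈ E}.Finite) : MeasurableSet {x | ∃ y, (x, y) ∈ E} := by
  have hA : NovikovSeparable fun n => {x | n ≤ {y | (x, y) ∈ E}.ncard} := by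
    let := upgradeStandardBorel X
    refine novikovSeparable_of_analyticSet (fun n => ?_) ?_
    · have := (measurableSet_tupleSet hE n).analyticSet_image (f := Prod.fst) measurable_fst
      convert this using 1
      ext x
      simp only [mem_ofPred_eq, mem_image, Prod.exists, exists_and_right, exists_eq_right]
      rw [exists_tuple_iff hfin]
    · rw [eq_empty_iff_forall_notMem]
      intro x hx
      have := mem_iInter.1 hx ({y | (x, y) ∈ E}.ncard + 1)
      simp at this
  obtain ⟨u, hu, hum, hue⟩ := hA
  have hb : ∀ n, MeasurableSet {x | ∃ y, (x, y) ∈ E ∩ Prod.fst ⁻¹' (u n)ᶜ} := by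
    intro n
    have hfin' : ∀ x, {y | (x, y) ∈ E ∩ Prod.fst ⁻¹' (u n)ᶜ}.Finite :=
      fun x => (hfin x).subset fun y hy => hy.1
    have := measurableSet_le_ncard_of_bounded (E := E ∩ Prod.fst ⁻¹' (u n)ᶜ)
      (hE.inter (measurable_fst (hum n).compl)) hfin' (n + 1) (fun x => ?_) 1
    · convert this using 1
      ext x
      rw [mem_ofPred_eq, mem_ofPred_eq, Nat.one_le_iff_ne_zero, Ne, Set.ncard_eq_zero (hfin' x),
        ← Ne, ← Set.nonempty_iff_ne_empty]
      rfl
    · by_cases hx : x ∈ u n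
      · have : {y | (x, y) ∈ E ∩ Prod.fst ⁻¹' (u n)ᶜ} = ∅ := by
          ext y; simp [hx]
        rw [this]; simp
      · have h1 : ¬ n ≤ {y | (x, y) ∈ E}.ncard := fun h => hx (hu n h)
        have := Set.ncard_le_ncard (s := {y | (x, y) ∈ E ∩ Prod.fst ⁻¹' (u n)ᶜ})
          (t := {y | (x, y) ∈ E}) (fun y hy => hy.1) (hfin x)
        omega
  convert MeasurableSet.iUnion hb using 1
  ext x
  simp only [mem_ofPred_eq, mem_iUnion, mem_inter_iff, mem_preimage, mem_compl_iff]
  constructor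
  · rintro ⟨y, hy⟩
    have : x ∉ ⋂ n, u n := by rw [hue]; simp
    simp only [mem_iInter, not_forall] at this
    obtain ⟨n, hn⟩ := this
    exact ⟨n, y, hy, hn⟩
  · rintro ⟨n, y, hy, -⟩
    exact ⟨y, hy⟩

end LusinNovikov

section Enumeration

open Set

theorem le_ncard_iff_exists {Y : Type*} {s : Set Y} (hs : s.Finite) (k : ℕ) :
    k ≤ s.ncard ↔ ∃ t : Fin k → Y, Function.Injective t ∧ ∀ i, t i ∈ s := by
  constructor
  · intro h
    rw [Set.ncard_eq_toFinset_card _ hs] at h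
    obtain ⟨u, hu, hc⟩ := Finset.exists_subset_card_eq h
    refine ⟨fun i => (u.equivFin.symm (Fin.cast hc.symm i) : Y), ?_, ?_⟩
    · intro i j hij
      simpa using hij
    · intro i
      exact hs.mem_toFinset.1 (hu (Finset.coe_mem _))
  · rintro ⟨t, ht, hts⟩
    have := Set.ncard_le_ncard (s := range t) (t := s) (by rintro _ ⟨i, rfl⟩; exact hts i) hs
    rw [← Set.image_univ, Set.ncard_image_of_injective _ ht] at this
    simpa using this

variable {X : Type*} [MeasurableSpace X]

theorem measurable_least {P : ℕ → X → Prop} (hP : ∀ n, Measurable (P n)) :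
    ∃ N : X → ℕ, Measurable N ∧ ∀ x, (∃ n, P n x) → P (N x) x ∧ ∀ m, P m x → N x ≤ m := by
  classical
  refine ⟨fun x => sInf {n | P n x}, ?_, ?_⟩
  · refine measurable_to_countable' fun n => ?_
    have : (fun x => sInf {n | P n x}) ⁻¹' {n} =
        {x | (P n x ∧ ∀ m, P m x → n ≤ m) ∨ ((¬ ∃ m, P m x) ∧ n = 0)} := by
      ext x
      simp only [mem_preimage, mem_singleton_iff, mem_ofPred_eq]
      by_cases h : ∃ m, P m x
      · have h' : {n | P n x}.Nonempty := h
        simp only [h, not_true, false_and, or_false]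
        constructor
        · rintro rfl
          exact ⟨Nat.sInf_mem h', fun m hm => Nat.sInf_le hm⟩
        · rintro ⟨h1, h2⟩
          exact le_antisymm (Nat.sInf_le h1) (h2 _ (Nat.sInf_mem h'))
      · have h' : {n | P n x} = ∅ := by
          rw [eq_empty_iff_forall_notMem]; exact fun y hy => h ⟨y, hy⟩
        rw [h', Nat.sInf_empty]
        constructor
        · rintro rfl
          exact Or.inr ⟨h, rfl⟩
        · rintro (⟨h1, h2⟩ | h1)
          · exact absurd ⟨_, h1⟩ h
          · exact h1.2.symm
    rw [this]
    exact Measurable.setOf (by fun_prop)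
  · intro x hx
    exact ⟨Nat.sInf_mem (s := {n | P n x}) hx, fun m hm => Nat.sInf_le hm⟩

theorem measurable_nat_apply {Y : Type*} [MeasurableSpace Y] {g : ℕ → X → Y}
    (hg : ∀ n, Measurable (g n)) {N : X → ℕ} (hN : Measurable N) : Measurable fun x => g (N x) x := by
  have : Measurable fun p : ℕ × X => g p.1 p.2 := measurable_from_prod_countable_right hg
  exact this.comp (hN.prodMk measurable_id)

theorem exists_select_of_enum {Y : Type*} [MeasurableSpace Y] {g : ℕ → X → Y}
    (hg : ∀ n, Measurable (g n)) {R : X → Y → Prop} (hR : Measurable fun p : X × Y => R p.1 p.2) :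
    ∃ f : X → Y, Measurable f ∧ ∀ x, (∃ n, R x (g n x)) → R x (f x) := by
  obtain ⟨N, hN, hNP⟩ := measurable_least (P := fun n x => R x (g n x)) (fun n => by fun_prop)
  exact ⟨fun x => g (N x) x, measurable_nat_apply hg hN, fun x hx => (hNP x hx).1⟩

variable [StandardBorelSpace X]

theorem measurable_sInf_section {E : Set (X × ℝ)} (hE : MeasurableSet E)
    (hfin : ∀ x, {y | (x, y) ∈ E}.Finite) : Measurable fun x => sInf {y | (x, y) ∈ E} := by
  refine measurable_of_Iio fun c => ?_
  have h1 : MeasurableSet {x | ∃ y, (x, y) ∈ E ∩ Prod.snd ⁻¹' Iio c} :=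
    measurableSet_proj_of_finite_real (hE.inter (measurable_snd measurableSet_Iio))
      fun x => (hfin x).subset fun y hy => hy.1
  have h2 := measurableSet_proj_of_finite_real hE hfin
  have : (fun x => sInf {y | (x, y) ∈ E}) ⁻¹' Iio c =
      {x | ∃ y, (x, y) ∈ E ∩ Prod.snd ⁻¹' Iio c} ∪ ({x | ∃ y, (x, y) ∈ E}ᶜ ∩ {_x | 0 < c}) := by
    ext x
    simp only [mem_preimage, mem_Iio, mem_union, mem_ofPred_eq, mem_inter_iff, mem_compl_iff]
    by_cases hx : ∃ y, (x, y) ∈ E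
    · have := csInf_lt_iff (s := {y | (x, y) ∈ E}) (a := c) (hfin x).bddBelow hx
      simp only [this, mem_ofPred_eq, hx, not_true, false_and, or_false]
    · have h0 : {y | (x, y) ∈ E} = ∅ := by
        rw [eq_empty_iff_forall_notMem]; exact fun y hy => hx ⟨y, hy⟩
      rw [h0, Real.sInf_empty]
      simp only [hx, not_false_eq_true, true_and]
      constructor
      · exact Or.inr
      · rintro (⟨y, hy, -⟩ | h)
        · exact absurd ⟨y, hy⟩ hx
        · exact h
  rw [this]
  exact h1.union (h2.compl.inter (MeasurableSet.const _))

theorem exists_enum_real {E : Set (X × ℝ)} (hE : MeasurableSet E)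
    (hfin : ∀ x, {y | (x, y) ∈ E}.Finite) :
    ∃ g : ℚ → X → ℝ, (∀ n, Measurable (g n)) ∧ ∀ x y, (x, y) ∈ E → ∃ n, g n x = y := by
  refine ⟨fun q x => sInf {y | (x, y) ∈ E ∩ Prod.snd ⁻¹' Ioi (q : ℝ)}, fun q =>
    measurable_sInf_section (hE.inter (measurable_snd measurableSet_Ioi))
      fun x => (hfin x).subset fun y hy => hy.1, ?_⟩
  intro x y hy
  obtain ⟨q, hq1, hq2⟩ : ∃ q : ℚ, (q : ℝ) < y ∧ ∀ z, (x, z) ∈ E → z < y → z ≤ q := by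
    have hf : {z | (x, z) ∈ E ∧ z < y}.Finite := (hfin x).subset fun z hz => hz.1
    obtain ⟨q, hq⟩ : ∃ q : ℚ, (q : ℝ) < y ∧ ∀ z ∈ hf.toFinset, z ≤ q := by
      by_cases hne : hf.toFinset.Nonempty
      · obtain ⟨q, hq1, hq2⟩ := exists_rat_btwn
          (((hf.mem_toFinset).1 (hf.toFinset.max'_mem hne)).2)
        exact ⟨q, hq2, fun z hz => (hf.toFinset.le_max' z hz).trans hq1.le⟩
      · obtain ⟨q, hq⟩ := exists_rat_lt y
        refine ⟨q, hq, fun z hz => absurd ⟨z, hz⟩ hne⟩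
    exact ⟨q, hq.1, fun z h1 h2 => hq.2 z (hf.mem_toFinset.2 ⟨h1, h2⟩)⟩
  refine ⟨q, ?_⟩
  refine IsLeast.csInf_eq ⟨⟨hy, hq1⟩, ?_⟩
  rintro z ⟨hz1, hz2⟩
  by_contra h
  exact absurd hz2 (not_lt.2 (hq2 z hz1 (not_le.1 h)))

/-- Lusin–Novikov enumeration for Borel relations with finite sections. -/
theorem exists_enum {Y : Type*} [MeasurableSpace Y] [StandardBorelSpace Y] [Nonempty Y]
    {R : X → Y → Prop} (hR : Measurable fun p : X × Y => R p.1 p.2)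
    (hfin : ∀ x, {y | R x y}.Finite) :
    ∃ g : ℕ → X → Y, (∀ n, Measurable (g n)) ∧ ∀ x y, R x y → ∃ n, g n x = y := by
  obtain ⟨e, he⟩ := exists_measurableEmbedding_real Y
  have hE : MeasurableSet ((Prod.map id e) '' {p : X × Y | R p.1 p.2}) :=
    (MeasurableEmbedding.id.prodMap he).measurableSet_image' hR.setOf
  have hEf : ∀ x, {z | (x, z) ∈ (Prod.map id e) '' {p : X × Y | R p.1 p.2}} = e '' {y | R x y} := by
    intro x
    ext z
    simp
  obtain ⟨g, hg, hgE⟩ := exists_enum_real hE (fun x => by rw [hEf]; exact (hfin x).image e)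
  obtain ⟨i, hi, hie⟩ := he.exists_measurable_extend measurable_id (fun _ => inferInstance)
  obtain ⟨den, hden⟩ := exists_surjective_nat ℚ
  refine ⟨fun n x => i (g (den n) x), fun n => hi.comp (hg _), fun x y hxy => ?_⟩
  obtain ⟨q, hq⟩ := hgE x (e y) ⟨(x, y), hxy, rfl⟩
  obtain ⟨n, rfl⟩ := hden q
  refine ⟨n, ?_⟩
  simp only [hq]
  exact congrFun hie y

theorem measurable_exists {Y : Type*} [MeasurableSpace Y] [StandardBorelSpace Y]
    {R : X → Y → Prop} (hR : Measurable fun p : X × Y => R p.1 p.2)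
    (hfin : ∀ x, {y | R x y}.Finite) : Measurable fun x => ∃ y, R x y := by
  rcases isEmpty_or_nonempty Y with h | h
  · simp
  obtain ⟨g, hg, hgR⟩ := exists_enum hR hfin
  have : (fun x => ∃ y, R x y) = fun x => ∃ n, R x (g n x) := by
    ext x
    constructor
    · rintro ⟨y, hy⟩
      obtain ⟨n, rfl⟩ := hgR x y hy
      exact ⟨n, hy⟩
    · rintro ⟨n, hn⟩; exact ⟨_, hn⟩
  rw [this]
  fun_prop

theorem exists_select {Y : Type*} [MeasurableSpace Y] [StandardBorelSpace Y] [Nonempty Y]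
    {R : X → Y → Prop} (hR : Measurable fun p : X × Y => R p.1 p.2)
    (hfin : ∀ x, {y | R x y}.Finite) :
    ∃ f : X → Y, Measurable f ∧ ∀ x, (∃ y, R x y) → R x (f x) := by
  obtain ⟨g, hg, hgR⟩ := exists_enum hR hfin
  obtain ⟨f, hf, hfR⟩ := exists_select_of_enum hg hR
  refine ⟨f, hf, fun x hx => hfR x ?_⟩
  obtain ⟨y, hy⟩ := hx
  obtain ⟨n, rfl⟩ := hgR x y hy
  exact ⟨n, hy⟩

theorem measurable_ncard_section {Y : Type*} [MeasurableSpace Y] [StandardBorelSpace Y]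
    {R : X → Y → Prop} (hR : Measurable fun p : X × Y => R p.1 p.2)
    (hfin : ∀ x, {y | R x y}.Finite) : Measurable fun x => {y | R x y}.ncard := by
  rcases isEmpty_or_nonempty Y with h | h
  · have : ∀ x, {y | R x y} = ∅ := fun x => eq_empty_of_isEmpty _
    simp [this]
  obtain ⟨g, hg, hgR⟩ := exists_enum hR hfin
  refine measurable_of_Ici fun k => ?_
  have : (fun x => {y | R x y}.ncard) ⁻¹' Ici k = {x | ∃ t : Fin k → ℕ,
      (∀ i j, g (t i) x = g (t j) x → i = j) ∧ ∀ i, R x (g (t i) x)} := by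
    ext x
    simp only [mem_preimage, mem_Ici, mem_ofPred_eq]
    rw [le_ncard_iff_exists (hfin x)]
    constructor
    · rintro ⟨t, ht, hR⟩
      choose u hu using fun i => hgR x (t i) (hR i)
      refine ⟨u, fun i j hij => ht ?_, fun i => ?_⟩
      · rwa [hu, hu] at hij
      · rw [hu]; exact hR i
    · rintro ⟨t, ht, hR⟩
      exact ⟨fun i => g (t i) x, fun i j h => ht i j h, hR⟩
  rw [this]
  exact Measurable.setOf (by fun_prop)

end Enumeration

section ChainTools

variable {X : Type*}

/-- There is a `P`-chain of length `n` starting at `x`. -/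
def ChainLen (P : X → X → Prop) : ℕ → X → Prop
  | 0, _ => True
  | n + 1, x => ∃ y, P x y ∧ ChainLen P n y

theorem ChainLen.pred {P : X → X → Prop} : ∀ {n x}, ChainLen P (n + 1) x → ChainLen P n x
  | 0, _, _ => trivial
  | _ + 1, _, ⟨y, hy, h⟩ => ⟨y, hy, h.pred⟩

theorem ChainLen.mono {P : X → X → Prop} {m n : ℕ} (h : m ≤ n) {x : X} (hx : ChainLen P n x) :
    ChainLen P m x := by
  induction n, h using Nat.le_induction with
  | base => exact hx
  | succ n _ ih => exact ih hx.pred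

theorem exists_next_of_forall_chainLen {P : X → X → Prop} (hfin : ∀ x, {y | P x y}.Finite) {x : X}
    (h : ∀ n, ChainLen P n x) : ∃ y, P x y ∧ ∀ n, ChainLen P n y := by
  by_contra hcon
  push Not at hcon
  choose! N hN using hcon
  have hb : ∃ M, ∀ y, P x y → N y ≤ M := by
    obtain ⟨M, hM⟩ := ((hfin x).image N).bddAbove
    exact ⟨M, fun y hy => hM ⟨y, hy, rfl⟩⟩
  obtain ⟨M, hM⟩ := hb
  obtain ⟨y, hy, hc⟩ := h (M + 1)
  exact hN y hy (hc.mono (hM y hy))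

theorem exists_seq_of_next {P : X → X → Prop} {Q : X → Prop} (h : ∀ x, Q x → ∃ y, P x y ∧ Q y)
    {x : X} (hx : Q x) : ∃ u : ℕ → X, u 0 = x ∧ ∀ i, Q (u i) ∧ P (u i) (u (i + 1)) := by
  choose! g hg hg' using h
  refine ⟨fun i => g^[i] x, rfl, fun i => ?_⟩
  have hQ : Q (g^[i] x) := by
    induction i with
    | zero => exact hx
    | succ i ih => rw [Function.iterate_succ_apply']; exact hg' _ ih
  exact ⟨hQ, by simp only [Function.iterate_succ_apply']; exact hg _ hQ⟩

theorem chainLen_of_seq {P : X → X → Prop} : ∀ (n : ℕ) (u : ℕ → X), (∀ i, P (u i) (u (i + 1))) →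
    ChainLen P n (u 0)
  | 0, _, _ => trivial
  | n + 1, u, hu => ⟨u 1, hu 0, chainLen_of_seq n (fun i => u (i + 1)) fun i => hu (i + 1)⟩

theorem exists_not_chainLen {P : X → X → Prop} (hfin : ∀ x, {y | P x y}.Finite)
    (hno : ¬ ∃ u : ℕ → X, ∀ i, P (u i) (u (i + 1))) (x : X) : ∃ n, ¬ ChainLen P n x := by
  by_contra h
  push Not at h
  obtain ⟨u, -, hu⟩ := exists_seq_of_next (Q := fun x => ∀ n, ChainLen P n x)
    (fun x hx => exists_next_of_forall_chainLen hfin hx) h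
  exact hno ⟨u, fun i => (hu i).2⟩

/-- No infinite backward `f`-orbit inside `D`. -/
def NoBack (D : Set X) (f : X → X) : Prop :=
  ¬ ∃ u : ℕ → X, ∀ i, u (i + 1) ∈ D ∧ f (u (i + 1)) = u i

end ChainTools

section ColoringTools

open Set

variable {X : Type*} [MeasurableSpace X] [StandardBorelSpace X]

theorem measurable_forall_imp {Y : Type*} [MeasurableSpace Y] [StandardBorelSpace Y]
    {R S : X → Y → Prop} (hR : Measurable fun p : X × Y => R p.1 p.2)
    (hS : Measurable fun p : X × Y => S p.1 p.2)
    (hfin : ∀ x, {y | R x y}.Finite) : Measurable fun x => ∀ y, R x y → S x y := by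
  have := measurable_exists (R := fun x y => R x y ∧ ¬ S x y) (by fun_prop)
    (fun x => (hfin x).subset fun y hy => hy.1)
  have h2 := this.not
  convert h2 using 2 with x
  push Not
  rfl

theorem measurable_chainLen {P : X → X → Prop} (hP : Measurable fun p : X × X => P p.1 p.2)
    (hfin : ∀ x, {y | P x y}.Finite) : ∀ n, Measurable (ChainLen P n)
  | 0 => measurable_const
  | n + 1 => by
    have := measurable_chainLen hP hfin n
    exact measurable_exists (R := fun x y => P x y ∧ ChainLen P n y) (by fun_prop)
      fun x => (hfin x).subset fun y hy => hy.1

theorem exists_height {P : X → X → Prop} (hP : Measurable fun p : X × X => P p.1 p.2)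
    (hfin : ∀ x, {y | P x y}.Finite) (hno : ¬ ∃ u : ℕ → X, ∀ i, P (u i) (u (i + 1))) :
    ∃ s : X → ℕ, Measurable s ∧ ∀ x y, P x y → s y < s x := by
  obtain ⟨N, hN, hNP⟩ := measurable_least (P := fun n x => ¬ ChainLen P n x)
    (fun n => (measurable_chainLen hP hfin n).not)
  refine ⟨N, hN, fun x y hxy => ?_⟩
  have hx := (hNP x (exists_not_chainLen hfin hno x)).1
  have hy := (hNP y (exists_not_chainLen hfin hno y)).2
  rcases h : N x with _ | n
  · rw [h] at hx; exact absurd trivial hx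
  · rw [h] at hx
    exact Nat.lt_succ_of_le (hy n fun hc => hx ⟨y, hxy, hc⟩)

theorem exists_countable_coloring {R : X → X → Prop} (hR : Measurable fun p : X × X => R p.1 p.2)
    (hfin : ∀ x, {y | R x y}.Finite) :
    ∃ κ : X → ℕ, Measurable κ ∧ ∀ x y, R x y → x ≠ y → κ x ≠ κ y := by
  obtain ⟨e, he⟩ := exists_measurableEmbedding_real X
  have hem := he.measurable
  obtain ⟨den, hden⟩ := exists_surjective_nat (ℚ × ℚ)
  let I : ℕ → ℝ → Prop := fun n z => ((den n).1 : ℝ) < z ∧ z < ((den n).2 : ℝ)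
  have hI : ∀ n, Measurable fun x => I n (e x) := fun n =>
    (Measurable.setOf (p := fun z => I n z) ((measurableSet_Ioi.inter measurableSet_Iio).mem)).mem.comp
      hem
  obtain ⟨N, hN, hNP⟩ := measurable_least
    (P := fun n x => I n (e x) ∧ ∀ y, (R x y ∧ y ≠ x) → ¬ I n (e y)) (fun n => by
      refine (hI n).and ?_
      refine measurable_forall_imp (R := fun x y => R x y ∧ y ≠ x) (by fun_prop)
        (S := fun x y => ¬ I n (e y)) ?_ fun x => (hfin x).subset fun y hy => hy.1
      exact ((hI n).comp measurable_snd).not)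
  have hex : ∀ x, ∃ n, I n (e x) ∧ ∀ y, (R x y ∧ y ≠ x) → ¬ I n (e y) := by
    intro x
    have hfx : ((e '' {y | R x y ∧ y ≠ x})).Finite :=
      ((hfin x).subset fun y hy => hy.1).image e
    have hnx : e x ∈ (e '' {y | R x y ∧ y ≠ x})ᶜ := by
      rintro ⟨y, ⟨-, hy⟩, hxy⟩
      exact hy (he.injective hxy)
    have := hfx.isClosed.isOpen_compl.mem_nhds hnx
    obtain ⟨ε, hε, hsub⟩ := Metric.mem_nhds_iff.1 this
    obtain ⟨a, ha1, ha2⟩ := exists_rat_btwn (show e x - ε < e x by linarith)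
    obtain ⟨b, hb1, hb2⟩ := exists_rat_btwn (show e x < e x + ε by linarith)
    obtain ⟨n, hn⟩ := hden (a, b)
    refine ⟨n, ?_, ?_⟩
    · simp only [I, hn]; exact ⟨ha2, hb1⟩
    · rintro y hy hIy
      simp only [I, hn] at hIy
      refine hsub (?_ : e y ∈ Metric.ball (e x) ε) ⟨y, hy, rfl⟩
      rw [Metric.mem_ball, Real.dist_eq, abs_lt]
      constructor <;> linarith [hIy.1, hIy.2]
  refine ⟨N, hN, fun x y hxy hne heq => ?_⟩
  have h1 := (hNP x (hex x)).1.2 y ⟨hxy, hne.symm⟩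
  have h2 := (hNP y (hex y)).1.1
  rw [heq] at h1
  exact h1 h2

theorem exists_greedy {P : X → X → Prop} (hP : Measurable fun p : X × X => P p.1 p.2)
    (hfin : ∀ x, {y | P x y}.Finite) {s : X → ℕ} (hs : Measurable s) (hsP : ∀ x y, P x y → s y < s x)
    {L : X → Finset ℝ} (hL : Measurable fun p : X × ℝ => p.2 ∈ L p.1) :
    ∃ c : X → ℝ, Measurable c ∧ ∀ x, {y | P x y}.ncard < (L x).card →
      c x ∈ L x ∧ ∀ y, P x y → c y ≠ c x := by
  classical
  have step : ∀ (n : ℕ) (c : {c : X → ℝ // Measurable c}), ∃ c' : {c : X → ℝ // Measurable c},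
      ∀ x, (s x ≠ n → c'.1 x = c.1 x) ∧ (s x = n → {y | P x y}.ncard < (L x).card →
        c'.1 x ∈ L x ∧ ∀ y, P x y → c.1 y ≠ c'.1 x) := by
    rintro n ⟨c, hc⟩
    obtain ⟨f, hf, hfP⟩ := exists_select (R := fun x v => v ∈ L x ∧ ∀ y, P x y → c y ≠ v)
      (by
        refine hL.and ?_
        exact measurable_forall_imp (X := X × ℝ) (R := fun p y => P p.1 y)
          (S := fun p y => c y ≠ p.2) (by fun_prop) (by fun_prop) fun p => hfin p.1)
      (fun x => (L x).finite_toSet.subset fun v hv => hv.1)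
    refine ⟨⟨fun x => if s x = n then f x else c x,
      Measurable.ite (Measurable.setOf (by fun_prop)) hf hc⟩, fun x => ⟨fun h => ?_, fun h hlt => ?_⟩⟩
    · simp [h]
    · simp only [h, if_true]
      apply hfP
      by_contra hcon
      push Not at hcon
      have : (L x : Set ℝ) ⊆ c '' {y | P x y} := fun v hv => hcon v hv
      have h1 := Set.ncard_le_ncard this ((hfin x).image c)
      have h2 := Set.ncard_image_le (f := c) (hfin x)
      rw [Set.ncard_coe_finset] at h1
      omega
  choose F hF using step
  let C : ℕ → {c : X → ℝ // Measurable c} := fun n =>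
    Nat.rec ⟨fun _ => 0, measurable_const⟩ (fun n c => F n c) n
  have hC : ∀ n, C (n + 1) = F n (C n) := fun n => rfl
  have hstab : ∀ x n, s x < n → (C n).1 x = (C (s x + 1)).1 x := by
    intro x n hn
    induction n, hn using Nat.le_induction with
    | base => rfl
    | succ n hn ih =>
      have : s x < n := hn
      rw [hC, ((hF n (C n)) x).1 this.ne, ih]
  refine ⟨fun x => (C (s x + 1)).1 x,
    measurable_nat_apply (g := fun n x => (C (n + 1)).1 x) (fun n => (C (n + 1)).2) hs,
    fun x hlt => ?_⟩
  obtain ⟨h1, h2⟩ := (hF (s x) (C (s x)) x).2 rfl hlt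
  refine ⟨h1, fun y hy => ?_⟩
  have := h2 y hy
  rw [hstab y (s x) (hsP x y hy)] at this
  exact this

theorem exists_coloring_of_noBack (G : SimpleGraph X)
    (hG : Measurable fun p : X × X => G.Adj p.1 p.2) (hlf : ∀ x, (G.neighborSet x).Finite)
    {D : Set X} (hD : Measurable fun x => x ∈ D) {f : X → X} (hf : Measurable f)
    (hadj : ∀ x ∈ D, G.Adj x (f x)) (hnb : NoBack D f) {L : X → Finset ℝ}
    (hL : Measurable fun p : X × ℝ => p.2 ∈ L p.1)
    (hcard : ∀ x ∈ D, (G.neighborSet x).ncard ≤ (L x).card) :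
    ∃ c : X → ℝ, Measurable c ∧ ∀ x ∈ D, c x ∈ L x ∧ ∀ y ∈ D, G.Adj x y → c x ≠ c y := by
  obtain ⟨s, hs, hsf⟩ := exists_height (P := fun x y => y ∈ D ∧ f y = x) (by fun_prop)
    (fun x => (hlf x).subset fun y hy => by
      have := hadj y hy.1
      rw [hy.2] at this
      exact this.symm) hnb
  obtain ⟨κ, hκ, hκc⟩ := exists_countable_coloring (R := fun x y => G.Adj x y) hG hlf
  let Q : X → X → Prop := fun x y =>
    G.Adj x y ∧ x ∈ D ∧ y ∈ D ∧ (s y < s x ∨ s y = s x ∧ κ y < κ x)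
  have hQm : Measurable fun p : X × X => Q p.1 p.2 := by
    simp only [Q]; fun_prop
  have hQf : ∀ x, {y | Q x y}.Finite := fun x => (hlf x).subset fun y hy => hy.1
  obtain ⟨r, hr, hrQ⟩ := exists_height hQm hQf (by
    rintro ⟨u, hu⟩
    have : StrictAnti fun i => toLex (s (u i), κ (u i)) := by
      refine strictAnti_nat_of_succ_lt fun i => ?_
      rw [Prod.Lex.toLex_lt_toLex]
      exact (hu i).2.2.2
    exact not_strictAnti_of_wellFoundedLT _ this)
  obtain ⟨c, hc, hcP⟩ := exists_greedy hQm hQf hr hrQ hL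
  have key : ∀ x ∈ D, c x ∈ L x ∧ ∀ y, Q x y → c y ≠ c x := by
    intro x hx
    refine hcP x (lt_of_lt_of_le ?_ (hcard x hx))
    refine Set.ncard_lt_ncard ⟨fun y hy => hy.1, fun hsub => ?_⟩ (hlf x)
    have := hsub (hadj x hx)
    have h1 := hsf (f x) x ⟨hx, rfl⟩
    have h2 := this.2.2.2
    omega
  refine ⟨c, hc, fun x hx => ⟨(key x hx).1, fun y hy hxy => ?_⟩⟩
  have hne := hκc x y hxy hxy.ne
  by_cases h : s y < s x ∨ s y = s x ∧ κ y < κ x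
  · exact ((key x hx).2 y ⟨hxy, hx, hy, h⟩).symm
  · exact (key y hy).2 x ⟨hxy.symm, hy, hx, by omega⟩

/-- Finite colourings of Borel graphs of bounded degree. -/
theorem exists_finite_coloring {R : X → X → Prop} (hR : Measurable fun p : X × X => R p.1 p.2)
    (hfin : ∀ x, {y | R x y}.Finite) {d : ℕ} (hd : ∀ x, {y | R x y ∧ y ≠ x}.ncard ≤ d) :
    ∃ c : X → ℕ, Measurable c ∧ (∀ x, c x ≤ d) ∧ ∀ x y, R x y → R y x → x ≠ y → c x ≠ c y := by
  classical
  obtain ⟨κ, hκ, hκc⟩ := exists_countable_coloring hR hfin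
  obtain ⟨c, hc, hcP⟩ := exists_greedy (P := fun x y => R x y ∧ κ y < κ x) (by fun_prop)
    (fun x => (hfin x).subset fun y hy => hy.1) hκ (fun x y h => h.2)
    (L := fun _ => (Finset.range (d + 1)).image fun n : ℕ => (n : ℝ)) (by
      have : Measurable fun z : ℝ => z ∈ (Finset.range (d + 1)).image fun n : ℕ => (n : ℝ) :=
        (Finset.measurableSet _).mem
      exact this.comp measurable_snd)
  have hlt : ∀ x, {y | R x y ∧ κ y < κ x}.ncard <
      ((Finset.range (d + 1)).image fun n : ℕ => (n : ℝ)).card := by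
    intro x
    rw [Finset.card_image_of_injective _ Nat.cast_injective, Finset.card_range]
    refine Nat.lt_succ_of_le (le_trans (Set.ncard_le_ncard ?_ ?_) (hd x))
    · rintro y ⟨h1, h2⟩
      exact ⟨h1, fun h => by simp [h] at h2⟩
    · exact (hfin x).subset fun y hy => hy.1
  have key := fun x => hcP x (hlt x)
  have hfl : ∀ x, ((⌊c x⌋₊ : ℕ) : ℝ) = c x ∧ ⌊c x⌋₊ ≤ d := by
    intro x
    obtain ⟨n, hn, hnc⟩ := Finset.mem_image.1 (key x).1
    rw [← hnc, Nat.floor_natCast]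
    exact ⟨rfl, Nat.lt_succ_iff.1 (Finset.mem_range.1 hn)⟩
  refine ⟨fun x => ⌊c x⌋₊, Nat.measurable_floor.comp hc, fun x => (hfl x).2, fun x y hxy hyx hne h => ?_⟩
  simp only at h
  have hcc : c x = c y := by rw [← (hfl x).1, ← (hfl y).1, h]
  rcases lt_or_gt_of_ne (hκc x y hxy hne) with h' | h'
  · exact (key y).2 x ⟨hyx, h'⟩ hcc
  · exact (key x).2 y ⟨hxy, h'⟩ hcc.symm

end ColoringTools

section NoBackTools

variable {X : Type*}

theorem NoBack.mono {D D' : Set X} {f : X → X} (h : NoBack D f) (hD : D' ⊆ D) : NoBack D' f :=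
  fun ⟨u, hu⟩ => h ⟨u, fun i => ⟨hD (hu i).1, (hu i).2⟩⟩

theorem NoBack.congr {D : Set X} {f g : X → X} (h : NoBack D f) (hfg : ∀ x ∈ D, f x = g x) :
    NoBack D g :=
  fun ⟨u, hu⟩ => h ⟨u, fun i => ⟨(hu i).1, (hfg _ (hu i).1).trans (hu i).2⟩⟩

theorem NoBack.glue {D : Set X} {f : X → X} (ρ : X → ℕ)
    (hρ : ∀ x ∈ D, f x ∈ D → ρ x ≤ ρ (f x)) (h : ∀ n, NoBack {x | x ∈ D ∧ ρ x = n} f) :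
    NoBack D f := by
  rintro ⟨u, hu⟩
  have hanti : Antitone fun i => ρ (u (i + 1)) := by
    refine antitone_nat_of_succ_le fun i => ?_
    have := hρ (u (i + 2)) (hu (i + 1)).1
    rw [(hu (i + 1)).2] at this
    exact this (hu i).1
  obtain ⟨m, hm⟩ : ∃ m, ∀ i, ρ (u (m + 1)) ≤ ρ (u (i + 1)) :=
    ⟨Function.argmin fun i => ρ (u (i + 1)), fun i => Function.argmin_le (fun i => ρ (u (i + 1))) i⟩
  refine h (ρ (u (m + 1))) ⟨fun i => u (m + i), fun i => ⟨⟨(hu (m + i)).1, ?_⟩, (hu (m + i)).2⟩⟩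
  exact le_antisymm (hanti (Nat.le_add_right m i)) (hm (m + i))

/-- `x` has distance at most `n` to `A`. -/
def DistLE (H : SimpleGraph X) (A : Set X) : ℕ → X → Prop
  | 0, x => x ∈ A
  | n + 1, x => x ∈ A ∨ ∃ y, H.Adj x y ∧ DistLE H A n y

theorem exists_distLE_iff {H : SimpleGraph X} {A : Set X} {x : X} :
    (∃ n, DistLE H A n x) ↔ ∃ a, H.Reachable x a ∧ a ∈ A := by
  constructor
  · rintro ⟨n, hn⟩
    induction n generalizing x with
    | zero => exact ⟨x, SimpleGraph.Reachable.refl _, hn⟩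
    | succ n ih =>
      rcases hn with h | ⟨y, hxy, h⟩
      · exact ⟨x, SimpleGraph.Reachable.refl _, h⟩
      · obtain ⟨a, hya, ha⟩ := ih h
        exact ⟨a, hxy.reachable.trans hya, ha⟩
  · rintro ⟨a, hxa, ha⟩
    rw [SimpleGraph.reachable_iff_reflTransGen] at hxa
    induction hxa using Relation.ReflTransGen.head_induction_on with
    | refl => exact ⟨0, ha⟩
    | head hab _ ih =>
      obtain ⟨n, hn⟩ := ih
      exact ⟨n + 1, Or.inr ⟨_, hab, hn⟩⟩

end NoBackTools

section ComponentEnum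

open Relation

variable {X : Type*} [MeasurableSpace X] [StandardBorelSpace X]

theorem exists_enum_reflTransGen {R : X → X → Prop} (hR : Measurable fun p : X × X => R p.1 p.2)
    (hfin : ∀ x, {y | R x y}.Finite) :
    ∃ φ : ℕ → X → X, (∀ n, Measurable (φ n)) ∧ ∀ x y, ReflTransGen R x y ↔ ∃ n, φ n x = y := by
  classical
  rcases isEmpty_or_nonempty X with h | h
  · exact ⟨fun _ => id, fun _ => measurable_id, fun x => (h.false x).elim⟩
  obtain ⟨g, hg, hgR⟩ := exists_enum hR hfin
  let g' : ℕ → X → X := fun n x => if R x (g n x) then g n x else x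
  have hg' : ∀ n, Measurable (g' n) := fun n =>
    Measurable.ite (Measurable.setOf (by fun_prop)) (hg n) measurable_id
  let ψ : List ℕ → X → X := fun l => l.foldr (fun n F => F ∘ g' n) id
  have hψ : ∀ l, Measurable (ψ l) := by
    intro l
    induction l with
    | nil => exact measurable_id
    | cons n l ih => exact ih.comp (hg' n)
  obtain ⟨den, hden⟩ := exists_surjective_nat (List ℕ)
  refine ⟨fun n => ψ (den n), fun n => hψ _, fun x y => ⟨fun hxy => ?_, ?_⟩⟩
  · have : ∃ l, ψ l x = y := by
      induction hxy using ReflTransGen.head_induction_on with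
      | refl => exact ⟨[], rfl⟩
      | head hab _ ih =>
        obtain ⟨l, hl⟩ := ih
        obtain ⟨n, hn⟩ := hgR _ _ hab
        refine ⟨n :: l, ?_⟩
        change ψ l (g' n _) = y
        simp only [g', hn, hab, if_true, hl]
    obtain ⟨l, hl⟩ := this
    obtain ⟨n, rfl⟩ := hden l
    exact ⟨n, hl⟩
  · rintro ⟨n, rfl⟩
    change ReflTransGen R x (ψ (den n) x)
    generalize den n = l
    induction l generalizing x with
    | nil => exact ReflTransGen.refl
    | cons n l ih =>
      change ReflTransGen R x (ψ l (g' n x))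
      by_cases h : R x (g n x)
      · have : g' n x = g n x := by simp [g', h]
        rw [this]
        exact ReflTransGen.head h (ih _)
      · have : g' n x = x := by simp [g', h]
        rw [this]
        exact ih _

theorem measurable_reflTransGen {R : X → X → Prop} (hR : Measurable fun p : X × X => R p.1 p.2)
    (hfin : ∀ x, {y | R x y}.Finite) : Measurable fun p : X × X => ReflTransGen R p.1 p.2 := by
  obtain ⟨φ, hφ, hφR⟩ := exists_enum_reflTransGen hR hfin
  simp only [hφR]
  fun_prop

theorem exists_enum_reachable {G : SimpleGraph X} (hG : Measurable fun p : X × X => G.Adj p.1 p.2)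
    (hlf : ∀ x, (G.neighborSet x).Finite) :
    ∃ φ : ℕ → X → X, (∀ n, Measurable (φ n)) ∧ ∀ x y, G.Reachable x y ↔ ∃ n, φ n x = y := by
  obtain ⟨φ, hφ, hφR⟩ := exists_enum_reflTransGen hG hlf
  exact ⟨φ, hφ, fun x y => by rw [SimpleGraph.reachable_iff_reflTransGen, hφR]⟩

theorem measurable_exists_reachable {G : SimpleGraph X}
    (hG : Measurable fun p : X × X => G.Adj p.1 p.2) (hlf : ∀ x, (G.neighborSet x).Finite)
    {A : X → Prop} (hA : Measurable A) : Measurable fun x => ∃ y, G.Reachable x y ∧ A y := by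
  obtain ⟨φ, hφ, hφR⟩ := exists_enum_reachable hG hlf
  have : (fun x => ∃ y, G.Reachable x y ∧ A y) = fun x => ∃ n, A (φ n x) := by
    ext x
    constructor
    · rintro ⟨y, hy, hA⟩
      obtain ⟨n, rfl⟩ := (hφR x y).1 hy
      exact ⟨n, hA⟩
    · rintro ⟨n, hn⟩
      exact ⟨_, (hφR x _).2 ⟨n, rfl⟩, hn⟩
  rw [this]
  fun_prop

theorem measurable_distLE {H : SimpleGraph X} (hH : Measurable fun p : X × X => H.Adj p.1 p.2)
    (hlf : ∀ x, (H.neighborSet x).Finite) {A : Set X} (hA : Measurable fun x => x ∈ A) :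
    ∀ n, Measurable (DistLE H A n)
  | 0 => hA
  | n + 1 => by
    have := measurable_distLE hH hlf hA n
    have h2 := measurable_exists (R := fun x y => H.Adj x y ∧ DistLE H A n y) (by fun_prop)
      fun x => (hlf x).subset fun y hy => hy.1
    exact hA.or h2

theorem exists_extension (H : SimpleGraph X) (hH : Measurable fun p : X × X => H.Adj p.1 p.2)
    (hlf : ∀ x, (H.neighborSet x).Finite) {A : Set X} (hA : Measurable fun x => x ∈ A) :
    ∃ f : X → X, Measurable f ∧ NoBack {x | x ∉ A ∧ ∃ a, H.Reachable x a ∧ a ∈ A} f ∧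
      ∀ x, x ∉ A → (∃ a, H.Reachable x a ∧ a ∈ A) → H.Adj x (f x) := by
  classical
  rcases isEmpty_or_nonempty X with hX | hX
  · exact ⟨id, measurable_id, fun ⟨u, _⟩ => hX.false (u 0), fun x => (hX.false x).elim⟩
  have hDm := measurable_distLE hH hlf hA
  obtain ⟨N, hN, hNP⟩ := measurable_least hDm
  let W : X → Prop := fun x => ∃ n, DistLE H A n x
  have hW : Measurable W := Measurable.exists hDm
  obtain ⟨p, hp, hpP⟩ := exists_select (R := fun x y => H.Adj x y ∧ W y ∧ N y < N x) (by fun_prop)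
    (fun x => (hlf x).subset fun y hy => hy.1)
  let D : Set X := {x | x ∉ A ∧ W x}
  have hD : Measurable fun x => x ∈ D := hA.not.and hW
  have hpD : ∀ x ∈ D, H.Adj x (p x) ∧ W (p x) ∧ N (p x) < N x := by
    rintro x ⟨hxA, hxW⟩
    refine hpP x ?_
    have h1 := (hNP x hxW).1
    rcases hn : N x with _ | n
    · rw [hn] at h1; exact absurd h1 hxA
    · rw [hn] at h1
      rcases h1 with h | ⟨y, hxy, hy⟩
      · exact absurd h hxA
      · exact ⟨y, hxy, ⟨n, hy⟩, Nat.lt_succ_of_le ((hNP y ⟨n, hy⟩).2 n hy)⟩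
  let P : X → X → Prop := fun x y => y ∈ D ∧ p y = x
  have hPm : Measurable fun q : X × X => P q.1 q.2 := by simp only [P]; fun_prop
  have hPf : ∀ x, {y | P x y}.Finite := fun x => (hlf x).subset fun y hy => by
    have := (hpD y hy.1).1
    rw [hy.2] at this
    exact this.symm
  let I : X → Prop := fun x => ∀ n, ChainLen P n x
  have hI : Measurable I := Measurable.forall (measurable_chainLen hPm hPf)
  obtain ⟨q, hq, hqP⟩ := exists_select (R := fun x y => P x y ∧ I y) (by fun_prop)
    (fun x => (hPf x).subset fun y hy => hy.1)
  have hqI : ∀ x, I x → P x (q x) ∧ I (q x) := fun x hx =>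
    hqP x (exists_next_of_forall_chainLen hPf hx)
  let f : X → X := fun x => if I x then q x else p x
  have hDset : {x | x ∉ A ∧ ∃ a, H.Reachable x a ∧ a ∈ A} = D := by
    ext x
    simp only [D, W, Set.mem_ofPred_eq, exists_distLE_iff]
  refine ⟨f, Measurable.ite hI.setOf hq hp, ?_, ?_⟩
  · rw [hDset]
    rintro ⟨u, hu⟩
    have hI1 : ∀ i, I (u (i + 1)) → P (u (i + 1)) (u i) ∧ I (u i) := by
      intro i hi
      have : f (u (i + 1)) = q (u (i + 1)) := by simp only [f, hi, if_true]
      rw [(hu i).2] at this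
      rw [this]
      exact hqI _ hi
    by_cases hall : ∀ i, I (u (i + 1))
    · have : StrictAnti fun i => N (u (i + 1)) := by
        refine strictAnti_nat_of_succ_lt fun i => ?_
        have h1 := (hI1 (i + 1) (hall (i + 1))).1
        have := (hpD _ h1.1).2.2
        rwa [h1.2] at this
      exact not_strictAnti_of_wellFoundedLT _ this
    · push Not at hall
      obtain ⟨i, hi⟩ := hall
      have hno : ∀ j, ¬ I (u (i + 1 + j)) := by
        intro j
        induction j with
        | zero => exact hi
        | succ j ih => exact fun h => ih (hI1 _ h).2
      refine hno 0 fun n => chainLen_of_seq n (fun j => u (i + 1 + j)) fun j => ?_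
      refine ⟨(hu _).1, ?_⟩
      have := (hu (i + 1 + j)).2
      have hf' : f (u (i + 1 + j + 1)) = p (u (i + 1 + j + 1)) := by
        have := hno (j + 1)
        rw [← add_assoc] at this
        simp only [f, this, if_false]
      rw [hf'] at this
      exact this
  · intro x hx hxa
    have hxD : x ∈ D := hDset ▸ (⟨hx, hxa⟩ : x ∈ {x | x ∉ A ∧ ∃ a, H.Reachable x a ∧ a ∈ A})
    by_cases h : I x
    · have : f x = q x := by simp only [f, h, if_true]
      rw [this]
      have h1 := (hqI x h).1
      have := (hpD _ h1.1).1
      rw [h1.2] at this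
      exact this.symm
    · have : f x = p x := by simp only [f, h, if_false]
      rw [this]
      exact (hpD x hxD).1

end ComponentEnum

section InsideReach

open Relation Set

variable {V : Type*}

/-- `x` and `y` are joined by a walk of `G` all of whose edges lie inside `S`. -/
def Rch (G : SimpleGraph V) (S : Set V) : V → V → Prop :=
  ReflTransGen fun a b => G.Adj a b ∧ a ∈ S ∧ b ∈ S

variable {G : SimpleGraph V} {S T : Set V} {x y z : V}

theorem Rch.symm (h : Rch G S x y) : Rch G S y x :=
  (@ReflTransGen.stdSymm _ (fun a b => G.Adj a b ∧ a ∈ S ∧ b ∈ S)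
    ⟨fun _ _ h => ⟨h.1.symm, h.2.2, h.2.1⟩⟩).symm _ _ h

theorem Rch.trans (h : Rch G S x y) (h' : Rch G S y z) : Rch G S x z :=
  ReflTransGen.trans h h'

theorem Rch.mono (h : Rch G S x y) (hS : S ⊆ T) : Rch G T x y :=
  ReflTransGen.mono (r := fun a b => G.Adj a b ∧ a ∈ S ∧ b ∈ S)
    (p := fun a b => G.Adj a b ∧ a ∈ T ∧ b ∈ T) (fun _ _ h => ⟨h.1, hS h.2.1, hS h.2.2⟩) _ _ h

theorem Rch.of_adj (h : G.Adj x y) (hx : x ∈ S) (hy : y ∈ S) : Rch G S x y :=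
  ReflTransGen.single ⟨h, hx, hy⟩

/-- The induced graph on `S` is preconnected. -/
def ConnSet (G : SimpleGraph V) (S : Set V) : Prop :=
  ∀ x ∈ S, ∀ y ∈ S, Rch G S x y

theorem connSet_iff : ConnSet G S ↔ (G.induce S).Preconnected := by
  constructor
  · rintro h ⟨x, hx⟩ ⟨y, hy⟩
    have := h x hx y hy
    induction this using ReflTransGen.head_induction_on with
    | refl => exact SimpleGraph.Reachable.refl _
    | head hab _ ih =>
      have := ih hab.2.2
      refine SimpleGraph.Reachable.trans (SimpleGraph.Adj.reachable ?_) this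
      exact hab.1
  · intro h x hx y hy
    have := h ⟨x, hx⟩ ⟨y, hy⟩
    rw [SimpleGraph.reachable_iff_reflTransGen] at this
    exact ReflTransGen.lift (p := fun a b => G.Adj a b ∧ a ∈ S ∧ b ∈ S) Subtype.val
      (fun a b hab => ⟨hab, a.2, b.2⟩) _ _ this

/-- A nonempty set which is connected and stays connected after removing any vertex. -/
def BiconnSet (G : SimpleGraph V) (S : Set V) : Prop :=
  S.Nonempty ∧ ConnSet G S ∧ ∀ x, ConnSet G (S \ {x})

theorem biconnSet_iff : BiconnSet G S ↔ BiconnectedSet G S := by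
  unfold BiconnSet BiconnectedSet
  rw [SimpleGraph.connected_iff, ← connSet_iff, Set.nonempty_coe_sort]
  constructor
  · rintro ⟨h1, h2, h3⟩
    exact ⟨⟨h2, h1⟩, fun x _ => connSet_iff.1 (h3 x)⟩
  · rintro ⟨⟨h1, h2⟩, h3⟩
    refine ⟨h2, h1, fun x => ?_⟩
    by_cases hx : x ∈ S
    · exact connSet_iff.2 (h3 x hx)
    · rwa [Set.sdiff_singleton_eq_self hx]

theorem ConnSet.of_base {B : Set V} (hB : ConnSet G B) (hBT : B ⊆ T)
    (h : ∀ y ∈ T, ∃ b ∈ B, Rch G T y b) : ConnSet G T := by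
  intro x hx y hy
  obtain ⟨b, hb, hxb⟩ := h x hx
  obtain ⟨b', hb', hyb⟩ := h y hy
  exact hxb.trans (((hB b hb b' hb').mono hBT).trans hyb.symm)

theorem rch_seq {u : ℕ → V} {i j : ℕ} (hij : i ≤ j)
    (hadj : ∀ k, i ≤ k → k < j → G.Adj (u k) (u (k + 1))) (hS : ∀ k, i ≤ k → k ≤ j → u k ∈ S) :
    Rch G S (u i) (u j) := by
  induction j, hij using Nat.le_induction with
  | base => exact ReflTransGen.refl
  | succ j hij ih =>
    refine (ih (fun k h1 h2 => hadj k h1 (by omega)) (fun k h1 h2 => hS k h1 (by omega))).trans ?_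
    exact Rch.of_adj (hadj j hij (by omega)) (hS j hij (by omega)) (hS (j + 1) (by omega) le_rfl)

theorem BiconnSet.union_path {H : Set V} (hH : BiconnSet G H) {u : ℕ → V} {n : ℕ}
    (hinj : ∀ i j, i ≤ n → j ≤ n → u i = u j → i = j) (h0 : u 0 ∈ H) (hn : u n ∈ H)
    (hadj : ∀ i < n, G.Adj (u i) (u (i + 1))) : BiconnSet G (H ∪ {y | ∃ i ≤ n, y = u i}) := by
  refine ⟨hH.1.mono subset_union_left, hH.2.1.of_base subset_union_left ?_, fun x =>
    (hH.2.2 x).of_base (sdiff_subset_sdiff_left subset_union_left) ?_⟩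
  · rintro y (hy | ⟨i, hi, rfl⟩)
    · exact ⟨y, hy, ReflTransGen.refl⟩
    · refine ⟨u 0, h0, (rch_seq (Nat.zero_le i) (fun k _ hk => hadj k (by omega))
        fun k _ hk => Or.inr ⟨k, by omega, rfl⟩).symm⟩
  · rintro y ⟨hy | ⟨i, hi, rfl⟩, hyx⟩
    · exact ⟨y, ⟨hy, hyx⟩, ReflTransGen.refl⟩
    · by_cases hx : ∃ j < i, x = u j
      · obtain ⟨j, hj, rfl⟩ := hx
        have key : ∀ k, i ≤ k → k ≤ n → u k ∉ ({u j} : Set V) := by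
          intro k h1 h2 h3
          have := hinj k j h2 (by omega) h3
          omega
        exact ⟨u n, ⟨hn, key n hi le_rfl⟩, rch_seq hi (fun k _ hk => hadj k (by omega))
          fun k h1 hk => ⟨Or.inr ⟨k, by omega, rfl⟩, key k h1 hk⟩⟩
      · push Not at hx
        have key : ∀ k, 0 ≤ k → k ≤ i → u k ∉ ({x} : Set V) := by
          intro k h1 h2 h3
          rcases h2.lt_or_eq with h | rfl
          · exact hx k h h3.symm
          · exact hyx h3
        exact ⟨u 0, ⟨h0, key 0 le_rfl (Nat.zero_le _)⟩, Rch.symm (rch_seq (Nat.zero_le i)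
          (fun k _ hk => hadj k (by omega))
          fun k h1 hk => ⟨Or.inr ⟨k, by omega, rfl⟩, key k h1 hk⟩)⟩

theorem ConnSet.of_clique (h : ∀ a ∈ S, ∀ b ∈ S, a ≠ b → G.Adj a b) : ConnSet G S := by
  intro x hx y hy
  by_cases hxy : x = y
  · subst hxy; exact ReflTransGen.refl
  · exact Rch.of_adj (h x hx y hy hxy) hx hy

theorem BiconnSet.of_clique (hne : S.Nonempty) (h : ∀ a ∈ S, ∀ b ∈ S, a ≠ b → G.Adj a b) :
    BiconnSet G S :=
  ⟨hne, ConnSet.of_clique h, fun _ => ConnSet.of_clique fun a ha b hb => h a ha.1 b hb.1⟩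

theorem BiconnSet.pair (h : G.Adj x y) : BiconnSet G {x, y} := by
  refine BiconnSet.of_clique ⟨x, by simp⟩ ?_
  rintro a (rfl | rfl) b (rfl | rfl) hab
  · exact absurd rfl hab
  · exact h
  · exact h.symm
  · exact absurd rfl hab

theorem BiconnSet.of_cycle {u : ℕ → V} {n : ℕ}
    (hinj : ∀ i j, i ≤ n → j ≤ n → u i = u j → i = j)
    (hadj : ∀ i < n, G.Adj (u i) (u (i + 1))) (hcl : G.Adj (u 0) (u n)) :
    BiconnSet G {y | ∃ i ≤ n, y = u i} := by
  have := (BiconnSet.pair hcl).union_path hinj (by simp) (by simp) hadj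
  rwa [Set.union_eq_self_of_subset_left] at this
  rintro y (rfl | rfl)
  · exact ⟨0, Nat.zero_le _, rfl⟩
  · exact ⟨n, le_rfl, rfl⟩

theorem BiconnSet.sUnion {F : Set (Set V)} {p q : V} (hpq : p ≠ q) (hne : F.Nonempty)
    (hF : ∀ S ∈ F, BiconnSet G S ∧ p ∈ S ∧ q ∈ S) : BiconnSet G (⋃₀ F) := by
  obtain ⟨S0, hS0⟩ := hne
  have hsub : ∀ S ∈ F, S ⊆ ⋃₀ F := fun S hS => subset_sUnion_of_mem hS
  refine ⟨⟨p, S0, hS0, (hF S0 hS0).2.1⟩, ?_, fun x => ?_⟩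
  · refine ConnSet.of_base (B := S0) (hF S0 hS0).1.2.1 (hsub _ hS0) ?_
    rintro y ⟨S, hS, hy⟩
    exact ⟨p, (hF S0 hS0).2.1, ((hF S hS).1.2.1 y hy p (hF S hS).2.1).mono (hsub S hS)⟩
  · refine ConnSet.of_base (B := S0 \ {x}) ((hF S0 hS0).1.2.2 x)
      (sdiff_subset_sdiff_left (hsub _ hS0)) ?_
    rintro y ⟨⟨S, hS, hy⟩, hyx⟩
    obtain ⟨r, hr, hrx⟩ : ∃ r, (∀ S ∈ F, r ∈ S) ∧ r ∉ ({x} : Set V) := by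
      by_cases hp : p = x
      · exact ⟨q, fun S hS => (hF S hS).2.2, fun h => hpq (hp.trans (Eq.symm h))⟩
      · exact ⟨p, fun S hS => (hF S hS).2.1, hp⟩
    exact ⟨r, ⟨hr _ hS0, hrx⟩, ((hF S hS).1.2.2 x y ⟨hy, hyx⟩ r ⟨hr _ hS, hrx⟩).mono
      (sdiff_subset_sdiff_left (hsub S hS))⟩

end InsideReach

section Choosability

open Relation Set

variable {V : Type*}

/-- `S` admits a proper coloring from the lists `L`. -/
def ColS (G : SimpleGraph V) (S : Set V) (L : V → Finset ℝ) : Prop :=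
  ∃ c : V → ℝ, (∀ x ∈ S, c x ∈ L x) ∧ ∀ x ∈ S, ∀ y ∈ S, G.Adj x y → c x ≠ c y

/-- The number of neighbors of `x` in `S`. -/
noncomputable def degS (G : SimpleGraph V) (S : Set V) (x : V) : ℕ :=
  (G.neighborSet x ∩ S).ncard

/-- Every assignment of lists to `S` at least as large as the degrees inside `S` admits
a coloring. -/
def ChoosableSet (G : SimpleGraph V) (S : Set V) : Prop :=
  ∀ L : V → Finset ℝ, (∀ x ∈ S, degS G S x ≤ (L x).card) → ColS G S L

variable {G : SimpleGraph V} {S T H : Set V} {L : V → Finset ℝ} {x y v : V}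

theorem degS_mono (hS : S.Finite) (h : T ⊆ S) (x : V) : degS G T x ≤ degS G S x :=
  ncard_le_ncard (inter_subset_inter_right _ h) (hS.inter_of_right _)

theorem degS_lt (hS : S.Finite) (h : T ⊆ S) (hy : y ∈ S) (hyT : y ∉ T) (hxy : G.Adj x y) :
    degS G T x < degS G S x := by
  refine ncard_lt_ncard ?_ (hS.inter_of_right _)
  refine ⟨inter_subset_inter_right _ h, fun hh => hyT (hh ⟨hxy, hy⟩).2⟩

theorem exists_residual (hS : S.Finite) {A : Set V} (hA : A ⊆ S) {c : V → ℝ}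
    (hcL : ∀ x ∈ A, c x ∈ L x) (hc : ∀ x ∈ A, ∀ y ∈ A, G.Adj x y → c x ≠ c y) :
    ∃ L' : V → Finset ℝ, (∀ x, (L x).card + degS G (S \ A) x ≤ (L' x).card + degS G S x) ∧
      (∀ x, (∀ a ∈ A, G.Adj x a → c a ∉ L x) → L' x = L x) ∧
      (ColS G (S \ A) L' → ColS G S L) := by
  classical
  have hAf : A.Finite := hS.subset hA
  let F : V → Finset ℝ := fun x => ((hAf.inter_of_right (G.neighborSet x)).toFinset.image c)
  have hF : ∀ x t, t ∈ F x ↔ ∃ a ∈ A, G.Adj x a ∧ c a = t := by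
    intro x t
    simp only [F, Finset.mem_image, Finite.mem_toFinset, mem_inter_iff,
      SimpleGraph.mem_neighborSet]
    grind
  refine ⟨fun x => L x \ F x, fun x => ?_, fun x hx => ?_, ?_⟩
  · have h1 : degS G S x = degS G (S \ A) x + (G.neighborSet x ∩ A).ncard := by
      unfold degS
      rw [← ncard_union_eq _ ((hS.sdiff).inter_of_right _) (hAf.inter_of_right _)]
      · congr 1
        ext z
        have := @hA z
        simp only [mem_inter_iff, mem_union, mem_sdiff]
        tauto
      · rw [Set.disjoint_left]
        rintro z ⟨_, _, h⟩ ⟨_, h'⟩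
        exact h h'
    have h2 : (F x).card ≤ (G.neighborSet x ∩ A).ncard := by
      rw [ncard_eq_toFinset_card _ (hAf.inter_of_right (G.neighborSet x))]
      exact Finset.card_image_le
    have h3 := Finset.le_card_sdiff (F x) (L x)
    dsimp only
    omega
  · dsimp only
    rw [Finset.sdiff_eq_self_iff_disjoint, Finset.disjoint_left]
    intro t ht h
    obtain ⟨a, ha, hxa, rfl⟩ := (hF x t).1 h
    exact hx a ha hxa ht
  · rintro ⟨d, hd1, hd2⟩
    refine ⟨fun x => if x ∈ A then c x else d x, fun x hx => ?_, fun x hx y hy hxy => ?_⟩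
    · by_cases h : x ∈ A
      · simpa [h] using hcL x h
      · simpa [h] using (Finset.mem_sdiff.1 (hd1 x ⟨hx, h⟩)).1
    · have key : ∀ a ∈ A, ∀ z ∈ S \ A, G.Adj z a → c a ≠ d z := by
        intro a ha z hz hza h
        exact (Finset.mem_sdiff.1 (hd1 z hz)).2 ((hF _ _).2 ⟨a, ha, hza, h⟩)
      by_cases h : x ∈ A <;> by_cases h' : y ∈ A
      · simpa [h, h'] using hc x h y h' hxy
      · simpa [h, h'] using key x h y ⟨hy, h'⟩ hxy.symm
      · simpa [h, h'] using (key y h' x ⟨hx, h⟩ hxy).symm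
      · simpa [h, h'] using hd2 x ⟨hx, h⟩ y ⟨hy, h'⟩ hxy

theorem ColS.insert_last (hS : S.Finite) (hv : v ∈ S) (h : ColS G (S \ {v}) L)
    (hd : degS G S v < (L v).card) : ColS G S L := by
  obtain ⟨c, hc1, hc2⟩ := h
  obtain ⟨L', h1, -, h3⟩ := exists_residual hS sdiff_subset hc1 hc2
  refine h3 ?_
  have hne : (L' v).Nonempty := by
    rw [← Finset.card_pos]
    have := h1 v
    omega
  obtain ⟨t, ht⟩ := hne
  have : S \ (S \ {v}) = {v} := by
    rw [sdiff_sdiff_right_self]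
    ext z
    simp only [mem_inter_iff, mem_singleton_iff]
    grind
  rw [this]
  refine ⟨fun _ => t, ?_, ?_⟩
  · rintro x rfl
    exact ht
  · rintro x rfl y rfl h
    exact absurd h (G.irrefl)

theorem colS_of_strict (hS : S.Finite) (hd : ∀ x ∈ S, degS G S x ≤ (L x).card)
    (h : ∀ x ∈ S, ∃ v ∈ S, degS G S v < (L v).card ∧ Rch G S x v) : ColS G S L := by
  induction hn : S.ncard generalizing S with
  | zero =>
    rw [ncard_eq_zero hS] at hn
    subst hn
    exact ⟨fun _ => 0, by simp, by simp⟩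
  | succ n ih =>
    obtain ⟨x, hx⟩ : S.Nonempty := by
      rw [← ncard_pos hS]; omega
    obtain ⟨v, hv, hvd, -⟩ := h x hx
    refine ColS.insert_last hS hv (ih hS.sdiff (fun x hx =>
      (degS_mono hS sdiff_subset x).trans (hd x hx.1)) ?_ ?_) hvd
    · intro x hx
      obtain ⟨w, hw, hwd, hxw⟩ := h x hx.1
      induction hxw using ReflTransGen.head_induction_on with
      | refl => exact ⟨w, hx, (degS_mono hS sdiff_subset w).trans_lt hwd, ReflTransGen.refl⟩
      | @head a b hab _ ih =>
        by_cases hb : b = v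
        · subst hb
          exact ⟨a, hx, (degS_lt hS sdiff_subset hab.2.2 (by simp) hab.1).trans_le
            (hd a hx.1), ReflTransGen.refl⟩
        · obtain ⟨w', h1, h2, h3⟩ := ih ⟨hab.2.2, hb⟩
          exact ⟨w', h1, h2, (Rch.of_adj hab.1 hx ⟨hab.2.2, hb⟩).trans h3⟩
    · have := ncard_sdiff_singleton_add_one hv hS
      omega

theorem ChoosableSet.mono (hH : H.Finite) (hc : ConnSet G H) (hSH : S ⊆ H) (hne : S.Nonempty)
    (hS : ChoosableSet G S) : ChoosableSet G H := by
  intro L hL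
  have h1 : ColS G (H \ S) L := by
    refine colS_of_strict hH.sdiff (fun x hx => (degS_mono hH sdiff_subset x).trans (hL x hx.1)) ?_
    intro x hx
    obtain ⟨s, hs⟩ := hne
    have hxs := hc x hx.1 s (hSH hs)
    induction hxs using ReflTransGen.head_induction_on with
    | refl => exact absurd hs hx.2
    | @head a b hab _ ih =>
      by_cases hb : b ∈ S
      · exact ⟨a, hx, (degS_lt hH sdiff_subset hab.2.2 (by simp [hb]) hab.1).trans_le
          (hL a hx.1), ReflTransGen.refl⟩
      · obtain ⟨w', h1, h2, h3⟩ := ih ⟨hab.2.2, hb⟩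
        exact ⟨w', h1, h2, (Rch.of_adj hab.1 hx ⟨hab.2.2, hb⟩).trans h3⟩
  obtain ⟨c, hc1, hc2⟩ := h1
  obtain ⟨L', h1, -, h3⟩ := exists_residual hH sdiff_subset hc1 hc2
  rw [sdiff_sdiff_cancel_left hSH] at h1 h3
  refine h3 (hS L' fun x hx => ?_)
  have := h1 x
  have := hL x (hSH hx)
  omega

theorem BiconnSet.regular_of_not_choosable (hH : H.Finite) (hB : BiconnSet G H)
    (hn : ¬ ChoosableSet G H) :
    ∃ F : Finset ℝ, (∀ x ∈ H, degS G H x = F.card) ∧ ¬ ColS G H fun _ => F := by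
  unfold ChoosableSet at hn
  push Not at hn
  obtain ⟨L, hL, hcol⟩ := hn
  have hreg : ∀ x ∈ H, degS G H x = (L x).card := by
    intro v hv
    by_contra h
    exact hcol (colS_of_strict hH hL fun x hx =>
      ⟨v, hv, lt_of_le_of_ne (hL v hv) h, hB.2.1 x hx v hv⟩)
  have hsub : ∀ u ∈ H, ∀ v ∈ H, G.Adj v u → L v ⊆ L u := by
    intro u hu v hv hvu t ht
    by_contra htu
    obtain ⟨L', h1, h2, h3⟩ := exists_residual (L := L) (S := H) (A := {v}) (G := G)
      (c := fun _ => t) hH (by simpa using hv) (by simpa using ht) (by simp)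
    refine hcol (h3 (colS_of_strict hH.sdiff (fun x hx => ?_) fun x hx => ?_))
    · have := h1 x
      have := hL x hx.1
      omega
    · have huv : u ∈ H \ {v} := ⟨hu, fun h => hvu.ne h.symm⟩
      refine ⟨u, huv, ?_, hB.2.2 v x hx u huv⟩
      rw [h2 u (by simpa using fun _ => htu)]
      exact (degS_lt hH sdiff_subset hv (by simp) hvu.symm).trans_le (hL u hu)
  have hconst : ∀ x y, x ∈ H → Rch G H x y → L x = L y := by
    intro x y hx h
    induction h with
    | refl => rfl
    | tail _ hab ih =>
      exact ih.trans ((hsub _ hab.2.2 _ hab.2.1 hab.1).antisymm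
        (hsub _ hab.2.1 _ hab.2.2 hab.1.symm))
  obtain ⟨x0, hx0⟩ := hB.1
  refine ⟨L x0, fun x hx => ?_, ?_⟩
  · rw [hreg x hx, hconst x0 x hx0 (hB.2.1 x0 hx0 x hx)]
  · rintro ⟨c, hc1, hc2⟩
    refine hcol ⟨c, fun x hx => ?_, hc2⟩
    rw [← hconst x0 x hx0 (hB.2.1 x0 hx0 x hx)]
    exact hc1 x hx

end Choosability

section Ears

open Relation Set

variable {V : Type*}

/-- `u 0, …, u (m + 1)` is a walk between distinct points of `H` whose inner points lie in
`S \ H`. -/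
def IsEar (G : SimpleGraph V) (S H : Set V) (m : ℕ) (u : ℕ → V) : Prop :=
  1 ≤ m ∧ u 0 ∈ H ∧ u (m + 1) ∈ H ∧ u 0 ≠ u (m + 1) ∧
    (∀ i, 1 ≤ i → i ≤ m → u i ∈ S \ H) ∧ ∀ i ≤ m, G.Adj (u i) (u (i + 1))

variable {G : SimpleGraph V} {S H : Set V}

theorem ConnSet.exists_adj_diff (hS : ConnSet G S) (hHS : H ⊆ S) (hH : H.Nonempty)
    (hne : H ≠ S) : ∃ v ∈ S \ H, ∃ a ∈ H, G.Adj v a := by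
  obtain ⟨y, hy, hyH⟩ := exists_of_ssubset (hHS.ssubset_of_ne hne)
  obtain ⟨h, hh⟩ := hH
  have := hS y hy h (hHS hh)
  induction this using ReflTransGen.head_induction_on with
  | refl => exact absurd hh hyH
  | @head a b hab _ ih =>
    by_cases hb : b ∈ H
    · exact ⟨a, ⟨hab.2.1, hyH⟩, b, hb, hab.1⟩
    · exact ih hab.2.2 hb

theorem BiconnSet.exists_ear (hS : BiconnSet G S) (hHS : H ⊆ S) (hH : H.Nontrivial)
    (hne : H ≠ S) : ∃ m u, IsEar G S H m u := by
  obtain ⟨v, hv, a, ha, hva⟩ := hS.2.1.exists_adj_diff hHS hH.nonempty hne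
  obtain ⟨b, hb, hba⟩ := hH.exists_ne a
  have hr := hS.2.2 a v ⟨hv.1, fun h => hv.2 (h ▸ ha)⟩ b ⟨hHS hb, hba⟩
  suffices h : ∃ (m : ℕ) (w : ℕ → V), w 0 = v ∧ (∀ i ≤ m, w i ∈ S \ H) ∧ w (m + 1) ∈ H \ {a} ∧
      ∀ i ≤ m, G.Adj (w i) (w (i + 1)) by
    obtain ⟨m, w, h0, h1, h2, h3⟩ := h
    refine ⟨m + 1, fun i => Nat.casesOn i a w, by omega, ha, h2.1, fun h => h2.2 (Eq.symm h),
      ?_, ?_⟩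
    · rintro (_ | i) h4 h5
      · omega
      · exact h1 i (by omega)
    · rintro (_ | i) h4
      · simpa [h0] using hva.symm
      · exact h3 i (by omega)
  clear hva
  induction hr using ReflTransGen.head_induction_on with
  | refl => exact absurd hb hv.2
  | @head x y hxy _ ih =>
    by_cases hy : y ∈ H
    · refine ⟨0, fun i => Nat.casesOn i x fun _ => y, rfl, ?_, ⟨hy, hxy.2.2.2⟩, ?_⟩
      · rintro i hi
        obtain rfl : i = 0 := by omega
        exact hv
      · rintro i hi
        obtain rfl : i = 0 := by omega
        exact hxy.1
    · obtain ⟨m, w, h0, h1, h2, h3⟩ := ih ⟨hxy.2.2.1, hy⟩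
      refine ⟨m + 1, fun i => Nat.casesOn i x w, rfl, ?_, h2, ?_⟩
      · rintro (_ | i) hi
        · exact hv
        · exact h1 i (by omega)
      · rintro (_ | i) hi
        · simpa [h0] using hxy.1
        · exact h3 i (by omega)

/-- An ear of minimal length. -/
def IsMinEar (G : SimpleGraph V) (S H : Set V) (m : ℕ) (u : ℕ → V) : Prop :=
  IsEar G S H m u ∧ ∀ m' u', IsEar G S H m' u' → m ≤ m'

theorem BiconnSet.exists_minEar (hS : BiconnSet G S) (hHS : H ⊆ S) (hH : H.Nontrivial)
    (hne : H ≠ S) : ∃ m u, IsMinEar G S H m u := by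
  classical
  have h := hS.exists_ear hHS hH hne
  obtain ⟨u, hu⟩ := Nat.find_spec h
  exact ⟨Nat.find h, u, hu, fun m' u' h' => Nat.find_min' h ⟨u', h'⟩⟩

variable {m : ℕ} {u : ℕ → V}

theorem IsMinEar.chord (h : IsMinEar G S H m u) {i j : ℕ} (hij : i + 2 ≤ j) (hj : j ≤ m + 1)
    (hadj : G.Adj (u i) (u j)) : i = 0 ∧ j = m + 1 := by
  obtain ⟨⟨h1, h2, h3, h4, h5, h6⟩, hmin⟩ := h
  by_contra hne
  have hm := hmin (m - (j - i - 1)) (fun k => if k ≤ i then u k else u (k + (j - i - 1)))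
    ⟨by omega, by simpa using h2, ?_, ?_, fun k hk1 hk2 => ?_, fun k hk => ?_⟩
  · omega
  · have e : m - (j - i - 1) + 1 + (j - i - 1) = m + 1 := by omega
    simp only [e, if_neg (show ¬ m - (j - i - 1) + 1 ≤ i by omega)]
    exact h3
  · have e : m - (j - i - 1) + 1 + (j - i - 1) = m + 1 := by omega
    simp only [e, if_neg (show ¬ m - (j - i - 1) + 1 ≤ i by omega)]
    exact h4
  · dsimp only
    split_ifs with hki
    · exact h5 k hk1 (by omega)
    · exact h5 _ (by omega) (by omega)
  · dsimp only
    by_cases hki : k < i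
    · rw [if_pos (by omega), if_pos (by omega)]
      exact h6 k (by omega)
    · by_cases hki' : k = i
      · subst hki'
        rw [if_pos le_rfl, if_neg (by omega), show k + 1 + (j - k - 1) = j by omega]
        exact hadj
      · rw [if_neg (by omega), if_neg (by omega), show k + 1 + (j - i - 1) = k + (j - i - 1) + 1
          by omega]
        exact h6 _ (by omega)

theorem IsMinEar.injOn (h : IsMinEar G S H m u) : ∀ i j, i ≤ m + 1 → j ≤ m + 1 →
    u i = u j → i = j := by
  have key : ∀ i j, i < j → j ≤ m + 1 → u i ≠ u j := by
    intro i j hij hj he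
    obtain ⟨h1, h2, h3, h4, h5, h6⟩ := h.1
    by_cases hi : i = 0
    · subst hi
      by_cases hj' : j = m + 1
      · subst hj'
        exact h4 he
      · exact (h5 j (by omega) (by omega)).2 (he ▸ h2)
    · by_cases hj' : j = m + 1
      · subst hj'
        exact (h5 i (by omega) (by omega)).2 (he ▸ h3)
      · have := h.chord (i := i) (j := j + 1) (by omega) (by omega) (he ▸ h6 j (by omega))
        omega
  intro i j hi hj he
  rcases lt_trichotomy i j with hlt | heq | hgt
  · exact absurd he (key i j hlt hj)
  · exact heq
  · exact absurd he.symm (key j i hgt hi)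

theorem IsMinEar.first (h : IsMinEar G S H m u) (hm : 2 ≤ m) {a : V} (ha : a ∈ H)
    (hadj : G.Adj (u 1) a) : a = u 0 := by
  obtain ⟨⟨h1, h2, h3, h4, h5, h6⟩, hmin⟩ := h
  by_contra hne
  have := hmin 1 (fun k => if k ≤ 1 then u k else a) ⟨le_rfl, by simpa using h2, by simpa using ha,
    by simpa using Ne.symm hne, ?_, ?_⟩
  · omega
  · intro i hi1 hi2
    obtain rfl : i = 1 := by omega
    simpa using h5 1 le_rfl (by omega)
  · intro i hi
    obtain rfl | rfl : i = 0 ∨ i = 1 := by omega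
    · simpa using h6 0 (by omega)
    · simpa using hadj

end Ears

section BlockClassification

open Relation Set

variable {V : Type*} {G : SimpleGraph V} {S H : Set V} {m : ℕ} {u : ℕ → V}

theorem IsEar.union_subset (h : IsEar G S H m u) (hHS : H ⊆ S) :
    H ∪ {y | ∃ i ≤ m + 1, y = u i} ⊆ S := by
  obtain ⟨h1, h2, h3, h4, h5, h6⟩ := h
  rintro y (hy | ⟨i, hi, rfl⟩)
  · exact hHS hy
  · by_cases h0 : i = 0
    · subst h0; exact hHS h2
    · by_cases hm : i = m + 1
      · subst hm; exact hHS h3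
      · exact (h5 i (by omega) (by omega)).1

theorem finite_path_set (n : ℕ) (u : ℕ → V) : {y | ∃ i ≤ n, y = u i}.Finite := by
  refine ((Set.finite_Iic n).image u).subset ?_
  rintro y ⟨i, hi, rfl⟩
  exact ⟨i, hi, rfl⟩

theorem BiconnSet.clique_insert (hS : BiconnSet G S)
    (hno : ∀ K ⊆ S, K.Finite → K.Nonempty → ¬ ChoosableSet G K)
    (hH : BiconnSet G H) (hHf : H.Finite) (hHS : H ⊆ S) (hne : H ≠ S)
    (hdeg : ∃ a ∈ H, 2 ≤ degS G H a) :
    ∃ v ∈ S \ H, ∀ a ∈ insert v H, ∀ b ∈ insert v H, a ≠ b → G.Adj a b := by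
  obtain ⟨F, hF, -⟩ := hH.regular_of_not_choosable hHf (hno H hHS hHf hH.1)
  have hnt : H.Nontrivial := by
    obtain ⟨a, ha, hd⟩ := hdeg
    have : degS G H a ≤ H.ncard := ncard_le_ncard inter_subset_right hHf
    obtain ⟨p, q, hp, hq, hpq⟩ := (one_lt_ncard_iff hHf).1 (by omega)
    exact ⟨p, hp, q, hq, hpq⟩
  obtain ⟨m, u, hu⟩ := hS.exists_minEar hHS hnt hne
  have hinj := hu.injOn
  obtain ⟨h1, h2, h3, h4, h5, h6⟩ := hu.1
  set H' := H ∪ {y | ∃ i ≤ m + 1, y = u i} with hH'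
  have hH'S : H' ⊆ S := hu.1.union_subset hHS
  have hH'f : H'.Finite := hHf.union (finite_path_set _ _)
  have hH'b : BiconnSet G H' := hH.union_path hinj h2 h3 fun i hi => h6 i (by omega)
  obtain ⟨F', hF', -⟩ := hH'b.regular_of_not_choosable hH'f (hno H' hH'S hH'f hH'b.1)
  have hHH' : H ⊆ H' := subset_union_left
  have hu1 : u 1 ∈ H' := Or.inr ⟨1, by omega, rfl⟩
  have hk : F.card < F'.card := by
    rw [← hF (u 0) h2, ← hF' (u 0) (hHH' h2)]
    exact degS_lt hH'f hHH' hu1 (h5 1 le_rfl h1).2 (h6 0 (by omega))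
  have hk2 : 2 ≤ F.card := by
    obtain ⟨a, ha, hd⟩ := hdeg
    rwa [hF a ha] at hd
  have hm1 : m = 1 := by
    by_contra hm
    have hsub : G.neighborSet (u 1) ∩ H' ⊆ {u 0, u 2} := by
      rintro z ⟨hz, hz' | ⟨i, hi, rfl⟩⟩
      · exact Or.inl (hu.first (by omega) hz' hz)
      · have hz : G.Adj (u 1) (u i) := hz
        by_contra hcon
        simp only [mem_insert_iff, mem_singleton_iff, not_or] at hcon
        have hi0 : i ≠ 0 := by rintro rfl; exact hcon.1 rfl
        have hi1 : i ≠ 1 := by rintro rfl; exact hz.ne rfl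
        have hi2 : i ≠ 2 := by rintro rfl; exact hcon.2 rfl
        have := hu.chord (by omega) hi hz
        omega
    have : degS G H' (u 1) ≤ 2 := (ncard_le_ncard hsub (by simp)).trans
      ((ncard_insert_le _ _).trans (by simp))
    rw [hF' _ hu1] at this
    omega
  subst hm1
  refine ⟨u 1, h5 1 le_rfl le_rfl, ?_⟩
  have hH'2 : H' = insert (u 1) H := by
    ext y
    simp only [hH', mem_union, mem_insert_iff, mem_ofPred_eq]
    constructor
    · rintro (hy | ⟨i, hi, rfl⟩)
      · exact Or.inr hy
      · interval_cases i
        · exact Or.inr h2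
        · exact Or.inl rfl
        · exact Or.inr h3
    · rintro (rfl | hy)
      · exact Or.inr ⟨1, by omega, rfl⟩
      · exact Or.inl hy
  have hadj : ∀ h ∈ H, G.Adj (u 1) h := by
    intro h hh
    by_contra hcon
    have : degS G H' h = degS G H h := by
      unfold degS
      congr 1
      rw [hH'2]
      ext z
      simp only [mem_inter_iff, SimpleGraph.mem_neighborSet, mem_insert_iff]
      constructor
      · rintro ⟨hz, rfl | hz'⟩
        · exact absurd hz.symm hcon
        · exact ⟨hz, hz'⟩
      · rintro ⟨hz, hz'⟩
        exact ⟨hz, Or.inr hz'⟩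
    rw [hF' h (hHH' hh), hF h hh] at this
    omega
  have hcard : H.ncard = F'.card := by
    rw [← hF' _ hu1]
    unfold degS
    congr 1
    rw [hH'2]
    ext z
    simp only [mem_inter_iff, SimpleGraph.mem_neighborSet, mem_insert_iff]
    constructor
    · exact fun hz => ⟨hadj z hz, Or.inr hz⟩
    · rintro ⟨hz, rfl | hz'⟩
      · exact absurd rfl hz.ne
      · exact hz'
  have hle : F'.card ≤ F.card + 1 := by
    rw [← hF (u 0) h2, ← hF' (u 0) (hHH' h2)]
    refine (ncard_le_ncard (t := insert (u 1) (G.neighborSet (u 0) ∩ H)) ?_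
      ((hHf.inter_of_right _).insert _)).trans (ncard_insert_le _ _)
    rw [hH'2]
    rintro z ⟨hz, rfl | hz'⟩
    · exact Or.inl rfl
    · exact Or.inr ⟨hz, hz'⟩
  have hcl : ∀ a ∈ H, ∀ b ∈ H, a ≠ b → G.Adj a b := by
    intro a ha b hb hab
    have e : G.neighborSet a ∩ H = H \ {a} := by
      refine eq_of_subset_of_ncard_le (fun z hz => ⟨hz.2, fun h => hz.1.ne (Eq.symm h)⟩) ?_
        hHf.sdiff
      have e1 := hF a ha
      unfold degS at e1
      have := ncard_sdiff_singleton_add_one ha hHf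
      omega
    have : b ∈ G.neighborSet a ∩ H := e ▸ ⟨hb, fun h => hab (Eq.symm h)⟩
    exact this.1
  rintro a (rfl | ha) b (rfl | hb) hab
  · exact absurd rfl hab
  · exact hadj b hb
  · exact (hadj a ha).symm
  · exact hcl a ha b hb hab

theorem BiconnSet.isClique_of_clique (hlf : ∀ x, (G.neighborSet x).Finite) (hS : BiconnSet G S)
    (hno : ∀ K ⊆ S, K.Finite → K.Nonempty → ¬ ChoosableSet G K) {K : Set V} (hK : K ⊆ S)
    (hKc : ∀ a ∈ K, ∀ b ∈ K, a ≠ b → G.Adj a b) (hKf : K.Finite) (h3 : 3 ≤ K.ncard) :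
    G.IsClique S := by
  obtain ⟨a, ha⟩ : K.Nonempty := by rw [← ncard_pos hKf]; omega
  by_contra hcon
  have hstep : ∀ n, ∃ K : Set V, a ∈ K ∧ K ⊆ S ∧ K.Finite ∧ n + 3 ≤ K.ncard ∧
      ∀ a ∈ K, ∀ b ∈ K, a ≠ b → G.Adj a b := by
    intro n
    induction n with
    | zero => exact ⟨K, ha, hK, hKf, by omega, hKc⟩
    | succ n ih =>
      obtain ⟨K, ha, hK, hKf, h3, hKc⟩ := ih
      have hdeg : 2 ≤ degS G K a := by
        have e : K \ {a} ⊆ G.neighborSet a ∩ K := fun z hz =>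
          ⟨hKc a ha z hz.1 fun h => hz.2 (Eq.symm h), hz.1⟩
        have h4 := ncard_le_ncard e (hKf.inter_of_right _)
        have := ncard_sdiff_singleton_add_one ha hKf
        unfold degS
        omega
      have hne : K ≠ S := by
        rintro rfl
        exact hcon fun a ha b hb hab => hKc a ha b hb hab
      obtain ⟨v, hv, hvc⟩ := hS.clique_insert hno (BiconnSet.of_clique ⟨a, ha⟩ hKc) hKf hK hne
        ⟨a, ha, hdeg⟩
      refine ⟨insert v K, Or.inr ha, insert_subset hv.1 hK, hKf.insert v, ?_, hvc⟩
      rw [ncard_insert_of_notMem hv.2 hKf]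
      omega
  obtain ⟨K, ha, hK, hKf, h3, hKc⟩ := hstep (G.neighborSet a).ncard
  have e : K \ {a} ⊆ G.neighborSet a := fun z hz =>
    hKc a ha z hz.1 fun h => hz.2 (Eq.symm h)
  have h4 := ncard_le_ncard e (hlf a)
  have := ncard_sdiff_singleton_add_one ha hKf
  omega

theorem oddCycleSet_of_seq (hm : 1 ≤ m) (hodd : Odd (m + 2))
    (hinj : ∀ i j, i ≤ m + 1 → j ≤ m + 1 → u i = u j → i = j)
    (hadj : ∀ i j, i < j → j ≤ m + 1 → (G.Adj (u i) (u j) ↔ j = i + 1 ∨ (i = 0 ∧ j = m + 1))) :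
    OddCycleSet G {y | ∃ i ≤ m + 1, y = u i} := by
  refine ⟨m + 2, hodd, by omega, ⟨RelIso.symm ⟨Equiv.ofBijective
    (fun i : Fin (m + 2) => (⟨u i, i, by omega, rfl⟩ : {y | ∃ i ≤ m + 1, y = u i}))
    ⟨fun i j hij => ?_, ?_⟩, ?_⟩⟩⟩
  · exact Fin.ext (hinj i j (by omega) (by omega) (congrArg Subtype.val hij))
  · rintro ⟨_, i, hi, rfl⟩
    exact ⟨⟨i, by omega⟩, rfl⟩
  · have key : ∀ i j : Fin (m + 2), i < j →
        (G.Adj (u i) (u j) ↔ (SimpleGraph.cycleGraph (m + 2)).Adj i j) := by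
      rintro ⟨i, hi⟩ ⟨j, hj⟩ hij
      have hij : i < j := hij
      rw [SimpleGraph.cycleGraph_adj', hadj i j hij (by omega), Fin.sub_def, Fin.sub_def]
      simp only
      have e1 : (m + 2 - i + j) % (m + 2) = j - i := by
        rw [show m + 2 - i + j = (j - i) + (m + 2) by omega, Nat.add_mod_right,
          Nat.mod_eq_of_lt (by omega)]
      have e2 : (m + 2 - j + i) % (m + 2) = m + 2 - j + i := Nat.mod_eq_of_lt (by omega)
      rw [e1, e2]
      omega
    intro i j
    change G.Adj (u i) (u j) ↔ _
    rcases lt_trichotomy i j with h | rfl | h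
    · exact key i j h
    · simp
    · rw [G.adj_comm, SimpleGraph.adj_comm _ i j]
      exact key j i h

theorem BiconnSet.classification (hlf : ∀ x, (G.neighborSet x).Finite) (hS : BiconnSet G S)
    (hno : ∀ K ⊆ S, K.Finite → K.Nonempty → ¬ ChoosableSet G K) :
    S.Finite ∧ (G.IsClique S ∨ OddCycleSet G S) := by
  suffices h : G.IsClique S ∨ S.Finite ∧ OddCycleSet G S by
    rcases h with h | h
    · refine ⟨?_, Or.inl h⟩
      obtain ⟨a, ha⟩ := hS.1
      refine ((hlf a).insert a).subset fun z hz => ?_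
      by_cases hza : z = a
      · exact Or.inl hza
      · exact Or.inr (h ha hz (Ne.symm hza))
    · exact ⟨h.1, Or.inr h.2⟩
  by_contra! hcon
  obtain ⟨hcl, hoc⟩ := hcon
  obtain ⟨a, ha, b, hb, hab⟩ : ∃ a ∈ S, ∃ b ∈ S, G.Adj a b := by
    obtain ⟨a, ha⟩ := hS.1
    obtain ⟨v, hv, a', ha', h⟩ := hS.2.1.exists_adj_diff (singleton_subset_iff.2 ha)
      (singleton_nonempty a) (by rintro rfl; exact hcl (by simp))
    obtain rfl : a' = a := ha'
    exact ⟨v, hv.1, a', ha, h⟩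
  have hpair : ({a, b} : Set V) ≠ S := by
    rintro rfl
    refine hcl ?_
    rw [SimpleGraph.isClique_pair]
    exact fun _ => hab
  have hpS : ({a, b} : Set V) ⊆ S := by
    rintro z (rfl | rfl) <;> assumption
  obtain ⟨m, u, hu⟩ := hS.exists_minEar hpS (nontrivial_pair hab.ne) hpair
  have hinj := hu.injOn
  obtain ⟨h1, h2, h3, h4, h5, h6⟩ := hu.1
  have hcl0 : G.Adj (u 0) (u (m + 1)) := by
    rcases h2 with e | e <;> rcases h3 with e' | e'
    · exact absurd (e.trans (Eq.symm e')) h4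
    · rw [e, show u (m + 1) = b from e']; exact hab
    · rw [show u 0 = b from e, e']; exact hab.symm
    · exact absurd (Eq.trans e (Eq.symm e')) h4
  set H : Set V := {y | ∃ i ≤ m + 1, y = u i} with hHdef
  have hHf : H.Finite := finite_path_set _ _
  have hHb : BiconnSet G H := BiconnSet.of_cycle hinj (fun i hi => h6 i (by omega)) hcl0
  have hHS : H ⊆ S := subset_union_right.trans (hu.1.union_subset hpS)
  have hdeg : 2 ≤ degS G H (u 0) := by
    have e : {u 1, u (m + 1)} ⊆ G.neighborSet (u 0) ∩ H := by
      rintro z (rfl | rfl)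
      · exact ⟨h6 0 (by omega), 1, by omega, rfl⟩
      · exact ⟨hcl0, m + 1, le_rfl, rfl⟩
    have e2 := ncard_le_ncard e (hHf.inter_of_right _)
    rwa [ncard_pair (fun h => by have := hinj _ _ (by omega) le_rfl h; omega)] at e2
  have hadj : ∀ i j, i < j → j ≤ m + 1 →
      (G.Adj (u i) (u j) ↔ j = i + 1 ∨ (i = 0 ∧ j = m + 1)) := by
    intro i j hij hj
    constructor
    · intro h
      by_cases hji : j = i + 1
      · exact Or.inl hji
      · exact Or.inr (hu.chord (by omega) hj h)
    · rintro (rfl | ⟨rfl, rfl⟩)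
      · exact h6 i (by omega)
      · exact hcl0
  have hu0 : u 0 ∈ H := ⟨0, Nat.zero_le _, rfl⟩
  by_cases hne : H = S
  · have hev : ¬ Odd (m + 2) := by
      intro hodd
      have hfin : S.Finite := hne ▸ hHf
      exact hoc hfin (hne ▸ oddCycleSet_of_seq h1 hodd hinj hadj)
    obtain ⟨F, hF, hF2⟩ := hHb.regular_of_not_choosable hHf (hno H hHS hHf hHb.1)
    have hFc : 1 < F.card := by rw [← hF _ hu0]; omega
    obtain ⟨s, hs, t, ht, hst⟩ := Finset.one_lt_card.1 hFc
    classical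
    have hidx : ∀ x : V, ∃ i, x ∈ H → i ≤ m + 1 ∧ x = u i := by
      intro x
      by_cases hx : x ∈ H
      · obtain ⟨i, hi⟩ := hx
        exact ⟨i, fun _ => hi⟩
      · exact ⟨0, fun h => absurd h hx⟩
    choose ι hι using hidx
    refine hF2 ⟨fun x => if Even (ι x) then s else t, fun x _ => ?_, fun x hx y hy hxy => ?_⟩
    · dsimp only
      split_ifs <;> assumption
    · obtain ⟨hi, hxi⟩ := hι x hx
      obtain ⟨hj, hyj⟩ := hι y hy
      have hev' : Even (m + 2) := Nat.not_odd_iff_even.1 hev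
      have par : Even (ι x) ↔ ¬ Even (ι y) := by
        generalize ι x = i at hi hxi
        generalize ι y = j at hj hyj
        subst hxi hyj
        rcases lt_trichotomy i j with h | rfl | h
        · rcases (hadj i j h hj).1 hxy with rfl | ⟨rfl, rfl⟩ <;> grind
        · exact absurd rfl hxy.ne
        · rcases (hadj j i h hi).1 hxy.symm with rfl | ⟨rfl, rfl⟩ <;> grind
      dsimp only
      by_cases hx' : Even (ι x)
      · rw [if_pos hx', if_neg (par.1 hx')]; exact hst
      · rw [if_neg hx', if_pos (by tauto)]; exact hst.symm
  · obtain ⟨v, hv, hvc⟩ := hS.clique_insert hno hHb hHf hHS hne ⟨u 0, hu0, hdeg⟩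
    refine hcl (hS.isClique_of_clique hlf hno (insert_subset hv.1 hHS) hvc (hHf.insert v) ?_)
    rw [ncard_insert_of_notMem hv.2 hHf]
    have : degS G H (u 0) ≤ H.ncard := ncard_le_ncard inter_subset_right hHf
    omega

end BlockClassification

section Transfer

open Relation Set

variable {V W : Type*} {G : SimpleGraph V} {G' : SimpleGraph W}

theorem degS_image {K : Set V} {f : V → W} (hf : InjOn f K)
    (hadj : ∀ a ∈ K, ∀ b ∈ K, (G.Adj a b ↔ G'.Adj (f a) (f b))) {x : V} (hx : x ∈ K) :
    degS G' (f '' K) (f x) = degS G K x := by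
  unfold degS
  rw [← (hf.mono inter_subset_right).ncard_image]
  congr 1
  ext z
  constructor
  · rintro ⟨hz, y, hy, rfl⟩
    exact ⟨y, ⟨(hadj x hx y hy).2 hz, hy⟩, rfl⟩
  · rintro ⟨y, ⟨hy, hyK⟩, rfl⟩
    exact ⟨(hadj x hx y hyK).1 hy, y, hyK, rfl⟩

theorem choosableSet_image {K : Set V} {f : V → W} (hf : InjOn f K)
    (hadj : ∀ a ∈ K, ∀ b ∈ K, (G.Adj a b ↔ G'.Adj (f a) (f b))) :
    ChoosableSet G' (f '' K) ↔ ChoosableSet G K := by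
  rcases K.eq_empty_or_nonempty with rfl | ⟨k, hk⟩
  · rw [image_empty]
    exact ⟨fun _ L _ => ⟨fun _ => 0, by simp, by simp⟩, fun _ L _ => ⟨fun _ => 0, by simp, by simp⟩⟩
  have : Nonempty V := ⟨k⟩
  have hinv : ∀ x ∈ K, Function.invFunOn f K (f x) = x := fun x hx => hf.leftInvOn_invFunOn hx
  constructor
  · intro h L hL
    obtain ⟨c, hc1, hc2⟩ := h (fun w => L (Function.invFunOn f K w)) (by
      rintro _ ⟨x, hx, rfl⟩
      rw [degS_image hf hadj hx, hinv x hx]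
      exact hL x hx)
    refine ⟨fun x => c (f x), fun x hx => ?_, fun x hx y hy hxy =>
      hc2 _ ⟨x, hx, rfl⟩ _ ⟨y, hy, rfl⟩ ((hadj x hx y hy).1 hxy)⟩
    have := hc1 (f x) ⟨x, hx, rfl⟩
    dsimp only at this
    rwa [hinv x hx] at this
  · intro h L hL
    obtain ⟨c, hc1, hc2⟩ := h (fun x => L (f x)) (fun x hx => by
      rw [← degS_image hf hadj hx]
      exact hL _ ⟨x, hx, rfl⟩)
    refine ⟨fun w => c (Function.invFunOn f K w), ?_, ?_⟩
    · rintro _ ⟨x, hx, rfl⟩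
      dsimp only
      rw [hinv x hx]
      exact hc1 x hx
    · rintro _ ⟨x, hx, rfl⟩ _ ⟨y, hy, rfl⟩ hxy
      dsimp only
      rw [hinv x hx, hinv y hy]
      exact hc2 x hx y hy ((hadj x hx y hy).2 hxy)

/-- No finite nonempty subset of the component of `x` is degree-choosable. -/
def Unchoosable (G : SimpleGraph V) (x : V) : Prop :=
  ∀ K : Set V, K.Finite → K.Nonempty → (∀ y ∈ K, G.Reachable x y) → ¬ ChoosableSet G K

theorem Rch.reachable {S : Set V} {x y : V} (h : Rch G S x y) : G.Reachable x y := by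
  rw [SimpleGraph.reachable_iff_reflTransGen]
  exact ReflTransGen.mono (r := fun a b => G.Adj a b ∧ a ∈ S ∧ b ∈ S)
    (p := fun a b => G.Adj a b) (fun _ _ h => h.1) _ _ h

theorem Unchoosable.biconn_finite (hlf : ∀ x, (G.neighborSet x).Finite) {x : V}
    (hx : Unchoosable G x) {S : Set V} (hS : BiconnSet G S) (hxS : x ∈ S) : S.Finite :=
  (hS.classification hlf fun K hK hKf hKn =>
    hx K hKf hKn fun y hy => (hS.2.1 x hxS y (hK hy)).reachable).1

theorem gallaiTree_of_unchoosable (hlf : ∀ x, (G.neighborSet x).Finite)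
    {c : G.ConnectedComponent} (h : ∀ x ∈ c.supp, Unchoosable G x) :
    GallaiTree (G.induce c.supp) := by
  refine ⟨c.connected_toSimpleGraph, fun S hS => ?_⟩
  refine (BiconnSet.classification (fun x => ?_) (biconnSet_iff.2 hS.1) ?_).2
  · refine Finite.of_finite_image ((hlf x).subset ?_) Subtype.val_injective.injOn
    rintro _ ⟨y, hy, rfl⟩
    exact hy
  · rintro K - hK ⟨k, hk⟩ hKc
    refine h k k.2 (Subtype.val '' K) (hK.image _) ⟨k, k, hk, rfl⟩ ?_ ?_
    · rintro _ ⟨y, -, rfl⟩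
      refine SimpleGraph.ConnectedComponent.exact ?_
      rw [SimpleGraph.ConnectedComponent.mem_supp_iff _ _ |>.1 k.2,
        SimpleGraph.ConnectedComponent.mem_supp_iff _ _ |>.1 y.2]
    · exact (choosableSet_image Subtype.val_injective.injOn fun a _ b _ => Iff.rfl).2 hKc

/-- There is a walk of length at most `n` from `x` to `y`. -/
def Near (G : SimpleGraph V) (n : ℕ) (x y : V) : Prop :=
  ∃ p : G.Walk x y, p.length ≤ n

variable {x y z : V} {m n : ℕ}

theorem Near.symm (h : Near G n x y) : Near G n y x := by
  obtain ⟨p, hp⟩ := h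
  exact ⟨p.reverse, by simpa using hp⟩

theorem Near.trans (h : Near G m x y) (h' : Near G n y z) : Near G (m + n) x z := by
  obtain ⟨p, hp⟩ := h
  obtain ⟨q, hq⟩ := h'
  exact ⟨p.append q, by simp; omega⟩

theorem Near.mono (h : Near G m x y) (hmn : m ≤ n) : Near G n x y := by
  obtain ⟨p, hp⟩ := h
  exact ⟨p, hp.trans hmn⟩

theorem Near.of_adj (h : G.Adj x y) : Near G 1 x y := ⟨h.toWalk, by simp⟩

theorem Near.refl (n : ℕ) (x : V) : Near G n x x := ⟨SimpleGraph.Walk.nil, by simp⟩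

theorem Near.reachable (h : Near G n x y) : G.Reachable x y := h.choose.reachable

theorem near_zero : Near G 0 x y ↔ x = y := by
  constructor
  · rintro ⟨p, hp⟩
    exact SimpleGraph.Walk.eq_of_length_eq_zero (Nat.le_zero.1 hp)
  · rintro rfl
    exact Near.refl _ _

theorem near_succ : Near G (n + 1) x y ↔ x = y ∨ ∃ z, G.Adj x z ∧ Near G n z y := by
  constructor
  · rintro ⟨p, hp⟩
    cases p with
    | nil => exact Or.inl rfl
    | cons h p => exact Or.inr ⟨_, h, p, by simpa using hp⟩
  · rintro (rfl | ⟨z, hz, h⟩)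
    · exact Near.refl _ _
    · exact ((Near.of_adj hz).trans h).mono (by omega)

theorem near_finite (hlf : ∀ x, (G.neighborSet x).Finite) (n : ℕ) (x : V) :
    {y | Near G n x y}.Finite := by
  induction n generalizing x with
  | zero => exact (finite_singleton x).subset fun y hy => (near_zero.1 hy).symm
  | succ n ih =>
    refine (((hlf x).biUnion fun z _ => ih z).insert x).subset fun y hy => ?_
    rcases near_succ.1 hy with rfl | ⟨z, hz, h⟩
    · exact Or.inl rfl
    · exact Or.inr (mem_biUnion hz h)

theorem connSet_ball (n : ℕ) (x : V) : ConnSet G {y | Near G n x y} := by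
  refine ConnSet.of_base (B := {x}) ?_ (singleton_subset_iff.2 (Near.refl n x)) ?_
  · rintro a rfl b rfl
    exact ReflTransGen.refl
  · intro y hy
    refine ⟨x, rfl, Rch.symm ?_⟩
    induction n generalizing y with
    | zero =>
      obtain rfl := near_zero.1 hy
      exact ReflTransGen.refl
    | succ n ih =>
      rcases near_succ.1 hy.symm with rfl | ⟨z, hz, h⟩
      · exact ReflTransGen.refl
      · exact ((ih z h.symm).mono fun w hw => Near.mono hw (by omega)).trans
          (Rch.of_adj hz.symm (h.symm.mono (by omega)) hy)

theorem exists_ball_choosable (hlf : ∀ x, (G.neighborSet x).Finite) (hx : ¬ Unchoosable G x) :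
    ∃ n, ∃ y, G.Reachable x y ∧ ChoosableSet G {z | Near G n y z} := by
  unfold Unchoosable at hx
  push Not at hx
  obtain ⟨K, hK, ⟨k, hk⟩, hKr, hKc⟩ := hx
  have h : ∀ y ∈ K, ∃ n, Near G n k y := fun y hy =>
    let ⟨p⟩ := (hKr k hk).symm.trans (hKr y hy)
    ⟨p.length, p, le_rfl⟩
  choose! N hN using h
  obtain ⟨M, hM⟩ := (hK.image N).bddAbove
  exact ⟨M, k, hKr k hk, hKc.mono (near_finite hlf M k) (connSet_ball M k)
    (fun y hy => (hN y hy).mono (hM ⟨y, hy, rfl⟩)) ⟨k, hk⟩⟩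

theorem not_unchoosable_of_ball (hlf : ∀ x, (G.neighborSet x).Finite) (hxy : G.Reachable x y)
    (h : ChoosableSet G {z | Near G n y z}) : ¬ Unchoosable G x := fun hx =>
  hx _ (near_finite hlf n y) ⟨y, Near.refl n y⟩ (fun _ hz => hxy.trans (Near.reachable hz)) h

end Transfer

section NearMeasurable

variable {X : Type*} [MeasurableSpace X] [StandardBorelSpace X]

theorem measurable_near {G : SimpleGraph X} (hG : Measurable fun p : X × X => G.Adj p.1 p.2)
    (hlf : ∀ x, (G.neighborSet x).Finite) (n : ℕ) :
    Measurable fun p : X × X => Near G n p.1 p.2 := by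
  induction n with
  | zero =>
    simp only [near_zero]
    fun_prop
  | succ n ih =>
    simp only [near_succ]
    have := measurable_exists (X := X × X) (Y := X)
      (R := fun p z => G.Adj p.1 z ∧ Near G n z p.2) (by fun_prop)
      (fun p => (hlf p.1).subset fun z hz => hz.1)
    fun_prop

theorem measurable_choosable {G : SimpleGraph X} (hG : Measurable fun p : X × X => G.Adj p.1 p.2)
    {φ : ℕ → X → X} (hφ : ∀ n, Measurable (φ n)) (s : Finset ℕ) :
    Measurable fun x => Set.InjOn (fun n => φ n x) s ∧
      ChoosableSet G ((fun n => φ n x) '' s) := by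
  classical
  have h : ∀ x, (Set.InjOn (fun n => φ n x) s ∧ ChoosableSet G ((fun n => φ n x) '' s)) ↔
      (∀ i ∈ s, ∀ j ∈ s, φ i x = φ j x → i = j) ∧ ∃ t : Finset (ℕ × ℕ),
        (∀ i ∈ s, ∀ j ∈ s, ((i, j) ∈ t ↔ G.Adj (φ i x) (φ j x))) ∧
        ChoosableSet (SimpleGraph.fromRel fun i j : ℕ => (i, j) ∈ t) s := by
    intro x
    have e : Set.InjOn (fun n => φ n x) s ↔ ∀ i ∈ s, ∀ j ∈ s, φ i x = φ j x → i = j := by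
      simp only [Set.InjOn, Finset.mem_coe]
    rw [← e]
    refine and_congr_right fun hinj => ?_
    have key : ∀ t : Finset (ℕ × ℕ),
        (∀ i ∈ s, ∀ j ∈ s, ((i, j) ∈ t ↔ G.Adj (φ i x) (φ j x))) →
        (ChoosableSet G ((fun n => φ n x) '' s) ↔
          ChoosableSet (SimpleGraph.fromRel fun i j : ℕ => (i, j) ∈ t) s) := by
      intro t ht
      refine choosableSet_image hinj fun i hi j hj => ?_
      rw [SimpleGraph.fromRel_adj, ht i hi j hj, ht j hj i hi, G.adj_comm (φ j x), or_self]
      refine ⟨fun h => h.2, fun h => ⟨?_, h⟩⟩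
      rintro rfl
      exact h.ne rfl
    constructor
    · intro h
      refine ⟨(s ×ˢ s).filter fun p => G.Adj (φ p.1 x) (φ p.2 x), ?_, ?_⟩
      · intro i hi j hj
        simp [hi, hj]
      · refine (key _ ?_).1 h
        intro i hi j hj
        simp [hi, hj]
    · rintro ⟨t, ht, h⟩
      exact (key t ht).2 h
  simp only [h]
  fun_prop

/-- The set of points whose ball of radius `n` is degree-choosable is measurable. -/
theorem measurable_choosable_ball {G : SimpleGraph X}
    (hG : Measurable fun p : X × X => G.Adj p.1 p.2)
    (hlf : ∀ x, (G.neighborSet x).Finite) (n : ℕ) :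
    Measurable fun x => ChoosableSet G {y | Near G n x y} := by
  classical
  obtain ⟨φ, hφ, hφr⟩ := exists_enum_reachable hG hlf
  have h : ∀ x, ChoosableSet G {y | Near G n x y} ↔ ∃ s : Finset ℕ,
      (∀ k, Near G n x (φ k x) ↔ ∃ i ∈ s, φ i x = φ k x) ∧
      Set.InjOn (fun n => φ n x) s ∧ ChoosableSet G ((fun n => φ n x) '' s) := by
    intro x
    have key : ∀ s : Finset ℕ, (∀ k, Near G n x (φ k x) ↔ ∃ i ∈ s, φ i x = φ k x) →
        {y | Near G n x y} = (fun n => φ n x) '' s := by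
      intro s hs
      ext y
      constructor
      · intro hy
        obtain ⟨k, rfl⟩ := (hφr x y).1 (Near.reachable hy)
        obtain ⟨i, hi, e⟩ := (hs k).1 hy
        exact ⟨i, hi, e⟩
      · rintro ⟨i, hi, rfl⟩
        exact (hs i).2 ⟨i, hi, rfl⟩
    constructor
    · intro hc
      have hk : ∀ y, ∃ k, Near G n x y → φ k x = y := fun y => by
        by_cases hy : Near G n x y
        · obtain ⟨k, hk⟩ := (hφr x y).1 hy.reachable
          exact ⟨k, fun _ => hk⟩
        · exact ⟨0, fun h => absurd h hy⟩
      choose k hk using hk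
      have hfin : {y | Near G n x y}.Finite := near_finite hlf n x
      have hs : ∀ j, Near G n x (φ j x) ↔ ∃ i ∈ hfin.toFinset.image k, φ i x = φ j x := by
        intro j
        simp only [Finset.mem_image, Set.Finite.mem_toFinset]
        constructor
        · intro hj
          exact ⟨_, ⟨_, hj, rfl⟩, hk _ hj⟩
        · rintro ⟨i, ⟨y, hy, rfl⟩, e⟩
          rw [← e, hk y hy]
          exact hy
      refine ⟨hfin.toFinset.image k, hs, ?_, key _ hs ▸ hc⟩
      intro i hi j hj e
      simp only [Finset.coe_image, Set.Finite.coe_toFinset] at hi hj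
      obtain ⟨y, hy, rfl⟩ := hi
      obtain ⟨z, hz, rfl⟩ := hj
      dsimp only at e
      rw [hk y hy, hk z hz] at e
      rw [e]
    · rintro ⟨s, hs, -, hc⟩
      rwa [key s hs]
  have := measurable_near hG hlf n
  have := measurable_choosable hG hφ
  simp only [h]
  fun_prop

end NearMeasurable

section ChoosablePart

open Set

variable {X : Type*}

theorem ColS.mono {G : SimpleGraph X} {S T : Set X} {L : X → Finset ℝ} (h : ColS G T L)
    (hST : S ⊆ T) : ColS G S L := by
  obtain ⟨c, h1, h2⟩ := h
  exact ⟨c, fun x hx => h1 x (hST hx), fun x hx y hy => h2 x (hST hx) y (hST hy)⟩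

variable [MeasurableSpace X] [StandardBorelSpace X]

theorem measurable_unchoosable {G : SimpleGraph X}
    (hG : Measurable fun p : X × X => G.Adj p.1 p.2) (hlf : ∀ x, (G.neighborSet x).Finite) :
    Measurable (Unchoosable G) := by
  have h : ∀ x, Unchoosable G x ↔
      ¬ ∃ n, ∃ y, G.Reachable x y ∧ ChoosableSet G {z | Near G n y z} := by
    intro x
    rw [iff_not_comm]
    constructor
    · rintro ⟨n, y, hxy, hc⟩
      exact not_unchoosable_of_ball hlf hxy hc
    · exact exists_ball_choosable hlf
  have := fun n => measurable_exists_reachable hG hlf (measurable_choosable_ball hG hlf n)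
  have h2 : Measurable fun x => ¬ ∃ n, ∃ y, G.Reachable x y ∧ ChoosableSet G {z | Near G n y z} := by
    fun_prop
  convert h2 using 2 with x
  exact h x

/-- The part of the graph consisting of components with a finite choosable set contains
a family of pairwise distant finite choosable sets meeting each of these components. -/
theorem exists_choosable_clusters [Nonempty X] {G : SimpleGraph X}
    (hG : Measurable fun p : X × X => G.Adj p.1 p.2) (hlf : ∀ x, (G.neighborSet x).Finite) :
    ∃ (A : Set X) (z : X → X), (Measurable fun x => x ∈ A) ∧ Measurable z ∧
      (∀ x ∈ A, ¬ Unchoosable G x) ∧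
      (∀ x, ¬ Unchoosable G x → ∃ a, G.Reachable x a ∧ a ∈ A) ∧
      (∀ L : X → Finset ℝ, (∀ x ∈ A, degS G A x ≤ (L x).card) →
        ∀ w, ColS G {x | x ∈ A ∧ z x = w} L) ∧
      (∀ w, {x | x ∈ A ∧ z x = w}.Finite) ∧
      ∀ x ∈ A, ∀ y ∈ A, G.Adj x y → z x = z y := by
  have hP := fun n => measurable_exists_reachable hG hlf (measurable_choosable_ball hG hlf n)
  obtain ⟨r, hr, hr'⟩ := measurable_least hP
  have hrinv : ∀ x y, G.Reachable x y →
      (∃ n y, G.Reachable x y ∧ ChoosableSet G {z | Near G n y z}) → r x = r y := by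
    rintro x y hxy ⟨n, w, hw, hc⟩
    obtain ⟨⟨u, hu, huc⟩, hx2⟩ := hr' x ⟨n, w, hw, hc⟩
    obtain ⟨⟨v, hv, hvc⟩, hy2⟩ := hr' y ⟨n, w, hxy.symm.trans hw, hc⟩
    exact (hx2 _ ⟨v, hxy.trans hv, hvc⟩).antisymm (hy2 _ ⟨u, hxy.symm.trans hu, huc⟩)
  let Z : X → Prop := fun x => ∃ n, r x = n ∧ ChoosableSet G {y | Near G n x y}
  have hcb := measurable_choosable_ball hG hlf
  have hnear := measurable_near hG hlf
  have hZ : Measurable Z := by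
    simp only [Z]
    fun_prop
  have hZX : ∀ x, Z x → ∃ n y, G.Reachable x y ∧ ChoosableSet G {z | Near G n y z} := by
    rintro x ⟨n, -, h⟩
    exact ⟨n, x, SimpleGraph.Reachable.refl x, h⟩
  obtain ⟨κ, hκ, hκ'⟩ := exists_countable_coloring
    (R := fun x y => ∃ n, r x = n ∧ Near G (2 * n + 1) x y) (by fun_prop) (fun x => by
      refine (near_finite hlf (2 * r x + 1) x).subset ?_
      rintro y ⟨n, rfl, h⟩
      exact h)
  obtain ⟨k, hk, hk'⟩ := measurable_least (P := fun k x => ∃ y, G.Reachable x y ∧ Z y ∧ κ y = k)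
    (fun k => measurable_exists_reachable hG hlf (by fun_prop))
  have hkinv : ∀ x y, G.Reachable x y → Z x → k x = k y := by
    intro x y hxy hx
    obtain ⟨⟨u, hu, huc⟩, hx2⟩ := hk' x ⟨_, x, SimpleGraph.Reachable.refl x, hx, rfl⟩
    obtain ⟨⟨v, hv, hvc⟩, hy2⟩ := hk' y ⟨_, x, hxy.symm, hx, rfl⟩
    exact (hx2 _ ⟨v, hxy.trans hv, hvc⟩).antisymm (hy2 _ ⟨u, hxy.symm.trans hu, huc⟩)
  let R : X → X → Prop := fun x w => (∃ n, r x = n ∧ Near G n x w) ∧ Z w ∧ κ w = k w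
  have hR : Measurable fun p : X × X => R p.1 p.2 := by
    simp only [R]
    fun_prop
  have hRf : ∀ x, {y | R x y}.Finite := by
    intro x
    refine (near_finite hlf (r x) x).subset ?_
    rintro y ⟨⟨n, rfl, h⟩, -⟩
    exact h
  obtain ⟨z, hz, hz'⟩ := exists_select hR hRf
  have hRr : ∀ x w, R x w → r x = r w ∧ Near G (r w) x w := by
    rintro x w ⟨⟨n, rfl, h⟩, hw, -⟩
    have := hrinv w x h.reachable.symm (hZX w hw)
    exact ⟨this.symm, this ▸ h⟩
  have huniq : ∀ x y w w', R x w → R y w' → Near G 1 x y → w = w' := by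
    intro x y w w' h1 h2 hxy
    by_contra hne
    obtain ⟨e1, n1⟩ := hRr x w h1
    obtain ⟨e2, n2⟩ := hRr y w' h2
    have hw := n1.symm.trans (hxy.trans n2)
    have e3 := hrinv w w' hw.reachable (hZX w h1.2.1)
    refine hκ' w w' ⟨r w, rfl, hw.mono (by omega)⟩ hne ?_
    rw [h1.2.2, h2.2.2]
    exact hkinv w w' hw.reachable h1.2.1
  have hzw : ∀ x w, R x w → z x = w := fun x w h =>
    huniq x x _ _ (hz' x ⟨w, h⟩) h (Near.refl 1 x)
  refine ⟨{x | ∃ w, R x w}, z, measurable_exists hR hRf, hz, ?_, ?_, ?_, ?_, ?_⟩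
  · rintro x ⟨w, h⟩
    obtain ⟨n, y, hy, hc⟩ := hZX w h.2.1
    exact not_unchoosable_of_ball hlf ((hRr x w h).2.reachable.trans hy) hc
  · intro x hx
    obtain ⟨⟨y, hy, hyc⟩, -⟩ := hr' x (exists_ball_choosable hlf hx)
    have hyZ : Z y := ⟨r x, (hrinv x y hy (exists_ball_choosable hlf hx)).symm, hyc⟩
    obtain ⟨⟨v, hv, hvZ, hvk⟩, -⟩ := hk' y ⟨_, y, SimpleGraph.Reachable.refl y, hyZ, rfl⟩
    exact ⟨v, hy.trans hv, v, ⟨r v, rfl, Near.refl _ _⟩, hvZ,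
      hvk.trans (hkinv y v hv hyZ)⟩
  · intro L hL w
    by_cases hne : ∃ x, (∃ w, R x w) ∧ z x = w
    · obtain ⟨x, hx, rfl⟩ := hne
      have hxz := hz' x hx
      obtain ⟨e, hn⟩ := hRr _ _ hxz
      obtain ⟨n, hn', hc⟩ := hxz.2.1
      subst hn'
      have hball : ∀ y, Near G (r (z x)) (z x) y → R y (z x) := fun y hy =>
        ⟨⟨_, (hrinv (z x) y hy.reachable (hZX _ hxz.2.1)).symm, hy.symm⟩, hxz.2⟩
      refine (hc L fun y hy => le_trans ?_ (hL y ⟨z x, hball y hy⟩)).mono ?_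
      · exact ncard_le_ncard (inter_subset_inter_right _ fun v hv => ⟨z x, hball v hv⟩)
          ((hlf y).inter_of_left _)
      · rintro y ⟨hy, hyx⟩
        exact hyx ▸ (hRr _ _ (hz' y hy)).2.symm
    · refine ⟨fun _ => 0, ?_, ?_⟩
      · exact fun x hx => absurd ⟨x, hx⟩ hne
      · exact fun x hx => absurd ⟨x, hx⟩ hne
  · intro w
    refine (near_finite hlf (r w) w).subset ?_
    rintro x ⟨hx, rfl⟩
    exact (hRr _ _ (hz' x hx)).2.symm
  · intro x hx y hy hxy
    exact huniq x y _ _ (hz' x hx) (hz' y hy) (Near.of_adj hxy)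

theorem exists_coloring_of_classes [Nonempty X] {G : SimpleGraph X}
    (hG : Measurable fun p : X × X => G.Adj p.1 p.2) (hlf : ∀ x, (G.neighborSet x).Finite)
    {A : Set X} (hA : Measurable fun x => x ∈ A) {z : X → X} (hz : Measurable z)
    {L : X → Finset ℝ} (hL : Measurable fun p : X × ℝ => p.2 ∈ L p.1)
    (hfin : ∀ w, {x | x ∈ A ∧ z x = w}.Finite)
    (hadj : ∀ x ∈ A, ∀ y ∈ A, G.Adj x y → z x = z y)
    (hcol : ∀ w, ColS G {x | x ∈ A ∧ z x = w} L) :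
    ∃ c : X → ℝ, Measurable c ∧ ∀ x ∈ A, c x ∈ L x ∧ ∀ y ∈ A, G.Adj x y → c x ≠ c y := by
  obtain ⟨g, hg, hgL⟩ := exists_enum (R := fun x t => t ∈ L x) hL fun x => (L x).finite_toSet
  obtain ⟨φ, hφ, hφA⟩ := exists_enum (R := fun w x => x ∈ A ∧ z x = w) (by fun_prop) hfin
  obtain ⟨N, hN, hN'⟩ := measurable_least (P := fun n x => φ n (z x) = x) (by fun_prop)
  have hNA : ∀ x ∈ A, φ (N x) (z x) = x := fun x hx => (hN' x (hφA (z x) x ⟨hx, rfl⟩)).1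
  let d : List ℕ → X → ℝ := fun σ x => g (σ.getD (N x) 0) x
  have hd : ∀ σ, Measurable (d σ) := fun σ => measurable_nat_apply hg (by fun_prop)
  let V : List ℕ → X → Prop := fun σ w => ∀ x, (x ∈ A ∧ z x = w) → (d σ x ∈ L x ∧
    ∀ y, (y ∈ A ∧ G.Adj x y) → d σ x ≠ d σ y)
  have hV : ∀ σ, Measurable (V σ) := by
    intro σ
    have hds := hd σ
    have h1 : Measurable fun x => d σ x ∈ L x :=
      hL.comp (measurable_id.prodMk (hd σ))
    have h2 : Measurable fun x => ∀ y, (y ∈ A ∧ G.Adj x y) → d σ x ≠ d σ y :=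
      measurable_forall_imp (by fun_prop) (by fun_prop) fun x => (hlf x).subset fun y hy => hy.2
    exact measurable_forall_imp (R := fun w x => x ∈ A ∧ z x = w)
      (S := fun w x => d σ x ∈ L x ∧ ∀ y, (y ∈ A ∧ G.Adj x y) → d σ x ≠ d σ y) (by fun_prop)
      ((h1.and h2).comp measurable_snd) hfin
  have hVex : ∀ w, ∃ σ, V σ w := by
    intro w
    obtain ⟨c, hc1, hc2⟩ := hcol w
    have hi : ∀ x, ∃ i, (x ∈ A ∧ z x = w) → g i x = c x := by
      intro x
      by_cases hx : x ∈ A ∧ z x = w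
      · obtain ⟨i, hi⟩ := hgL x (c x) (hc1 x hx)
        exact ⟨i, fun _ => hi⟩
      · exact ⟨0, fun h => absurd h hx⟩
    choose i hi using hi
    obtain ⟨M, hM⟩ := ((hfin w).image N).bddAbove
    have key : ∀ x, (x ∈ A ∧ z x = w) →
        d ((List.range (M + 1)).map fun n => i (φ n w)) x = c x := by
      intro x hx
      have hlt : N x < M + 1 := Nat.lt_succ_of_le (hM ⟨x, hx, rfl⟩)
      have e : ((List.range (M + 1)).map fun n => i (φ n w)).getD (N x) 0 = i x := by
        have e2 := hNA x hx.1
        rw [hx.2] at e2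
        simp [List.getD, hlt, e2]
      simp only [d, e]
      exact hi x hx
    refine ⟨(List.range (M + 1)).map fun n => i (φ n w), fun x hx => ?_⟩
    constructor
    · rw [key x hx]
      exact hc1 x hx
    · rintro y ⟨hy, hxy⟩
      have hy' : y ∈ A ∧ z y = w := ⟨hy, (hadj x hx.1 y hy hxy) ▸ hx.2⟩
      rw [key x hx, key y hy']
      exact hc2 x hx y hy' hxy
  obtain ⟨k, hk, hk'⟩ := measurable_least (P := fun n w => V (Denumerable.ofNat (List ℕ) n) w)
    (fun n => hV _)
  have hkV : ∀ w, V (Denumerable.ofNat (List ℕ) (k w)) w := by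
    intro w
    obtain ⟨σ, hσ⟩ := hVex w
    exact (hk' w ⟨Encodable.encode σ, by rwa [Denumerable.ofNat_encode]⟩).1
  refine ⟨fun x => d (Denumerable.ofNat (List ℕ) (k (z x))) x,
    measurable_nat_apply (g := fun n x => d (Denumerable.ofNat (List ℕ) n) x) (fun n => hd _)
      (hk.comp hz), fun x hx => ⟨((hkV (z x)) x ⟨hx, rfl⟩).1, fun y hy hxy => ?_⟩⟩
  have := ((hkV (z x)) x ⟨hx, rfl⟩).2 y ⟨hy, hxy⟩
  dsimp only
  rwa [← hadj x hx y hy hxy]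

end ChoosablePart

section SpanningForest

open Relation Set

variable {V : Type*} {G : SimpleGraph V} {w : V → V → ℝ}

/-- The edges of `G` of weight less than `t`. -/
def lightGraph (G : SimpleGraph V) (w : V → V → ℝ) (t : ℝ) : SimpleGraph V where
  Adj x y := G.Adj x y ∧ w x y < t ∧ w y x < t
  symm := ⟨fun _ _ h => ⟨h.1.symm, h.2.2, h.2.1⟩⟩
  loopless := ⟨fun _ h => h.1.ne rfl⟩

/-- The edges of `G` which are not the heaviest edge of a cycle. -/
def minForest (G : SimpleGraph V) (w : V → V → ℝ) : SimpleGraph V where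
  Adj x y := G.Adj x y ∧ ¬ (lightGraph G w (w x y)).Reachable x y ∧
    ¬ (lightGraph G w (w y x)).Reachable y x
  symm := ⟨fun _ _ h => ⟨h.1.symm, h.2.2, h.2.1⟩⟩
  loopless := ⟨fun _ h => h.1.ne rfl⟩

theorem minForest_isAcyclic (hws : ∀ a b, w a b = w b a)
    (hwi : ∀ a b c d, w a b = w c d → s(a, b) = s(c, d)) : (minForest G w).IsAcyclic := by
  classical
  intro v c hc
  let C : SimpleGraph V := SimpleGraph.fromEdgeSet {e | e ∈ c.edges}
  have hCT : ∀ a b, C.Adj a b ↔ s(a, b) ∈ c.edges := by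
    intro a b
    simp only [C, SimpleGraph.fromEdgeSet_adj, mem_ofPred_eq]
    exact ⟨fun h => h.1, fun h => ⟨h, ((minForest G w).mem_edgeSet.1 (c.edges_subset_edgeSet h)).ne⟩⟩
  let W : Sym2 V → ℝ := Sym2.lift ⟨w, hws⟩
  obtain ⟨e, he, hmax⟩ := c.edges.toFinset.exists_max_image W
    ⟨_, List.mem_toFinset.2 (List.head_mem (by simpa using hc.not_nil))⟩
  induction e using Sym2.ind with
  | _ x y =>
  rw [List.mem_toFinset] at he
  have hce : ∀ e ∈ c.edges, e ∈ C.edgeSet := by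
    intro e he
    induction e using Sym2.ind with
    | _ a b => exact (hCT a b).2 he
  have h1 : ∃ (u : V) (p : C.Walk u u), p.IsCycle ∧ s(x, y) ∈ p.edges :=
    ⟨v, c.transfer C hce, hc.transfer hce, by rwa [SimpleGraph.Walk.edges_transfer]⟩
  rw [← SimpleGraph.adj_and_reachable_delete_edges_iff_exists_cycle] at h1
  have hT : (minForest G w).Adj x y := (minForest G w).mem_edgeSet.1 (c.edges_subset_edgeSet he)
  refine hT.2.1 (h1.2.mono ?_)
  intro a b hab
  have hab1 := (hCT a b).1 hab.1
  have hne : s(a, b) ≠ s(x, y) := by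
    intro h
    exact hab.2 (by simp [h, hab.1.ne])
  have hle : w a b ≤ w x y := hmax s(a, b) (List.mem_toFinset.2 hab1)
  have hlt : w a b < w x y := lt_of_le_of_ne hle fun h => hne (hwi _ _ _ _ h)
  exact ⟨((minForest G w).mem_edgeSet.1 (c.edges_subset_edgeSet hab1)).1, hlt, by rwa [hws]⟩

theorem minForest_reachable_of_adj (hws : ∀ a b, w a b = w b a) {x y : V} (hxy : G.Adj x y)
    (hb : ∀ S, BiconnSet G S → x ∈ S → y ∈ S → S.Finite) : (minForest G w).Reachable x y := by
  let F : Set (Set V) := {S | BiconnSet G S ∧ x ∈ S ∧ y ∈ S}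
  have hS0 : BiconnSet G (⋃₀ F) := BiconnSet.sUnion hxy.ne
    ⟨{x, y}, BiconnSet.pair hxy, by simp, by simp⟩ fun S hS => hS
  have hxS : x ∈ ⋃₀ F := ⟨{x, y}, ⟨BiconnSet.pair hxy, by simp, by simp⟩, by simp⟩
  have hyS : y ∈ ⋃₀ F := ⟨{x, y}, ⟨BiconnSet.pair hxy, by simp, by simp⟩, by simp⟩
  have hfin := hb _ hS0 hxS hyS
  have hfin2 := hfin.prod hfin
  have key : ∀ n a b, a ∈ ⋃₀ F → b ∈ ⋃₀ F → G.Adj a b →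
      {p ∈ (⋃₀ F) ×ˢ (⋃₀ F) | w p.1 p.2 < w a b}.ncard = n → (minForest G w).Reachable a b := by
    intro n
    induction n using Nat.strong_induction_on with
    | _ n ih =>
    intro a b ha hb hab hn
    by_cases hl : (lightGraph G w (w a b)).Reachable a b
    · obtain ⟨p, hp⟩ := hl.exists_isPath
      have hinj : ∀ i j, i ≤ p.length → j ≤ p.length → p.getVert i = p.getVert j → i = j :=
        fun i j hi hj h => hp.getVert_injOn hi hj h
      have hadj : ∀ i < p.length, (lightGraph G w (w a b)).Adj (p.getVert i) (p.getVert (i + 1)) :=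
        fun i hi => p.adj_getVert_succ hi
      have hbi := BiconnSet.of_cycle hinj (fun i hi => (hadj i hi).1)
        (by rw [p.getVert_zero, p.getVert_length]; exact hab)
      have hsub : ⋃₀ {⋃₀ F, {y | ∃ i ≤ p.length, y = p.getVert i}} ⊆ ⋃₀ F := by
        refine subset_sUnion_of_mem ⟨BiconnSet.sUnion hab.ne ⟨⋃₀ F, Or.inl rfl⟩ ?_, ?_, ?_⟩
        · rintro S (rfl | rfl)
          · exact ⟨hS0, ha, hb⟩
          · exact ⟨hbi, ⟨0, by simp, by simp⟩, ⟨p.length, le_rfl, by simp⟩⟩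
        · exact ⟨⋃₀ F, Or.inl rfl, hxS⟩
        · exact ⟨⋃₀ F, Or.inl rfl, hyS⟩
      have hmem : ∀ i ≤ p.length, p.getVert i ∈ ⋃₀ F := fun i hi =>
        hsub ⟨_, Or.inr rfl, i, hi, rfl⟩
      have hstep : ∀ i < p.length, (minForest G w).Reachable (p.getVert i) (p.getVert (i + 1)) := by
        intro i hi
        refine ih _ ?_ _ _ (hmem i hi.le) (hmem _ hi) (hadj i hi).1 rfl
        rw [← hn]
        refine ncard_lt_ncard ?_ (hfin2.subset fun p hp => hp.1)
        refine ⟨fun q hq => ⟨hq.1, hq.2.trans (hadj i hi).2.1⟩, fun h => ?_⟩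
        have : (p.getVert i, p.getVert (i + 1)) ∈
            {q ∈ (⋃₀ F) ×ˢ (⋃₀ F) | w q.1 q.2 < w (p.getVert i) (p.getVert (i + 1))} :=
          h ⟨⟨hmem i hi.le, hmem _ hi⟩, (hadj i hi).2.1⟩
        exact lt_irrefl _ this.2
      have hall : ∀ i ≤ p.length, (minForest G w).Reachable a (p.getVert i) := by
        intro i
        induction i with
        | zero => intro _; simp
        | succ i ih => intro hi; exact (ih (Nat.le_of_succ_le hi)).trans (hstep i hi)
      have := hall _ le_rfl
      rwa [p.getVert_length] at this
    · refine SimpleGraph.Adj.reachable ⟨hab, hl, ?_⟩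
      rw [hws b a]
      exact fun h => hl h.symm
  exact key _ x y hxS hyS hxy rfl

end SpanningForest

section SpanningForestMeasurable

open Relation Set

variable {X : Type*} [MeasurableSpace X] [StandardBorelSpace X]

theorem measurable_lightGraph_reachable {G : SimpleGraph X}
    (hG : Measurable fun p : X × X => G.Adj p.1 p.2) (hlf : ∀ x, (G.neighborSet x).Finite)
    {w : X → X → ℝ} (hw : Measurable fun p : X × X => w p.1 p.2) :
    Measurable fun p : X × X => (lightGraph G w (w p.1 p.2)).Reachable p.1 p.2 := by
  have h := measurable_reflTransGen (X := X × ℝ)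
    (R := fun a b => a.2 = b.2 ∧ G.Adj a.1 b.1 ∧ w a.1 b.1 < a.2 ∧ w b.1 a.1 < a.2) (by
      have h1 : Measurable fun p : (X × ℝ) × X × ℝ => G.Adj p.1.1 p.2.1 :=
        hG.comp (by fun_prop : Measurable fun p : (X × ℝ) × X × ℝ => (p.1.1, p.2.1))
      have h2 : Measurable fun p : (X × ℝ) × X × ℝ => w p.1.1 p.2.1 :=
        hw.comp (by fun_prop : Measurable fun p : (X × ℝ) × X × ℝ => (p.1.1, p.2.1))
      have h3 : Measurable fun p : (X × ℝ) × X × ℝ => w p.2.1 p.1.1 :=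
        hw.comp (by fun_prop : Measurable fun p : (X × ℝ) × X × ℝ => (p.2.1, p.1.1))
      have h4 : Measurable fun p : (X × ℝ) × X × ℝ => w p.1.1 p.2.1 < p.1.2 :=
        (measurableSet_lt h2 (by fun_prop)).mem
      have h5 : Measurable fun p : (X × ℝ) × X × ℝ => w p.2.1 p.1.1 < p.1.2 :=
        (measurableSet_lt h3 (by fun_prop)).mem
      fun_prop) (fun a => by
      refine ((hlf a.1).prod (finite_singleton a.2)).subset ?_
      rintro b ⟨h1, h2, -⟩
      exact ⟨h2, h1.symm⟩)
  have h2 := h.comp (f := fun p : X × X => ((p.1, w p.1 p.2), (p.2, w p.1 p.2))) (by fun_prop)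
  convert h2 using 2 with p
  simp only [Function.comp]
  rw [SimpleGraph.reachable_iff_reflTransGen]
  constructor
  · intro h
    exact ReflTransGen.lift (fun a => (a, w p.1 p.2)) (fun a b hab => ⟨rfl, hab⟩) _ _ h
  · intro h
    have key : ∀ a b : X × ℝ, ReflTransGen (fun a b : X × ℝ =>
        a.2 = b.2 ∧ G.Adj a.1 b.1 ∧ w a.1 b.1 < a.2 ∧ w b.1 a.1 < a.2) a b →
        ReflTransGen (lightGraph G w a.2).Adj a.1 b.1 ∧ a.2 = b.2 := by
      intro a b h
      induction h with
      | refl => exact ⟨ReflTransGen.refl, rfl⟩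
      | tail _ hbc ih =>
        refine ⟨ih.1.tail ?_, ih.2.trans hbc.1⟩
        rw [ih.2]
        exact hbc.2
    exact (key _ _ h).1

/-- A Borel acyclic subgraph connecting adjacent vertices whose common biconnected sets
are finite. -/
theorem exists_spanning_forest {G : SimpleGraph X}
    (hG : Measurable fun p : X × X => G.Adj p.1 p.2) (hlf : ∀ x, (G.neighborSet x).Finite) :
    ∃ T : SimpleGraph X, (Measurable fun p : X × X => T.Adj p.1 p.2) ∧ T ≤ G ∧ T.IsAcyclic ∧
      ∀ x y, G.Reachable x y → Unchoosable G x → T.Reachable x y := by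
  obtain ⟨e, he⟩ := exists_measurableEmbedding_real (X × X)
  have hem := he.measurable
  let w : X → X → ℝ := fun x y => min (e (x, y)) (e (y, x))
  have hw : Measurable fun p : X × X => w p.1 p.2 := by fun_prop
  have hws : ∀ a b, w a b = w b a := fun a b => min_comm _ _
  have hwi : ∀ a b c d, w a b = w c d → s(a, b) = s(c, d) := by
    intro a b c d h
    have h1 : w a b = e (a, b) ∨ w a b = e (b, a) := min_choice _ _
    have h2 : w c d = e (c, d) ∨ w c d = e (d, c) := min_choice _ _
    rw [Sym2.eq_iff]
    rcases h1 with h1 | h1 <;> rcases h2 with h2 | h2 <;>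
    · have := he.injective (h1.symm.trans (h.trans h2))
      simp only [Prod.mk.injEq] at this
      tauto
  have hl := measurable_lightGraph_reachable hG hlf hw
  have hl2 : Measurable fun p : X × X => (lightGraph G w (w p.2 p.1)).Reachable p.2 p.1 :=
    hl.comp measurable_swap
  refine ⟨minForest G w, ?_, fun _ _ h => h.1, minForest_isAcyclic hws hwi, ?_⟩
  · exact hG.and (hl.not.and hl2.not)
  · intro x y hxy hx
    rw [SimpleGraph.reachable_iff_reflTransGen] at hxy
    induction hxy with
    | refl => rfl
    | tail h hbc ih =>
      refine ih.trans (minForest_reachable_of_adj hws hbc fun S hS hb _ => ?_)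
      refine Unchoosable.biconn_finite hlf (fun K hK hKn hKr => hx K hK hKn fun k hk => ?_) hS hb
      rw [← SimpleGraph.reachable_iff_reflTransGen] at h
      exact h.trans (hKr k hk)

end SpanningForestMeasurable

section Darts

open Relation Set

variable {V : Type*} {H : SimpleGraph V}

/-- The pair `e` continues the pair `d` along an edge of `H` without backtracking. -/
def DartStep (H : SimpleGraph V) (d e : V × V) : Prop :=
  e.1 = d.2 ∧ H.Adj d.2 e.2 ∧ e.2 ≠ d.1

/-- Nonbacktracking reachability of pairs along edges of `H`. -/
abbrev DartReach (H : SimpleGraph V) : V × V → V × V → Prop :=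
  ReflTransGen (DartStep H)

/-- The vertex `x` has at least three neighbors. -/
def IsNode (H : SimpleGraph V) (x : V) : Prop :=
  3 ≤ (H.neighborSet x).ncard

theorem DartReach.adj {d e : V × V} (h : DartReach H d e) (hd : H.Adj d.1 d.2) : H.Adj e.1 e.2 := by
  induction h with
  | refl => exact hd
  | tail _ hbc _ =>
    rw [hbc.1]
    exact hbc.2.1

theorem DartReach.reachable {d e : V × V} (h : DartReach H d e) : H.Reachable d.2 e.2 := by
  induction h with
  | refl => rfl
  | tail _ hbc ih => exact ih.trans hbc.2.1.reachable

theorem dartStep_finite (hlf : ∀ x, (H.neighborSet x).Finite) (d : V × V) :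
    {e | DartStep H d e}.Finite := by
  refine ((finite_singleton d.2).prod (hlf d.2)).subset ?_
  rintro e ⟨h1, h2, -⟩
  exact ⟨h1, h2⟩

theorem DartReach.exists_path (hac : H.IsAcyclic) {d e : V × V} (h : DartReach H d e)
    (hd : H.Adj d.1 d.2) : ∃ p : H.Walk d.1 e.2, p.IsPath ∧ p.snd = d.2 := by
  induction h using ReflTransGen.head_induction_on with
  | refl => exact ⟨hd.toWalk, by simp [hd.ne], by simp⟩
  | @head a c hac' _ ih =>
    have hc : H.Adj c.1 c.2 := by rw [hac'.1]; exact hac'.2.1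
    obtain ⟨p, hp, hps⟩ := ih hc
    have had : H.Adj a.1 c.1 := by rw [hac'.1]; exact hd
    refine ⟨SimpleGraph.Walk.cons had p, ?_, ?_⟩
    · rw [SimpleGraph.Walk.cons_isPath_iff]
      refine ⟨hp, fun hmem => hac'.2.2 ?_⟩
      rw [← hps]
      exact (hac.eq_snd_of_adj_start hp had.symm hmem).symm
    · simp [hac'.1]

theorem DartReach.ne (hac : H.IsAcyclic) {d e : V × V} (h : DartReach H d e)
    (hd : H.Adj d.1 d.2) : d.1 ≠ e.2 := by
  obtain ⟨p, hp, hps⟩ := h.exists_path hac hd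
  intro he
  obtain ⟨d1, d2⟩ := d
  obtain ⟨e1, e2⟩ := e
  dsimp only at *
  subst he
  cases SimpleGraph.Walk.isPath_iff_nil.1 hp
  exact hd.ne hps

theorem DartReach.snd_unique (hac : H.IsAcyclic) {a b b' c c' z : V} (h : DartReach H (a, b) (c, z))
    (h' : DartReach H (a, b') (c', z)) (hb : H.Adj a b) (hb' : H.Adj a b') : b = b' := by
  obtain ⟨p, hp, hps⟩ := h.exists_path hac hb
  obtain ⟨q, hq, hqs⟩ := h'.exists_path hac hb'
  have := (hac.subsingleton_path a z).elim ⟨p, hp⟩ ⟨q, hq⟩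
  simp only [Subtype.mk.injEq] at this
  subst this
  exact hps.symm.trans hqs

theorem exists_dartReach_of_reachable {x v : V} (h : H.Reachable x v) :
    v = x ∨ ∃ y u, H.Adj x y ∧ DartReach H (x, y) (u, v) := by
  rw [SimpleGraph.reachable_iff_reflTransGen] at h
  induction h with
  | refl => exact Or.inl rfl
  | @tail b c _ hbc ih =>
    rcases ih with rfl | ⟨y, u, hxy, hr⟩
    · exact Or.inr ⟨c, b, hbc, ReflTransGen.refl⟩
    · by_cases hcu : c = u
      · subst hcu
        rcases ReflTransGen.cases_tail hr with h | ⟨e, he, hes⟩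
        · simp only [Prod.mk.injEq] at h
          exact Or.inl h.1
        · refine Or.inr ⟨y, e.1, hxy, ?_⟩
          have := hes.1
          simp only at this
          rw [this]
          exact he
      · exact Or.inr ⟨y, b, hxy, hr.tail ⟨rfl, hbc, hcu⟩⟩

/-- The pair `d` is an edge which starts an infinite nonbacktracking walk. -/
def InfDart (H : SimpleGraph V) (d : V × V) : Prop :=
  H.Adj d.1 d.2 ∧ ∀ n, ChainLen (DartStep H) n d

theorem InfDart.next (hlf : ∀ x, (H.neighborSet x).Finite) {x y : V} (h : InfDart H (x, y)) :
    ∃ z, z ≠ x ∧ InfDart H (y, z) := by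
  obtain ⟨⟨y', z⟩, ⟨h1, h2, h3⟩, h4⟩ := exists_next_of_forall_chainLen (dartStep_finite hlf) h.2
  simp only at h1 h2 h3
  subst h1
  exact ⟨z, h3, h2, h4⟩

theorem InfDart.prev {x y z : V} (hxy : H.Adj x y) (hzx : z ≠ x) (h : InfDart H (y, z)) :
    InfDart H (x, y) := by
  refine ⟨hxy, fun n => ?_⟩
  cases n with
  | zero => trivial
  | succ n => exact ⟨(y, z), ⟨rfl, h.1, hzx⟩, h.2 n⟩

theorem infDart_of_infinite (hlf : ∀ x, (H.neighborSet x).Finite) {d : V × V} (hd : H.Adj d.1 d.2)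
    (hinf : {e | DartReach H d e}.Infinite) : InfDart H d := by
  obtain ⟨u, hu0, hu⟩ := exists_seq_of_next (P := DartStep H)
    (Q := fun d => {e | DartReach H d e}.Infinite) (fun d hd => by
      by_contra hcon
      push Not at hcon
      refine hd (((finite_singleton d).union
        ((dartStep_finite hlf d).biUnion (t := fun d' => {e | DartReach H d' e}) hcon)).subset ?_)
      intro e he
      rcases ReflTransGen.cases_head he with h | ⟨c, hc, hce⟩
      · exact Or.inl h.symm
      · exact Or.inr (mem_biUnion (x := c) hc hce)) hinf
  refine ⟨hd, fun n => ?_⟩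
  rw [← hu0]
  exact chainLen_of_seq n u fun i => (hu i).2

theorem exists_infDart (hlf : ∀ x, (H.neighborSet x).Finite) {x : V}
    (hinf : {v | H.Reachable x v}.Infinite) : ∃ y, InfDart H (x, y) := by
  by_contra hcon
  push Not at hcon
  refine hinf (((finite_singleton x).union ((hlf x).biUnion
    (t := fun y => Prod.snd '' {e | DartReach H (x, y) e}) fun y hy =>
      (not_infinite.1 fun h => hcon y (infDart_of_infinite hlf hy h)).image _)).subset ?_)
  intro v hv
  rcases exists_dartReach_of_reachable hv with rfl | ⟨y, u, hxy, hr⟩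
  · exact Or.inl rfl
  · exact Or.inr (mem_biUnion (x := y) hxy ⟨_, hr, rfl⟩)

end Darts

section DartsMeasurable

open Relation Set

variable {X : Type*} [MeasurableSpace X] [StandardBorelSpace X] {H : SimpleGraph X}

theorem measurable_dartStep (hH : Measurable fun p : X × X => H.Adj p.1 p.2) :
    Measurable fun p : (X × X) × X × X => DartStep H p.1 p.2 := by
  have h1 : Measurable fun p : (X × X) × X × X => H.Adj p.1.2 p.2.2 :=
    hH.comp (f := fun p : (X × X) × X × X => (p.1.2, p.2.2)) (by fun_prop)
  unfold DartStep
  fun_prop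

theorem measurable_infDart (hH : Measurable fun p : X × X => H.Adj p.1 p.2)
    (hlf : ∀ x, (H.neighborSet x).Finite) : Measurable (InfDart H) := by
  have := measurable_chainLen (measurable_dartStep hH) (dartStep_finite hlf)
  unfold InfDart
  fun_prop

theorem measurable_isNode (hH : Measurable fun p : X × X => H.Adj p.1 p.2)
    (hlf : ∀ x, (H.neighborSet x).Finite) : Measurable (IsNode H) := by
  have h := measurable_ncard_section hH hlf
  exact (measurableSet_le measurable_const h).mem

theorem measurable_exists_dartReach (hH : Measurable fun p : X × X => H.Adj p.1 p.2)
    (hlf : ∀ x, (H.neighborSet x).Finite) {A : X × X → Prop} (hA : Measurable A) :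
    Measurable fun d => ∃ e, DartReach H d e ∧ A e := by
  obtain ⟨φ, hφ, hφR⟩ := exists_enum_reflTransGen (measurable_dartStep hH) (dartStep_finite hlf)
  have : (fun d => ∃ e, DartReach H d e ∧ A e) = fun d => ∃ n, A (φ n d) := by
    ext d
    constructor
    · rintro ⟨e, he, h⟩
      obtain ⟨n, rfl⟩ := (hφR d e).1 he
      exact ⟨n, h⟩
    · rintro ⟨n, h⟩
      exact ⟨_, (hφR _ _).2 ⟨n, rfl⟩, h⟩
  rw [this]
  fun_prop

end DartsMeasurable

section Glue

open Set

variable {X : Type*} [MeasurableSpace X]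

theorem exists_glue {D : ℕ → Set X} (hD : ∀ n, Measurable fun x => x ∈ D n)
    (hdis : ∀ x m n, x ∈ D m → x ∈ D n → m = n) {f : ℕ → X → X} (hf : ∀ n, Measurable (f n))
    (hnb : ∀ n, NoBack (D n) (f n)) (hle : ∀ n x m, x ∈ D n → f n x ∈ D m → n ≤ m) :
    ∃ F : X → X, Measurable F ∧ NoBack {x | ∃ n, x ∈ D n} F ∧ ∀ n, ∀ x ∈ D n, F x = f n x := by
  obtain ⟨ρ, hρ, hρD⟩ := measurable_least (P := fun n x => x ∈ D n) hD
  have hρ' : ∀ n x, x ∈ D n → ρ x = n := fun n x hx => hdis x _ _ (hρD x ⟨n, hx⟩).1 hx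
  have hF : ∀ n, ∀ x ∈ D n, (fun x => f (ρ x) x) x = f n x := by
    intro n x hx
    simp only [hρ' n x hx]
  refine ⟨fun x => f (ρ x) x, measurable_nat_apply hf hρ, NoBack.glue ρ ?_ fun n => ?_, hF⟩
  · rintro x ⟨n, hx⟩ ⟨m, hm⟩
    simp only [hρ' n x hx] at hm ⊢
    rw [hρ' m _ hm]
    exact hle n x m hx hm
  · refine ((hnb n).congr fun x hx => (hF n x hx).symm).mono ?_
    rintro x ⟨⟨m, hx⟩, rfl⟩
    rwa [← hρ' m x hx] at hx

theorem exists_glue_two {D E : Set X} (hD : Measurable fun x => x ∈ D)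
    (hE : Measurable fun x => x ∈ E) (hdis : ∀ x ∈ D, x ∉ E) {f g : X → X} (hf : Measurable f)
    (hg : Measurable g) (hfD : NoBack D f) (hgE : NoBack E g) (hle : ∀ x ∈ E, g x ∉ D) :
    ∃ F : X → X, Measurable F ∧ NoBack {x | x ∈ D ∨ x ∈ E} F ∧ (∀ x ∈ D, F x = f x) ∧
      ∀ x ∈ E, F x = g x := by
  let D' : ℕ → Set X := fun n => Nat.casesOn n D fun n => Nat.casesOn n E fun _ => ∅
  let f' : ℕ → X → X := fun n => Nat.casesOn n f fun _ => g
  obtain ⟨F, hF, hnb, hFf⟩ := exists_glue (D := D') (f := f') (by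
      rintro (_ | _ | n)
      exacts [hD, hE, measurable_const])
    (by
      rintro x (_ | _ | m) (_ | _ | n) h1 h2
      exacts [rfl, (hdis x h1 h2).elim, h2.elim, (hdis x h2 h1).elim, rfl, h2.elim, h1.elim,
        h1.elim, h1.elim])
    (by
      rintro (_ | n)
      exacts [hf, hg])
    (by
      rintro (_ | _ | n)
      exacts [hfD, hgE, fun ⟨_, hu⟩ => (hu 0).1])
    (by
      rintro (_ | _ | n) x (_ | _ | m) h1 h2
      exacts [le_rfl, Nat.zero_le _, Nat.zero_le _, (hle x h1 h2).elim, le_rfl, h2.elim,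
        h1.elim, h1.elim, h1.elim])
  refine ⟨F, hF, hnb.mono ?_, hFf 0, hFf 1⟩
  rintro x (hx | hx)
  exacts [⟨0, hx⟩, ⟨1, hx⟩]

end Glue

section CoreGraph

open Relation Set

variable {V : Type*} {T H : SimpleGraph V}

/-- The edges of `T` lying on bi-infinite nonbacktracking walks. -/
def coreGraph (T : SimpleGraph V) : SimpleGraph V where
  Adj x y := InfDart T (x, y) ∧ InfDart T (y, x)
  symm := ⟨fun _ _ h => ⟨h.2, h.1⟩⟩
  loopless := ⟨fun _ h => h.1.1.ne rfl⟩

theorem coreGraph_le : coreGraph T ≤ T := fun _ _ h => h.1.1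

theorem coreGraph_adj_of_two {x y z : V} (hy : InfDart T (x, y)) (hz : InfDart T (x, z))
    (hyz : y ≠ z) : (coreGraph T).Adj x y :=
  ⟨hy, hz.prev hy.1.symm hyz.symm⟩

theorem coreGraph_leafless (hlf : ∀ x, (T.neighborSet x).Finite) {x y : V}
    (h : (coreGraph T).Adj x y) : ∃ z, z ≠ x ∧ (coreGraph T).Adj y z := by
  obtain ⟨z, hzx, hz⟩ := h.1.next hlf
  exact ⟨z, hzx, coreGraph_adj_of_two hz h.2 hzx⟩

/-- The pair `d` starts a walk with a unique nonbacktracking continuation. -/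
def StraightDart (H : SimpleGraph V) (d : V × V) : Prop :=
  H.Adj d.1 d.2 ∧ ¬ ∃ e, DartReach H d e ∧ IsNode H e.2

/-- A leafless graph all of whose edges lead to nodes without backtracking. -/
structure Branching (H : SimpleGraph V) : Prop where
  leafless : ∀ x y, H.Adj x y → ∃ z, z ≠ x ∧ H.Adj y z
  node : ∀ x y, H.Adj x y → ∃ e, DartReach H (x, y) e ∧ IsNode H e.2

theorem eq_of_not_isNode (hlf : ∀ x, (H.neighborSet x).Finite) {x y z w : V} (h : ¬ IsNode H x)
    (hy : H.Adj x y) (hz : H.Adj x z) (hw : H.Adj x w) (hyz : y ≠ z) (hyw : y ≠ w) : z = w := by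
  by_contra hzw
  refine h ?_
  have : ({y, z, w} : Set V).ncard = 3 := ncard_eq_three.2 ⟨y, z, w, hyz, hyw, hzw, rfl⟩
  unfold IsNode
  rw [← this]
  refine ncard_le_ncard ?_ (hlf x)
  rintro a (rfl | rfl | rfl)
  exacts [hy, hz, hw]

theorem StraightDart.of_reach {d e : V × V} (h : StraightDart H d) (hde : DartReach H d e) :
    StraightDart H e :=
  ⟨hde.adj h.1, fun ⟨e', he', hn⟩ => h.2 ⟨e', hde.trans he', hn⟩⟩

theorem noBack_single {D : Set V} {f : V → V} (hf : ∀ x ∈ D, InfDart T (x, f x))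
    (hu : ∀ x ∈ D, ∀ y, InfDart T (x, y) → y = f x) (hlf : ∀ x, (T.neighborSet x).Finite) :
    NoBack D f := by
  rintro ⟨u, hu'⟩
  have hI : ∀ i, InfDart T (u (i + 1), u i) := by
    intro i
    have := hf _ (hu' i).1
    rwa [(hu' i).2] at this
  have hne : ∀ i, u i ≠ u (i + 2) := by
    intro i he
    obtain ⟨z, hz, hI2⟩ := (hI i).next hlf
    rw [he] at hI2
    have h3 := hu _ (hu' (i + 1)).1 z hI2
    rw [(hu' (i + 1)).2] at h3
    exact hz h3
  have h1 : InfDart T (u 1, u 2) := by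
    refine ⟨(hI 1).1.symm, fun n => ?_⟩
    refine chainLen_of_seq n (fun i => (u (i + 1), u (i + 2))) fun i => ⟨rfl, (hI (i + 2)).1.symm, ?_⟩
    exact (hne (i + 1)).symm
  have := hu _ (hu' 0).1 _ h1
  rw [(hu' 0).2] at this
  exact hne 0 this.symm

theorem noBack_straight {D : Set V} {f : V → V} (hf : ∀ x ∈ D, StraightDart H (x, f x))
    (hno : ∀ x y, StraightDart H (x, y) → ¬ StraightDart H (y, x))
    (hlf : ∀ x, (H.neighborSet x).Finite) : NoBack D f := by
  rintro ⟨u, hu⟩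
  have hS : ∀ i, StraightDart H (u (i + 1), u i) := by
    intro i
    have := hf _ (hu i).1
    rwa [(hu i).2] at this
  have hne : ∀ i, u i ≠ u (i + 2) := by
    intro i he
    have h1 := hS (i + 1)
    rw [← he] at h1
    exact hno _ _ h1 (hS i)
  refine hno _ _ (hS 1) ⟨(hS 1).1.symm, ?_⟩
  rintro ⟨e, he, hn⟩
  have key : ∀ e, DartReach H (u 1, u 2) e → ∃ i, e = (u (i + 1), u (i + 2)) := by
    intro e he
    induction he with
    | refl => exact ⟨0, rfl⟩
    | @tail b c _ hbc ih =>
      obtain ⟨i, rfl⟩ := ih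
      refine ⟨i + 1, ?_⟩
      have hnn : ¬ IsNode H (u (i + 2)) := fun h =>
        (hS (i + 2)).2 ⟨_, ReflTransGen.refl, h⟩
      have := eq_of_not_isNode hlf hnn (hS (i + 1)).1 hbc.2.1 (hS (i + 2)).1.symm hbc.2.2.symm
        (hne (i + 1))
      exact Prod.ext hbc.1 this
  obtain ⟨i, rfl⟩ := key e he
  exact (hS (i + 2)).2 ⟨_, ReflTransGen.refl, hn⟩

end CoreGraph

section BranchingCore

open Relation Set

variable {X : Type*} [MeasurableSpace X] [StandardBorelSpace X]

theorem exists_branching_core [Nonempty X] {T : SimpleGraph X}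
    (hT : Measurable fun p : X × X => T.Adj p.1 p.2) (hlf : ∀ x, (T.neighborSet x).Finite)
    (hno : ∀ x y, StraightDart (coreGraph T) (x, y) → ¬ StraightDart (coreGraph T) (y, x)) :
    ∃ H : SimpleGraph X, (Measurable fun p : X × X => H.Adj p.1 p.2) ∧ H ≤ T ∧ Branching H ∧
      ∃ (D : Set X) (f : X → X), (Measurable fun x => x ∈ D) ∧ Measurable f ∧ NoBack D f ∧
        (∀ x ∈ D, T.Adj x (f x)) ∧ (∀ x ∈ D, ¬ ∃ y, H.Adj x y) ∧
        ∀ x, (∃ y, InfDart T (x, y)) → x ∈ D ∨ ∃ y, H.Adj x y := by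
  have hI := measurable_infDart hT hlf
  have hI' : Measurable fun p : X × X => InfDart T (p.1, p.2) := hI
  have hIfin : ∀ x, {y | InfDart T (x, y)}.Finite := fun x => (hlf x).subset fun y hy => hy.1
  set C := coreGraph T with hCdef
  have hC : Measurable fun p : X × X => C.Adj p.1 p.2 := by
    have : Measurable fun p : X × X => InfDart T (p.2, p.1) := hI.comp measurable_swap
    exact hI'.and this
  have hClf : ∀ x, (C.neighborSet x).Finite := fun x =>
    (hlf x).subset fun y hy => coreGraph_le hy
  have hCleaf : ∀ x y, C.Adj x y → ∃ z, z ≠ x ∧ C.Adj y z := fun x y h => coreGraph_leafless hlf h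
  have hnode := measurable_isNode hC hClf
  have hS : Measurable (StraightDart C) := by
    have := measurable_exists_dartReach hC hClf (A := fun e => IsNode C e.2)
      (hnode.comp measurable_snd)
    exact hC.and this.not
  have hS' : Measurable fun p : X × X => StraightDart C (p.1, p.2) := hS
  have hSfin : ∀ x, {y | StraightDart C (x, y)}.Finite := fun x =>
    (hClf x).subset fun y hy => hy.1
  let N : Set X := {x | ∃ y, InfDart T (x, y) ∧ ∀ z, InfDart T (x, z) → z = y}
  let A : Set X := {x | ∃ y, StraightDart C (x, y)}
  have hA : Measurable fun x => x ∈ A := measurable_exists hS' hSfin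
  have hN : Measurable fun x => x ∈ N := by
    have h2 : Measurable fun p : X × X => ∀ z, InfDart T (p.1, z) → z = p.2 := by
      refine measurable_forall_imp (X := X × X) (R := fun p z => InfDart T (p.1, z))
        (S := fun p z => z = p.2) ?_ (by fun_prop) fun p => hIfin p.1
      exact hI.comp (f := fun q : (X × X) × X => (q.1.1, q.2)) (by fun_prop)
    exact measurable_exists (R := fun x y => InfDart T (x, y) ∧ ∀ z, InfDart T (x, z) → z = y)
      (hI'.and h2) fun x => (hIfin x).subset fun y hy => hy.1
  have hAr : Measurable fun x => ∃ a, C.Reachable x a ∧ a ∈ A :=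
    measurable_exists_reachable hC hClf hA
  -- the three pieces
  obtain ⟨f1, hf1, hf1I⟩ := exists_select hI' hIfin
  obtain ⟨f2, hf2, hf2S⟩ := exists_select hS' hSfin
  obtain ⟨f3, hf3, hf3n, hf3a⟩ := exists_extension C hC hClf hA
  have hf2S' : ∀ x ∈ A, StraightDart C (x, f2 x) := fun x hx => hf2S x hx
  have hNC : ∀ x ∈ N, ¬ ∃ y, C.Adj x y := by
    rintro x ⟨y, hy, hyu⟩ ⟨z, hz⟩
    obtain ⟨z', hz', hI2⟩ := hz.2.next hlf
    exact hz' ((hyu _ hI2).trans (hyu _ hz.1).symm)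
  have hAC : ∀ x ∈ A, ∃ y, C.Adj x y := fun x ⟨y, hy⟩ => ⟨y, hy.1⟩
  let E : Set X := {x | x ∉ A ∧ ∃ a, C.Reachable x a ∧ a ∈ A}
  have hE : Measurable fun x => x ∈ E := hA.not.and hAr
  obtain ⟨g, hg, hgn, hgE, hgA⟩ := exists_glue_two (D := E) (E := A) hE hA (fun x hx => hx.1)
    hf3 hf2 hf3n (noBack_straight hf2S' hno hClf) (by
      rintro x hx ⟨h1, -⟩
      obtain ⟨z, hz, hz'⟩ := hCleaf _ _ (hf2S' x hx).1
      exact h1 ⟨z, (hf2S' x hx).of_reach (ReflTransGen.single ⟨rfl, hz', hz⟩)⟩)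
  have hgadj : ∀ x, (x ∈ E ∨ x ∈ A) → C.Adj x (g x) := by
    rintro x (hx | hx)
    · rw [hgE x hx]
      exact hf3a x hx.1 hx.2
    · rw [hgA x hx]
      exact (hf2S' x hx).1
  obtain ⟨f, hf, hfn, hfN, hfg⟩ := exists_glue_two (D := N) (E := {x | x ∈ E ∨ x ∈ A}) hN
    (hE.or hA) (fun x hx h => hNC x hx ⟨_, hgadj x h⟩) hf1 hg
    (noBack_single (T := T) (fun x hx => hf1I x (hx.imp fun y hy => hy.1)) (by
      rintro x ⟨y, hy, hyu⟩ z hz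
      exact (hyu z hz).trans (hyu _ (hf1I x ⟨y, hy⟩)).symm) hlf) hgn
    (fun x hx h => hNC _ h ⟨_, (hgadj x hx).symm⟩)
  let H : SimpleGraph X :=
    { Adj := fun x y => C.Adj x y ∧ (¬ ∃ a, C.Reachable x a ∧ a ∈ A) ∧
        ¬ ∃ a, C.Reachable y a ∧ a ∈ A
      symm := ⟨fun _ _ h => ⟨h.1.symm, h.2.2, h.2.1⟩⟩
      loopless := ⟨fun _ h => h.1.ne rfl⟩ }
  have hHof : ∀ x y, (¬ ∃ a, C.Reachable x a ∧ a ∈ A) → C.Adj x y → H.Adj x y :=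
    fun x y hx hxy => ⟨hxy, hx, fun ⟨a, ha, haA⟩ => hx ⟨a, hxy.reachable.trans ha, haA⟩⟩
  refine ⟨H, ?_, fun x y h => coreGraph_le h.1, ⟨?_, ?_⟩, {x | x ∈ N ∨ x ∈ {x | x ∈ E ∨ x ∈ A}},
    f, hN.or (hE.or hA), hf, hfn, ?_, ?_, ?_⟩
  · exact hC.and ((hAr.comp measurable_fst).not.and (hAr.comp measurable_snd).not)
  · rintro x y ⟨hxy, -, hy⟩
    obtain ⟨z, hz, hyz⟩ := hCleaf x y hxy
    exact ⟨z, hz, hHof y z hy hyz⟩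
  · rintro x y ⟨hxy, hx, hy⟩
    have h1 : ¬ StraightDart C (x, y) := fun h => hx ⟨x, SimpleGraph.Reachable.refl _, y, h⟩
    obtain ⟨e, he, hn⟩ := not_not.1 fun h => h1 ⟨hxy, h⟩
    have key : DartReach H (x, y) e ∧ ¬ ∃ a, C.Reachable e.2 a ∧ a ∈ A := by
      clear hn
      induction he with
      | refl => exact ⟨ReflTransGen.refl, hy⟩
      | tail _ hbc ih =>
        have := hHof _ _ ih.2 hbc.2.1
        exact ⟨ih.1.tail ⟨hbc.1, this, hbc.2.2⟩, this.2.2⟩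
    refine ⟨e, key.1, ?_⟩
    have : H.neighborSet e.2 = C.neighborSet e.2 := by
      ext z
      exact ⟨fun h => h.1, fun h => hHof _ _ key.2 h⟩
    unfold IsNode
    rwa [this]
  · rintro x (hx | hx)
    · rw [hfN x hx]
      exact (hf1I x (hx.imp fun y hy => hy.1)).1
    · rw [hfg x hx]
      exact coreGraph_le (hgadj x hx)
  · rintro x (hx | hx) ⟨y, hy⟩
    · exact hNC x hx ⟨y, hy.1⟩
    · rcases hx with hx | hx
      · exact hy.2.1 hx.2
      · exact hy.2.1 ⟨x, SimpleGraph.Reachable.refl _, hx⟩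
  · rintro x ⟨y, hy⟩
    by_cases hx : ∃ a, C.Reachable x a ∧ a ∈ A
    · by_cases hxA : x ∈ A
      · exact Or.inl (Or.inr (Or.inr hxA))
      · exact Or.inl (Or.inr (Or.inl ⟨hxA, hx⟩))
    · by_cases hxN : x ∈ N
      · exact Or.inl (Or.inl hxN)
      · have : ∃ z, InfDart T (x, z) ∧ z ≠ y := by
          by_contra hcon
          push Not at hcon
          exact hxN ⟨y, hy, hcon⟩
        obtain ⟨z, hz, hzy⟩ := this
        exact Or.inr ⟨y, hHof x y hx (coreGraph_adj_of_two hy hz hzy.symm)⟩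

end BranchingCore

section TopologicalEdges

open Relation Set

variable {V : Type*} {H : SimpleGraph V}

/-- A nonbacktracking step through a vertex which is not a node. -/
def StraightStep (H : SimpleGraph V) (d e : V × V) : Prop :=
  DartStep H d e ∧ ¬ IsNode H d.2

/-- `e` is the first pair on the nonbacktracking walk along `d` which ends at a node. -/
def TermRel (H : SimpleGraph V) (d e : V × V) : Prop :=
  H.Adj d.1 d.2 ∧ ReflTransGen (StraightStep H) d e ∧ IsNode H e.2

theorem dartReach_of_straight {d e : V × V} (h : ReflTransGen (StraightStep H) d e) :
    DartReach H d e :=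
  ReflTransGen.mono (r := StraightStep H) (p := DartStep H) (fun _ _ h => h.1) _ _ h

theorem TermRel.unique (hlf : ∀ x, (H.neighborSet x).Finite) {d e e' : V × V} (h : TermRel H d e)
    (h' : TermRel H d e') : e = e' := by
  obtain ⟨hd, hde, hn⟩ := h
  obtain ⟨-, hde', hn'⟩ := h'
  induction hde using ReflTransGen.head_induction_on with
  | refl =>
    rcases ReflTransGen.cases_head hde' with h | ⟨c, hc, -⟩
    · exact h
    · exact absurd hn hc.2
  | @head a c hac _ ih =>
    rcases ReflTransGen.cases_head hde' with h | ⟨c', hc', hce'⟩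
    · subst h
      exact absurd hn' hac.2
    · have hcc : c = c' := Prod.ext (hac.1.1.trans hc'.1.1.symm)
        (eq_of_not_isNode hlf hac.2 hd.symm hac.1.2.1 hc'.1.2.1 hac.1.2.2.symm hc'.1.2.2.symm)
      subst hcc
      refine ih ?_ hce'
      rw [hac.1.1]
      exact hac.1.2.1

theorem TermRel.head {d e t : V × V} (hd : H.Adj d.1 d.2)
    (h : ReflTransGen (StraightStep H) d e) (he : TermRel H e t) : TermRel H d t :=
  ⟨hd, h.trans he.2.1, he.2.2⟩

theorem straight_swap {d e : V × V} (hd : H.Adj d.1 d.2)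
    (h : ReflTransGen (StraightStep H) d e) : ReflTransGen (StraightStep H) e.swap d.swap := by
  induction h with
  | refl => exact ReflTransGen.refl
  | @tail b c hab hbc ih =>
    refine ReflTransGen.head ⟨⟨hbc.1.1.symm, ?_, ?_⟩, ?_⟩ ih
    · simp only [Prod.snd_swap, hbc.1.1]
      exact ((dartReach_of_straight hab).adj hd).symm
    · simpa using hbc.1.2.2.symm
    · simp only [Prod.snd_swap, hbc.1.1]
      exact hbc.2

theorem Branching.exists_termRel (hB : Branching H) {d : V × V} (hd : H.Adj d.1 d.2) :
    ∃ e, TermRel H d e := by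
  obtain ⟨e, he, hn⟩ := hB.node _ _ hd
  have he' : DartReach H d e := he
  clear he
  induction he' using ReflTransGen.head_induction_on with
  | refl => exact ⟨e, hd, ReflTransGen.refl, hn⟩
  | @head a c hac _ ih =>
    by_cases ha : IsNode H a.2
    · exact ⟨a, hd, ReflTransGen.refl, ha⟩
    · obtain ⟨t, ht⟩ := ih (by rw [hac.1]; exact hac.2.1)
      exact ⟨t, ht.head hd (ReflTransGen.single ⟨hac, ha⟩)⟩

open Classical in
/-- The end of the topological edge along `d`. -/
noncomputable def termOf (H : SimpleGraph V) (d : V × V) : V × V :=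
  if h : ∃ e, TermRel H d e then h.choose else d

theorem TermRel.termOf_eq (hlf : ∀ x, (H.neighborSet x).Finite) {d e : V × V}
    (h : TermRel H d e) : termOf H d = e := by
  have h' : ∃ e, TermRel H d e := ⟨e, h⟩
  unfold termOf
  rw [dif_pos h']
  exact h'.choose_spec.unique hlf h

/-- A representative of the topological edge through `d`, independent of the orientation. -/
noncomputable def repOf (H : SimpleGraph V) (w : V × V → ℝ) (d : V × V) : V × V :=
  if w (termOf H d) ≤ w (termOf H d.swap) then termOf H d else termOf H d.swap

variable {w : V × V → ℝ}

theorem repOf_swap (hw : Function.Injective w) (d : V × V) : repOf H w d.swap = repOf H w d := by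
  unfold repOf
  rw [Prod.swap_swap]
  split_ifs with h1 h2 h2
  · exact hw (le_antisymm h1 h2)
  · rfl
  · rfl
  · exact absurd (le_of_not_ge h1) h2

theorem repOf_mem (d : V × V) : repOf H w d = termOf H d ∨ repOf H w d = termOf H d.swap := by
  unfold repOf
  split_ifs
  exacts [Or.inl rfl, Or.inr rfl]

theorem termOf_node {x q : V} (hlf : ∀ x, (H.neighborSet x).Finite) (hd : H.Adj x q) (hq : IsNode H q) :
    termOf H (x, q) = (x, q) :=
  TermRel.termOf_eq (d := (x, q)) hlf ⟨hd, ReflTransGen.refl, hq⟩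

variable (hlf : ∀ x, (H.neighborSet x).Finite) (hB : Branching H)
include hlf hB

theorem termRel_termOf {d : V × V} (hd : H.Adj d.1 d.2) : TermRel H d (termOf H d) := by
  obtain ⟨e, he⟩ := hB.exists_termRel hd
  rwa [he.termOf_eq hlf]

theorem termOf_straight {d e : V × V} (hd : H.Adj d.1 d.2)
    (h : ReflTransGen (StraightStep H) d e) : termOf H d = termOf H e :=
  ((termRel_termOf hlf hB ((dartReach_of_straight h).adj hd)).head hd h).termOf_eq hlf

theorem termOf_swap_straight {d e : V × V} (hd : H.Adj d.1 d.2)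
    (h : ReflTransGen (StraightStep H) d e) : termOf H e.swap = termOf H d.swap :=
  termOf_straight hlf hB ((dartReach_of_straight h).adj hd).symm (straight_swap hd h)

theorem repOf_straight {d e : V × V} (hd : H.Adj d.1 d.2)
    (h : ReflTransGen (StraightStep H) d e) : repOf H w d = repOf H w e := by
  unfold repOf
  rw [termOf_straight hlf hB hd h, termOf_swap_straight hlf hB hd h]

theorem termOf_swap_termOf {q a : V} (hd : H.Adj q a) (hq : IsNode H q) :
    termOf H (termOf H (q, a)).swap = (a, q) := by
  rw [termOf_swap_straight hlf hB (d := (q, a)) hd (termRel_termOf hlf hB hd).2.1]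
  exact termOf_node hlf hd.symm hq

theorem repOf_eq_cases {q a q' a' : V} (hq : IsNode H q) (hq' : IsNode H q') (ha : H.Adj q a)
    (ha' : H.Adj q' a') (h : repOf H w (q, a) = repOf H w (q', a')) :
    (q = q' ∧ a = a') ∨ termOf H (q, a) = (a', q') := by
  have h1 := repOf_mem (H := H) (w := w) (q, a)
  have h2 := repOf_mem (H := H) (w := w) (q', a')
  rw [show (q, a).swap = (a, q) from rfl, termOf_node hlf ha.symm hq] at h1
  rw [show (q', a').swap = (a', q') from rfl, termOf_node hlf ha'.symm hq'] at h2
  rcases h1 with h1 | h1 <;> rcases h2 with h2 | h2 <;> rw [h1, h2] at h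
  · have e1 := termOf_swap_termOf hlf hB ha hq
    rw [h, termOf_swap_termOf hlf hB ha' hq'] at e1
    simp only [Prod.mk.injEq] at e1
    exact Or.inl ⟨e1.2.symm, e1.1.symm⟩
  · exact Or.inr h
  · have e1 := termOf_swap_termOf hlf hB ha' hq'
    rw [← h] at e1
    exact Or.inr e1
  · simp only [Prod.mk.injEq] at h
    exact Or.inl ⟨h.2, h.1⟩

end TopologicalEdges

section RemoveLabel

open Relation Set

variable {V : Type*} {H : SimpleGraph V}

/-- The nodes at distance at most one, along chosen edges, from the topological edge of `t`. -/
noncomputable def nearNode (H : SimpleGraph V) (p : Fin 3 → V → V) (b : Bool) (o : Option (Fin 3))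
    (t : V × V) : V :=
  let q := if b then t.2 else (termOf H t.swap).2
  match o with
  | none => q
  | some k => (termOf H (q, p k q)).2

/-- `t'` represents a chosen topological edge at a node near `t`. -/
def Conflict (H : SimpleGraph V) (w : V × V → ℝ) (p : Fin 3 → V → V) (t t' : V × V) : Prop :=
  ∃ b o i, t' = repOf H w (nearNode H p b o t, p i (nearNode H p b o t))

/-- Remove all edges whose topological edge has color `j`. -/
noncomputable def removeLabel (H : SimpleGraph V) {w : V × V → ℝ} (hw : Function.Injective w)
    (c : V × V → ℕ) (j : ℕ) : SimpleGraph V where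
  Adj x y := H.Adj x y ∧ c (repOf H w (x, y)) ≠ j
  symm := ⟨fun x y h => ⟨h.1.symm, by
    rw [show (y, x) = (x, y).swap from rfl, repOf_swap hw]
    exact h.2⟩⟩
  loopless := ⟨fun _ h => h.1.ne rfl⟩

variable {w : V × V → ℝ} {p : Fin 3 → V → V} {c : V × V → ℕ} {j : ℕ}
  (hlf : ∀ x, (H.neighborSet x).Finite) (hB : Branching H)

include hlf hB in
theorem nearNode_none {q a : V} (hq : IsNode H q) (ha : H.Adj q a) :
    ∃ b, nearNode H p b none (repOf H w (q, a)) = q := by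
  rcases repOf_mem (H := H) (w := w) (q, a) with h | h
  · refine ⟨false, ?_⟩
    rw [h]
    simp [nearNode, termOf_swap_termOf hlf hB ha hq]
  · refine ⟨true, ?_⟩
    rw [h, show (q, a).swap = (a, q) from rfl, termOf_node hlf ha.symm hq]
    simp [nearNode]

include hlf hB in
theorem conflict_same {q a : V} (hq : IsNode H q) (ha : H.Adj q a) (i : Fin 3) :
    Conflict H w p (repOf H w (q, a)) (repOf H w (q, p i q)) := by
  obtain ⟨b, hb⟩ := nearNode_none (w := w) (p := p) hlf hB hq ha
  exact ⟨b, none, i, by rw [hb]⟩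

include hlf hB in
theorem conflict_next {q a : V} (hq : IsNode H q) (ha : H.Adj q a) (k i : Fin 3) :
    Conflict H w p (repOf H w (q, a)) (repOf H w ((termOf H (q, p k q)).2,
      p i (termOf H (q, p k q)).2)) := by
  obtain ⟨b, hb⟩ := nearNode_none (w := w) (p := p) hlf hB hq ha
  refine ⟨b, some k, i, ?_⟩
  have : nearNode H p b (some k) (repOf H w (q, a)) = (termOf H (q, p k q)).2 := by
    unfold nearNode at hb ⊢
    dsimp only at hb ⊢
    rw [hb]
  rw [this]

variable (hac : H.IsAcyclic) (hw : Function.Injective w)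
  (hpa : ∀ q, IsNode H q → ∀ i, H.Adj q (p i q))
  (hpi : ∀ q, IsNode H q → ∀ i k, p i q = p k q → i = k)
  (hc : ∀ t t', Conflict H w p t t' → Conflict H w p t' t → t ≠ t' → c t ≠ c t')

include hlf hB hac hpa hpi hc

theorem label_ne_same {q : V} (hq : IsNode H q) {i k : Fin 3} (hik : i ≠ k) :
    c (repOf H w (q, p i q)) ≠ c (repOf H w (q, p k q)) := by
  refine hc _ _ (conflict_same hlf hB hq (hpa q hq i) k) (conflict_same hlf hB hq (hpa q hq k) i) ?_
  intro h
  rcases repOf_eq_cases hlf hB hq hq (hpa q hq i) (hpa q hq k) h with h | h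
  · exact hik (hpi q hq _ _ h.2)
  · have h1 := (dartReach_of_straight (termRel_termOf hlf hB (d := (q, p i q)) (hpa q hq i)).2.1)
    have := h1.ne hac (hpa q hq i)
    rw [h] at this
    exact this rfl

theorem label_ne_next {q q' : V} (hq : IsNode H q) (hq' : IsNode H q') {i k i' k' : Fin 3}
    (hik : i ≠ k) (ht : termOf H (q, p k q) = (p k' q', q')) :
    c (repOf H w (q, p i q)) ≠ c (repOf H w (q', p i' q')) := by
  have ht' : termOf H (q', p k' q') = (p k q, q) := by
    have := termOf_swap_termOf hlf hB (hpa q hq k) hq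
    rwa [ht] at this
  refine hc _ _ ?_ ?_ ?_
  · have := conflict_next (w := w) (p := p) hlf hB hq (hpa q hq i) k i'
    rwa [ht] at this
  · have := conflict_next (w := w) (p := p) hlf hB hq' (hpa q' hq' i') k' i
    rwa [ht'] at this
  · intro h
    have h1 := (dartReach_of_straight (termRel_termOf hlf hB (d := (q, p k q)) (hpa q hq k)).2.1)
    rw [ht] at h1
    rcases repOf_eq_cases hlf hB hq hq' (hpa q hq i) (hpa q' hq' i') h with h | h
    · exact h1.ne hac (hpa q hq k) h.1
    · have h2 := (dartReach_of_straight (termRel_termOf hlf hB (d := (q, p i q)) (hpa q hq i)).2.1)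
      rw [h] at h2
      exact hik (hpi q hq _ _ (h2.snd_unique hac h1 (hpa q hq i) (hpa q hq k)))

theorem exists_kept_of_node {q : V} (hq : IsNode H q) (x : V) :
    ∃ i, p i q ≠ x ∧ (removeLabel H hw c j).Adj q (p i q) := by
  by_contra hcon
  push Not at hcon
  have h1 : ∀ i k, i ≠ k → p i q ≠ x → p k q ≠ x → False := by
    intro i k hik hi hk
    have hi' : c (repOf H w (q, p i q)) = j := not_not.1 fun h => hcon i hi ⟨hpa q hq i, h⟩
    have hk' : c (repOf H w (q, p k q)) = j := not_not.1 fun h => hcon k hk ⟨hpa q hq k, h⟩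
    exact label_ne_same hlf hB hac hpa hpi hc hq hik (hi'.trans hk'.symm)
  have h2 : ∀ i k, i ≠ k → p i q ≠ x ∨ p k q ≠ x := by
    intro i k hik
    by_contra hcon
    push Not at hcon
    exact hik (hpi q hq _ _ (hcon.1.trans hcon.2.symm))
  have a := h1 0 1 (by decide)
  have b := h1 0 2 (by decide)
  have d := h1 1 2 (by decide)
  have a' := h2 0 1 (by decide)
  have b' := h2 0 2 (by decide)
  have d' := h2 1 2 (by decide)
  tauto

theorem removeLabel_leafless {x y : V} (h : (removeLabel H hw c j).Adj x y) :
    ∃ z, z ≠ x ∧ (removeLabel H hw c j).Adj y z := by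
  by_cases hy : IsNode H y
  · obtain ⟨i, hi, hi'⟩ := exists_kept_of_node (j := j) hlf hB hac hw hpa hpi hc hy x
    exact ⟨_, hi, hi'⟩
  · obtain ⟨z, hz, hyz⟩ := hB.leafless x y h.1
    refine ⟨z, hz, hyz, ?_⟩
    rw [← repOf_straight hlf hB (d := (x, y)) h.1 (ReflTransGen.single ⟨⟨rfl, hyz, hz⟩, hy⟩)]
    exact h.2

omit hac hpa hpi hc in
theorem removeLabel_reach {d e : V × V} (hd : (removeLabel H hw c j).Adj d.1 d.2)
    (h : ReflTransGen (StraightStep H) d e) : DartReach (removeLabel H hw c j) d e := by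
  induction h with
  | refl => exact ReflTransGen.refl
  | @tail a b hab hbc ih =>
    refine ih.tail ⟨hbc.1.1, ⟨hbc.1.2.1, ?_⟩, hbc.1.2.2⟩
    have := repOf_straight (w := w) hlf hB hd.1 (hab.tail hbc)
    rw [← hbc.1.1]
    change c (repOf H w b) ≠ j
    rw [← this]
    exact hd.2

theorem exists_lost_of_not_isNode {q : V} (hq : IsNode H q)
    (hq' : ¬ IsNode (removeLabel H hw c j) q) : ∃ l, c (repOf H w (q, p l q)) = j ∧
      ∀ v, (removeLabel H hw c j).Adj q v → ∃ k, v = p k q ∧ l ≠ k := by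
  have hlf' : ∀ x, ((removeLabel H hw c j).neighborSet x).Finite := fun x =>
    (hlf x).subset fun y hy => hy.1
  have hl : ∃ l, c (repOf H w (q, p l q)) = j := by
    by_contra hcon
    push Not at hcon
    have hne : ∀ i k, i ≠ k → p i q ≠ p k q := fun i k hik h => hik (hpi q hq _ _ h)
    exact hne 1 2 (by decide) (eq_of_not_isNode hlf' hq' ⟨hpa q hq 0, hcon 0⟩ ⟨hpa q hq 1, hcon 1⟩
      ⟨hpa q hq 2, hcon 2⟩ (hne 0 1 (by decide)) (hne 0 2 (by decide)))
  obtain ⟨l, hl⟩ := hl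
  refine ⟨l, hl, fun v hv => ?_⟩
  have hkeep : ∀ k, l ≠ k → (removeLabel H hw c j).Adj q (p k q) := fun k hk =>
    ⟨hpa q hq k, fun h => label_ne_same hlf hB hac hpa hpi hc hq hk (hl.trans h.symm)⟩
  have h3 : ∀ l : Fin 3, ∃ k1 k2 : Fin 3, l ≠ k1 ∧ l ≠ k2 ∧ k1 ≠ k2 := by decide
  obtain ⟨k1, k2, h1, h2, h12⟩ := h3 l
  by_cases hv1 : p k1 q = v
  · exact ⟨k1, hv1.symm, h1⟩
  · exact ⟨k2, eq_of_not_isNode hlf' hq' (hkeep k1 h1) hv (hkeep k2 h2) hv1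
      fun h => h12 (hpi q hq _ _ h), h2⟩

theorem removeLabel_branching : Branching (removeLabel H hw c j) := by
  refine ⟨fun x y h => removeLabel_leafless hlf hB hac hw hpa hpi hc h, fun x y hxy => ?_⟩
  by_contra hcon
  have h1 := termRel_termOf hlf hB (d := (x, y)) hxy.1
  rcases ht0 : termOf H (x, y) with ⟨u, q⟩
  rw [ht0] at h1
  have hq : IsNode H q := h1.2.2
  have hr1 : DartReach (removeLabel H hw c j) (x, y) (u, q) :=
    removeLabel_reach hlf hB hw hxy h1.2.1
  have hqj : ¬ IsNode (removeLabel H hw c j) q := fun h => hcon ⟨_, hr1, h⟩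
  obtain ⟨l, hl, hlv⟩ := exists_lost_of_not_isNode hlf hB hac hw hpa hpi hc hq hqj
  obtain ⟨a, hau, hqa⟩ := removeLabel_leafless hlf hB hac hw hpa hpi hc (hr1.adj hxy)
  obtain ⟨k, rfl, hlk⟩ := hlv a hqa
  have h2 := termRel_termOf hlf hB (d := (q, p k q)) hqa.1
  rcases ht : termOf H (q, p k q) with ⟨a', q'⟩
  rw [ht] at h2
  have hq' : IsNode H q' := h2.2.2
  have hr2 : DartReach (removeLabel H hw c j) (q, p k q) (a', q') :=
    removeLabel_reach hlf hB hw hqa h2.2.1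
  have hqj' : ¬ IsNode (removeLabel H hw c j) q' := fun h =>
    hcon ⟨_, (hr1.tail ⟨rfl, hqa, hau⟩).trans hr2, h⟩
  obtain ⟨l', hl', hlv'⟩ := exists_lost_of_not_isNode hlf hB hac hw hpa hpi hc hq' hqj'
  obtain ⟨k', rfl, -⟩ := hlv' a' (hr2.adj hqa).symm
  exact label_ne_next hlf hB hac hpa hpi hc hq hq' hlk ht (hl.trans hl'.symm)

end RemoveLabel

section Sparser

open Relation Set

variable {X : Type*} [MeasurableSpace X] [StandardBorelSpace X] {H : SimpleGraph X}

theorem measurable_termOf [Nonempty X] (hH : Measurable fun p : X × X => H.Adj p.1 p.2)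
    (hlf : ∀ x, (H.neighborSet x).Finite) : Measurable (termOf H) := by
  classical
  have hD := measurable_dartStep hH
  have hN := measurable_isNode hH hlf
  have hS : Measurable fun p : (X × X) × X × X => StraightStep H p.1 p.2 := by
    unfold StraightStep
    have : Measurable fun p : (X × X) × X × X => IsNode H p.1.2 := hN.comp (by fun_prop)
    fun_prop
  have hT : Measurable fun p : (X × X) × X × X => TermRel H p.1 p.2 := by
    have h1 := measurable_reflTransGen hS fun d =>
      (dartStep_finite hlf d).subset fun e he => he.1
    have h2 : Measurable fun p : (X × X) × X × X => H.Adj p.1.1 p.1.2 := hH.comp measurable_fst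
    have h3 : Measurable fun p : (X × X) × X × X => IsNode H p.2.2 := hN.comp (by fun_prop)
    unfold TermRel
    fun_prop
  have hfin : ∀ d, {e | TermRel H d e}.Finite := fun d =>
    Subsingleton.finite fun e he e' he' => TermRel.unique hlf he he'
  obtain ⟨f, hf, hfR⟩ := exists_select hT hfin
  have : termOf H = fun d => if ∃ e, TermRel H d e then f d else d := by
    ext1 d
    by_cases h : ∃ e, TermRel H d e
    · rw [if_pos h]
      exact (hfR d h).termOf_eq hlf
    · rw [if_neg h]
      exact dif_neg h
  rw [this]
  exact Measurable.ite (measurable_exists hT hfin).setOf hf measurable_id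

theorem measurable_repOf [Nonempty X] (hH : Measurable fun p : X × X => H.Adj p.1 p.2)
    (hlf : ∀ x, (H.neighborSet x).Finite) {w : X × X → ℝ} (hw : Measurable w) :
    Measurable (repOf H w) := by
  have h := measurable_termOf hH hlf
  have h' : Measurable fun d : X × X => termOf H d.swap := h.comp measurable_swap
  unfold repOf
  exact Measurable.ite (measurableSet_le (hw.comp h) (hw.comp h')) h h'

theorem measurable_nearNode [Nonempty X] (hH : Measurable fun p : X × X => H.Adj p.1 p.2)
    (hlf : ∀ x, (H.neighborSet x).Finite) {p : Fin 3 → X → X} (hp : ∀ i, Measurable (p i))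
    (b : Bool) (o : Option (Fin 3)) : Measurable (nearNode H p b o) := by
  have h := measurable_termOf hH hlf
  have h' : Measurable fun d : X × X => termOf H d.swap := h.comp measurable_swap
  unfold nearNode
  cases b <;> cases o <;> simp <;> fun_prop

theorem exists_three_neighbors [Nonempty X] (hH : Measurable fun p : X × X => H.Adj p.1 p.2)
    (hlf : ∀ x, (H.neighborSet x).Finite) : ∃ p : Fin 3 → X → X, (∀ i, Measurable (p i)) ∧
      (∀ q, IsNode H q → ∀ i, H.Adj q (p i q)) ∧
      ∀ q, IsNode H q → ∀ i k, p i q = p k q → i = k := by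
  obtain ⟨f, hf, hfR⟩ := exists_select (Y := Fin 3 → X)
    (R := fun x t => ∀ i, H.Adj x (t i) ∧ ∀ k, t i = t k → i = k) (by
      have h1 : ∀ i, Measurable fun p : X × (Fin 3 → X) => H.Adj p.1 (p.2 i) := fun i =>
        hH.comp (f := fun p : X × (Fin 3 → X) => (p.1, p.2 i)) (by fun_prop)
      fun_prop) (fun x => (Set.Finite.pi' fun _ => hlf x).subset fun t ht i => (ht i).1)
  refine ⟨fun i x => f x i, fun i => by fun_prop, ?_, ?_⟩
  · intro q hq i
    refine (hfR q ?_ i).1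
    obtain ⟨t, ht, h⟩ := (le_ncard_iff_exists (hlf q) 3).1 hq
    exact ⟨t, fun i => ⟨h i, fun k hk => ht hk⟩⟩
  · intro q hq i
    refine (hfR q ?_ i).2
    obtain ⟨t, ht, h⟩ := (le_ncard_iff_exists (hlf q) 3).1 hq
    exact ⟨t, fun i => ⟨h i, fun k hk => ht hk⟩⟩

theorem exists_heavy_label {Y : Type*} [MeasurableSpace Y] (ν : Measure Y) [IsFiniteMeasure ν]
    {E : Set Y} {c : Y → ℕ} {d : ℕ} (hc : ∀ y, c y ≤ d) :
    ∃ j, ν.real E ≤ (d + 1) * ν.real {y | y ∈ E ∧ c y = j} := by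
  by_contra hcon
  push Not at hcon
  have h1 : E ⊆ ⋃ j ∈ Finset.range (d + 1), {y | y ∈ E ∧ c y = j} := by
    intro y hy
    simp only [mem_iUnion, Finset.mem_range]
    exact ⟨c y, Nat.lt_succ_of_le (hc y), hy, rfl⟩
  have h2 := (measureReal_mono (μ := ν) h1 (measure_ne_top _ _)).trans (measureReal_biUnion_finset_le _ _)
  have h3 : ∑ j ∈ Finset.range (d + 1), ν.real {y | y ∈ E ∧ c y = j} <
      ∑ j ∈ Finset.range (d + 1), ν.real E / (d + 1) :=
    Finset.sum_lt_sum_of_nonempty ⟨0, by simp⟩ fun j _ => by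
      rw [lt_div_iff₀ (by positivity), mul_comm]
      exact hcon j
  simp only [Finset.sum_const, Finset.card_range, nsmul_eq_mul, Nat.cast_add, Nat.cast_one] at h3
  rw [mul_div_cancel₀ _ (by positivity)] at h3
  linarith

theorem exists_sparser [Nonempty X] (hH : Measurable fun p : X × X => H.Adj p.1 p.2)
    (hlf : ∀ x, (H.neighborSet x).Finite) (hac : H.IsAcyclic) (hB : Branching H)
    (ν : Measure (X × X)) [IsFiniteMeasure ν] :
    ∃ H' : SimpleGraph X, (Measurable fun p : X × X => H'.Adj p.1 p.2) ∧ H' ≤ H ∧ Branching H' ∧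
      ν.real {p | H'.Adj p.1 p.2} ≤ 24 / 25 * ν.real {p | H.Adj p.1 p.2} ∧
      ∀ x y, H.Adj x y → ∃ a, H.Reachable x a ∧ ∃ b, H'.Adj a b := by
  obtain ⟨w, hwe⟩ := exists_measurableEmbedding_real (X × X)
  obtain ⟨p, hp, hpa, hpi⟩ := exists_three_neighbors hH hlf
  have hrep := measurable_repOf hH hlf hwe.measurable
  have hnear := measurable_nearNode hH hlf hp
  have hCset : ∀ t, {t' | Conflict H w p t t'} =
      (fun s : Bool × Option (Fin 3) × Fin 3 =>
        repOf H w (nearNode H p s.1 s.2.1 t, p s.2.2 (nearNode H p s.1 s.2.1 t))) '' univ := by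
    intro t
    ext t'
    simp [Conflict, eq_comm]
  obtain ⟨c, hcm, hcle, hc⟩ := exists_finite_coloring (R := Conflict H w p) (d := 24)
    (by
      unfold Conflict
      fun_prop)
    (fun t => by
      rw [hCset]
      exact finite_univ.image _)
    (fun t => by
      refine (ncard_le_ncard (t := {t' | Conflict H w p t t'}) (fun y hy => hy.1) ?_).trans ?_
      · rw [hCset]
        exact finite_univ.image _
      · rw [hCset]
        refine (ncard_image_le finite_univ).trans ?_
        rw [ncard_univ, Nat.card_eq_fintype_card]
        decide)
  obtain ⟨j, hj⟩ := exists_heavy_label ν (E := {p | H.Adj p.1 p.2})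
    (c := fun d => c (repOf H w d)) (d := 24) fun d => hcle _
  have hlab : Measurable fun p : X × X => c (repOf H w (p.1, p.2)) = j := by fun_prop
  refine ⟨removeLabel H hwe.injective c j, ?_, fun x y h => h.1,
    removeLabel_branching hlf hB hac hwe.injective hpa hpi hc, ?_, ?_⟩
  · exact hH.and hlab.not
  · have hd := measureReal_sdiff (μ := ν) (s₁ := {p : X × X | H.Adj p.1 p.2})
      (s₂ := {y | y ∈ {p : X × X | H.Adj p.1 p.2} ∧ c (repOf H w y) = j}) (fun y hy => hy.1)
      (hH.and hlab).setOf
    have he : {p : X × X | (removeLabel H hwe.injective c j).Adj p.1 p.2} =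
        {p | H.Adj p.1 p.2} \ {y | y ∈ {p | H.Adj p.1 p.2} ∧ c (repOf H w y) = j} := by
      ext q
      simp only [removeLabel, mem_sdiff, mem_ofPred_eq]
      tauto
    rw [he, hd]
    norm_num at hj ⊢
    linarith
  · intro x y hxy
    obtain ⟨e, he, hn⟩ := hB.node x y hxy
    obtain ⟨i, -, hi⟩ := exists_kept_of_node (j := j) hlf hB hac hwe.injective hpa hpi hc hn x
    exact ⟨e.2, hxy.reachable.trans he.reachable, _, hi⟩

end Sparser

section Iterate

open Relation Set

variable {X : Type*} [MeasurableSpace X] [StandardBorelSpace X] {G : SimpleGraph X}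

theorem exists_saturating_measure [Nonempty X] (hG : Measurable fun p : X × X => G.Adj p.1 p.2)
    (hlf : ∀ x, (G.neighborSet x).Finite) (μ : Measure X) [IsProbabilityMeasure μ] :
    ∃ ν : Measure (X × X), IsFiniteMeasure ν ∧ ∀ E : Set (X × X), MeasurableSet E → ν E = 0 →
      μ {x | ∃ a, G.Reachable x a ∧ ∃ b, G.Adj a b ∧ (a, b) ∈ E} = 0 := by
  obtain ⟨φ, hφ, hφR⟩ := exists_enum_reachable hG hlf
  obtain ⟨g, hg, hgR⟩ := exists_enum hG hlf
  obtain ⟨ε, hε, hεs⟩ := ENNReal.exists_pos_sum_of_countable (ε := 1) one_ne_zero (ℕ × ℕ)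
  let ψ : ℕ × ℕ → X → X × X := fun k x => (φ k.1 x, g k.2 (φ k.1 x))
  have hψ : ∀ k, Measurable (ψ k) := fun k =>
    (hφ k.1).prodMk ((hg k.2).comp (hφ k.1))
  refine ⟨Measure.sum fun k => (ε k : ENNReal) • μ.map (ψ k), ⟨?_⟩, ?_⟩
  · rw [Measure.sum_apply _ MeasurableSet.univ]
    have : ∀ k, ((ε k : ENNReal) • μ.map (ψ k)) univ = ε k := fun k => by
      rw [Measure.smul_apply, Measure.map_apply (hψ k) MeasurableSet.univ]
      simp
    simp only [this]
    exact hεs.trans ENNReal.one_lt_top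
  · intro E hE h0
    rw [Measure.sum_apply _ hE, ENNReal.tsum_eq_zero] at h0
    refine measure_mono_null (t := ⋃ k, ψ k ⁻¹' E) ?_ (measure_iUnion_null fun k => ?_)
    · rintro x ⟨a, hxa, b, hab, he⟩
      obtain ⟨n, rfl⟩ := (hφR x a).1 hxa
      obtain ⟨m, rfl⟩ := hgR _ b hab
      exact mem_iUnion.2 ⟨(n, m), he⟩
    · have := h0 k
      rw [Measure.smul_apply, Measure.map_apply (hψ k) hE, smul_eq_mul, mul_eq_zero] at this
      rcases this with h | h
      · exact absurd h (by simpa using (hε k).ne')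
      · exact h

theorem exists_sparser_seq [Nonempty X] {H : SimpleGraph X}
    (hH : Measurable fun p : X × X => H.Adj p.1 p.2)
    (hlf : ∀ x, (H.neighborSet x).Finite) (hac : H.IsAcyclic) (hB : Branching H)
    (ν : Measure (X × X)) [IsFiniteMeasure ν] :
    ∃ K : ℕ → SimpleGraph X, K 0 = H ∧ (∀ n, Measurable fun p : X × X => (K n).Adj p.1 p.2) ∧
      Antitone K ∧ ν {p | ∀ n, (K n).Adj p.1 p.2} = 0 ∧
      ∀ n x y, (K n).Adj x y → ∃ a, (K n).Reachable x a ∧ ∃ b, (K (n + 1)).Adj a b := by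
  let P : SimpleGraph X → Prop := fun K =>
    (Measurable fun p : X × X => K.Adj p.1 p.2) ∧ K ≤ H ∧ Branching K
  have hstep : ∀ K : {K // P K}, ∃ K' : {K // P K}, K'.1 ≤ K.1 ∧
      ν.real {p | K'.1.Adj p.1 p.2} ≤ 24 / 25 * ν.real {p | K.1.Adj p.1 p.2} ∧
      ∀ x y, K.1.Adj x y → ∃ a, K.1.Reachable x a ∧ ∃ b, K'.1.Adj a b := by
    rintro ⟨K, hK, hKH, hKB⟩
    obtain ⟨K', h1, h2, h3, h4, h5⟩ := exists_sparser hK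
      (fun x => (hlf x).subset fun y hy => hKH hy) (hac.anti hKH) hKB ν
    exact ⟨⟨K', h1, h2.trans hKH, h3⟩, h2, h4, h5⟩
  choose s hs1 hs2 hs3 using hstep
  let K : ℕ → {K // P K} := fun n => Nat.rec ⟨H, hH, le_rfl, hB⟩ (fun _ K => s K) n
  have hK : ∀ n, K (n + 1) = s (K n) := fun n => rfl
  refine ⟨fun n => (K n).1, rfl, fun n => (K n).2.1, antitone_nat_of_succ_le fun n => hs1 (K n), ?_,
    fun n => hs3 (K n)⟩
  have h1 : ∀ n, ν.real {p | (K n).1.Adj p.1 p.2} ≤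
      (24 / 25) ^ n * ν.real {p | H.Adj p.1 p.2} := by
    intro n
    induction n with
    | zero => simp [K]
    | succ n ih =>
      rw [hK, pow_succ']
      refine (hs2 (K n)).trans ?_
      rw [mul_assoc]
      gcongr
  have h2 : ν.real {p | ∀ n, (K n).1.Adj p.1 p.2} ≤ 0 := by
    have ht : Filter.Tendsto (fun n => ((24 : ℝ) / 25) ^ n * ν.real {p | H.Adj p.1 p.2})
        Filter.atTop (nhds (0 * _)) :=
      (tendsto_pow_atTop_nhds_zero_of_lt_one (by norm_num) (by norm_num)).mul_const _
    rw [zero_mul] at ht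
    exact ge_of_tendsto' ht fun n =>
      (measureReal_mono (s₂ := {p | (K n).1.Adj p.1 p.2}) (by
        intro p hp
        exact hp n)
        (measure_ne_top _ _)).trans (h1 n)
  exact (measureReal_eq_zero_iff (measure_ne_top _ _)).1 (le_antisymm h2 measureReal_nonneg)

theorem exists_noBack_of_branching [Nonempty X] (hG : Measurable fun p : X × X => G.Adj p.1 p.2)
    (hGlf : ∀ x, (G.neighborSet x).Finite) {H : SimpleGraph X} (hHG : H ≤ G)
    (hH : Measurable fun p : X × X => H.Adj p.1 p.2) (hac : H.IsAcyclic) (hB : Branching H)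
    (μ : Measure X) [IsProbabilityMeasure μ] :
    ∃ Z : Set X, (Measurable fun x => x ∈ Z) ∧ μ Z = 0 ∧
      (∀ x y, G.Reachable x y → x ∈ Z → y ∈ Z) ∧ ∃ f : X → X, Measurable f ∧
        NoBack {x | (∃ y, H.Adj x y) ∧ x ∉ Z} f ∧
        ∀ x, (∃ y, H.Adj x y) → x ∉ Z → H.Adj x (f x) := by
  obtain ⟨ν, hν, hνμ⟩ := exists_saturating_measure hG hGlf μ
  obtain ⟨K, rfl, hK, hanti, hK0, hnext⟩ := exists_sparser_seq hH
    (fun x => (hGlf x).subset fun y hy => hHG hy) hac hB ν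
  have hlf : ∀ n x, ((K n).neighborSet x).Finite := fun n x =>
    (hGlf x).subset fun y hy => hHG (hanti n.zero_le hy)
  have hI : Measurable fun p : X × X => ∀ n, (K n).Adj p.1 p.2 := by fun_prop
  let Z : Set X := {x | ∃ a, G.Reachable x a ∧ ∃ b, ∀ n, (K n).Adj a b}
  have hZ : Measurable fun x => x ∈ Z :=
    measurable_exists_reachable hG hGlf (measurable_exists hI fun x =>
      (hlf 0 x).subset fun y hy => hy 0)
  let A : ℕ → Set X := fun n => {x | ∃ y, (K n).Adj x y}
  have hA : ∀ n, Measurable fun x => x ∈ A n := fun n => measurable_exists (hK n) (hlf n)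
  have hAanti : ∀ {m n}, m ≤ n → A n ⊆ A m := fun h x ⟨y, hy⟩ => ⟨y, hanti h hy⟩
  let D : ℕ → Set X := fun n => {x | x ∈ A n ∧ x ∉ A (n + 1) ∧ x ∉ Z}
  have hD : ∀ n, Measurable fun x => x ∈ D n := fun n => by
    have h1 := hA n
    have h2 := hA (n + 1)
    exact h1.and (h2.not.and hZ.not)
  choose f hf hfnb hfadj using fun n => exists_extension (K n) (hK n) (hlf n) (hA (n + 1))
  have hDsub : ∀ n, ∀ x ∈ D n, x ∉ A (n + 1) ∧ ∃ a, (K n).Reachable x a ∧ a ∈ A (n + 1) := by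
    rintro n x ⟨⟨y, hy⟩, h2, -⟩
    exact ⟨h2, hnext n x y hy⟩
  have hle : ∀ n x m, x ∈ A n → x ∈ D m → n ≤ m := by
    intro n x m hn hm
    by_contra hlt
    exact hm.2.1 (hAanti (Nat.lt_of_not_le hlt) hn)
  obtain ⟨F, hF, hFnb, hFeq⟩ := exists_glue hD
    (fun x m n hm hn => le_antisymm (hle _ _ _ hm.1 hn) (hle _ _ _ hn.1 hm)) hf
    (fun n => (hfnb n).mono (hDsub n))
    (fun n x m hx hm => hle n _ m
      ⟨x, (hfadj n x (hDsub n x hx).1 (hDsub n x hx).2).symm⟩ hm)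
  have hex : ∀ x, (∃ y, (K 0).Adj x y) → x ∉ Z → ∃ n, x ∈ D n := by
    intro x hx hxZ
    by_contra hcon
    push Not at hcon
    have hall : ∀ n, x ∈ A n := by
      intro n
      induction n with
      | zero => exact hx
      | succ n ih => exact by_contra fun h => hcon n ⟨ih, h, hxZ⟩
    have hno : ∀ y, ∃ n, ¬ (K n).Adj x y := by
      intro y
      by_contra h
      push Not at h
      exact hxZ ⟨x, SimpleGraph.Reachable.refl x, y, h⟩
    choose N hN using hno
    obtain ⟨M, hM⟩ := ((hlf 0 x).image N).bddAbove
    obtain ⟨y, hy⟩ := hall M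
    exact hN y (hanti (hM ⟨y, hanti M.zero_le hy, rfl⟩) hy)
  refine ⟨Z, hZ, ?_, ?_, F, hF, hFnb.mono ?_, ?_⟩
  · refine measure_mono_null ?_ (hνμ _ hI.setOf hK0)
    rintro x ⟨a, hxa, b, hb⟩
    exact ⟨a, hxa, b, hHG (hb 0), hb⟩
  · rintro x y hxy ⟨a, hxa, h⟩
    exact ⟨a, hxy.symm.trans hxa, h⟩
  · rintro x ⟨hx, hxZ⟩
    exact hex x hx hxZ
  · intro x hx hxZ
    obtain ⟨n, hn⟩ := hex x hx hxZ
    rw [hFeq n x hn]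
    exact hanti n.zero_le (hfadj n x (hDsub n x hn).1 (hDsub n x hn).2)

theorem exists_noBack_of_forest [Nonempty X] (hG : Measurable fun p : X × X => G.Adj p.1 p.2)
    (hGlf : ∀ x, (G.neighborSet x).Finite) {T : SimpleGraph X} (hTG : T ≤ G)
    (hT : Measurable fun p : X × X => T.Adj p.1 p.2) (hac : T.IsAcyclic)
    (hno : ∀ x y, StraightDart (coreGraph T) (x, y) → ¬ StraightDart (coreGraph T) (y, x))
    (μ : Measure X) [IsProbabilityMeasure μ] :
    ∃ Z : Set X, (Measurable fun x => x ∈ Z) ∧ μ Z = 0 ∧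
      (∀ x y, G.Reachable x y → x ∈ Z → y ∈ Z) ∧ ∃ f : X → X, Measurable f ∧
        NoBack {x | (∃ y, InfDart T (x, y)) ∧ x ∉ Z} f ∧
        ∀ x, (∃ y, InfDart T (x, y)) → x ∉ Z → T.Adj x (f x) := by
  have hlf : ∀ x, (T.neighborSet x).Finite := fun x => (hGlf x).subset fun y hy => hTG hy
  obtain ⟨H, hH, hHT, hB, D, g, hD, hg, hgnb, hgadj, hDH, hcov⟩ := exists_branching_core hT hlf hno
  obtain ⟨Z, hZ, hZ0, hZinv, f, hf, hfnb, hfadj⟩ :=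
    exists_noBack_of_branching hG hGlf (hHT.trans hTG) hH (hac.anti hHT) hB μ
  have hS : Measurable fun x => ∃ y, H.Adj x y :=
    measurable_exists hH fun x => (hlf x).subset fun y hy => hHT hy
  obtain ⟨F, hF, hFnb, hF1, hF2⟩ := exists_glue_two hD
    (E := {x | (∃ y, H.Adj x y) ∧ x ∉ Z}) (hS.and hZ.not) (fun x hx hx' => hDH x hx hx'.1) hg hf
    hgnb hfnb (fun x hx hx' => hDH _ hx' ⟨x, (hfadj x hx.1 hx.2).symm⟩)
  refine ⟨Z, hZ, hZ0, hZinv, F, hF, hFnb.mono ?_, ?_⟩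
  · rintro x ⟨hx, hxZ⟩
    exact (hcov x hx).imp id fun h => ⟨h, hxZ⟩
  · intro x hx hxZ
    rcases hcov x hx with h | h
    · rw [hF1 x h]
      exact hgadj x h
    · rw [hF2 x ⟨h, hxZ⟩]
      exact hHT (hfadj x h hxZ)

end Iterate

section RayEnds

open Relation Set CategoryTheory

variable {V : Type*} {G : SimpleGraph V}

theorem exists_tail_component {a : ℕ → V} (ha : Function.Injective a)
    (hadj : ∀ i, G.Adj (a i) (a (i + 1))) (K : Finset V) :
    ∃ C : G.ComponentCompl (K : Set V), ∃ N, ∀ i, N ≤ i → a i ∈ C := by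
  have hfin : {i | a i ∈ K}.Finite := K.finite_toSet.preimage ha.injOn
  obtain ⟨M, hM⟩ := hfin.bddAbove
  have hN : ∀ i, M + 1 ≤ i → a i ∉ (K : Set V) := fun i hi h => by
    have : i ≤ M := hM h
    omega
  refine ⟨G.componentComplMk (hN _ le_rfl), M + 1, fun i hi => ?_⟩
  induction i, hi using Nat.le_induction with
  | base => exact G.componentComplMk_mem _
  | succ i hi ih =>
    exact SimpleGraph.ComponentCompl.mem_of_adj (a i) _ ih (hN _ (by omega)) (hadj i)

/-- The component outside `K` containing a tail of the ray `a`. -/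
noncomputable def rayComp {a : ℕ → V} (ha : Function.Injective a)
    (hadj : ∀ i, G.Adj (a i) (a (i + 1))) (K : Finset V) : G.ComponentCompl (K : Set V) :=
  (exists_tail_component ha hadj K).choose

variable {a b : ℕ → V} (ha : Function.Injective a) (hadj : ∀ i, G.Adj (a i) (a (i + 1)))
  (hb : Function.Injective b) (hbdj : ∀ i, G.Adj (b i) (b (i + 1)))

theorem rayComp_tail (K : Finset V) : ∃ N, ∀ i, N ≤ i → a i ∈ rayComp ha hadj K :=
  (exists_tail_component ha hadj K).choose_spec

theorem component_eq_of_mem {K : Set V} {C D : G.ComponentCompl K} {v : V} (hC : v ∈ C)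
    (hD : v ∈ D) : C = D := by
  obtain ⟨_, rfl⟩ := hC
  obtain ⟨_, rfl⟩ := hD
  rfl

theorem eq_rayComp {K : Finset V} {C : G.ComponentCompl (K : Set V)}
    (hC : ∃ N, ∀ i, N ≤ i → a i ∈ C) : C = rayComp ha hadj K := by
  obtain ⟨N, hN⟩ := hC
  obtain ⟨M, hM⟩ := rayComp_tail ha hadj K
  exact component_eq_of_mem (hN _ (le_max_left N M)) (hM _ (le_max_right N M))

theorem rayComp_hom {K L : Finset V} (h : (K : Set V) ⊆ L) :
    (rayComp ha hadj L).hom h = rayComp ha hadj K := by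
  obtain ⟨N, hN⟩ := rayComp_tail ha hadj L
  exact eq_rayComp ha hadj ⟨N, fun i hi => SimpleGraph.ComponentCompl.subset_hom _ h (hN i hi)⟩

theorem rayComp_mem_end :
    (fun K : (Finset V)ᵒᵖ => (rayComp ha hadj K.unop : G.componentComplFunctor.obj K)) ∈ G.end := by
  intro K L f
  exact rayComp_hom ha hadj (le_of_op_hom f)

/-- Two rays which are separated by a finite set, such that every infinite component outside a
finite set contains a tail of one of them, represent exactly two ends. -/
theorem ncard_end_eq_two
    (htail : ∀ (K : Finset V) (C : G.ComponentCompl (K : Set V)), C.supp.Infinite →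
      (∃ N, ∀ i, N ≤ i → a i ∈ C) ∨ ∃ N, ∀ i, N ≤ i → b i ∈ C)
    (K₀ : Finset V) (hK₀ : rayComp ha hadj K₀ ≠ rayComp hb hbdj K₀) : G.end.ncard = 2 := by
  classical
  rw [ncard_eq_two]
  refine ⟨fun K : (Finset V)ᵒᵖ => (rayComp ha hadj K.unop : G.componentComplFunctor.obj K),
    fun K : (Finset V)ᵒᵖ => (rayComp hb hbdj K.unop : G.componentComplFunctor.obj K), ?_, ?_⟩
  · intro h
    exact hK₀ (congrFun h (Opposite.op K₀))
  · refine Set.ext fun s => ⟨fun hs => ?_, ?_⟩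
    · change s = _ ∨ s = _
      have hcase : ∀ K : Finset V, s (Opposite.op K) = rayComp ha hadj K ∨
          s (Opposite.op K) = rayComp hb hbdj K := by
        intro K
        have hinf : SimpleGraph.ComponentCompl.supp (K := (K : Set V)) (s (Opposite.op K)) |>.Infinite :=
          (SimpleGraph.ComponentCompl.infinite_iff_in_all_ranges _).2 fun L h =>
            ⟨s (Opposite.op L), hs (opHomOfLE h : Opposite.op L ⟶ Opposite.op K)⟩
        rcases htail K _ hinf with h | h
        · exact Or.inl (eq_rayComp ha hadj h)
        · exact Or.inr (eq_rayComp hb hbdj h)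
      have hhom : ∀ {K L : Finset V} (h : K ≤ L),
          SimpleGraph.ComponentCompl.hom h (s (Opposite.op L)) = s (Opposite.op K) := fun h =>
        hs (opHomOfLE h : Opposite.op _ ⟶ Opposite.op _)
      have key : ∀ {c d : ℕ → V} (hc : Function.Injective c) (hcdj : ∀ i, G.Adj (c i) (c (i + 1)))
          (hd : Function.Injective d) (hddj : ∀ i, G.Adj (d i) (d (i + 1))),
          rayComp hc hcdj K₀ ≠ rayComp hd hddj K₀ → s (Opposite.op K₀) = rayComp hc hcdj K₀ →
          (∀ K : Finset V, s (Opposite.op K) = rayComp hc hcdj K ∨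
            s (Opposite.op K) = rayComp hd hddj K) →
          ∀ K : Finset V, s (Opposite.op K) = rayComp hc hcdj K := by
        intro c d hc hcdj hd hddj hne h0 hcd K
        have h1 : s (Opposite.op (K ∪ K₀)) = rayComp hc hcdj (K ∪ K₀) := by
          refine (hcd (K ∪ K₀)).resolve_right fun h => hne ?_
          have := hhom (Finset.subset_union_right : K₀ ≤ K ∪ K₀)
          rw [h, h0] at this
          rw [← this]
          exact rayComp_hom hd hddj (Finset.coe_subset.2 Finset.subset_union_right)
        have := hhom (Finset.subset_union_left : K ≤ K ∪ K₀)
        rw [h1] at this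
        rw [← this]
        exact rayComp_hom hc hcdj (Finset.coe_subset.2 Finset.subset_union_left)
      rcases hcase K₀ with h0 | h0
      · exact Or.inl (funext fun K => key ha hadj hb hbdj hK₀ h0 hcase K.unop)
      · exact Or.inr (funext fun K =>
          key hb hbdj ha hadj hK₀.symm h0 (fun K => (hcase K).symm) K.unop)
    · rintro (rfl | rfl)
      · exact rayComp_mem_end ha hadj
      · exact rayComp_mem_end hb hbdj

end RayEnds

section TwoRays

open Relation Set

variable {V : Type*} {T G : SimpleGraph V}

/-- A nonbacktracking infinite walk. -/
def NBSeq (T : SimpleGraph V) (u : ℕ → V) : Prop :=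
  (∀ i, T.Adj (u i) (u (i + 1))) ∧ ∀ i, u (i + 2) ≠ u i

theorem NBSeq.step {u : ℕ → V} (hu : NBSeq T u) (i : ℕ) :
    DartStep T (u i, u (i + 1)) (u (i + 1), u (i + 2)) :=
  ⟨rfl, hu.1 (i + 1), hu.2 i⟩

theorem NBSeq.dartReach {u : ℕ → V} (hu : NBSeq T u) {i j : ℕ} (h : i ≤ j) :
    DartReach T (u i, u (i + 1)) (u j, u (j + 1)) := by
  induction j, h using Nat.le_induction with
  | base => exact ReflTransGen.refl
  | succ j _ ih => exact ih.tail (hu.step j)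

theorem NBSeq.injective (hac : T.IsAcyclic) {u : ℕ → V} (hu : NBSeq T u) :
    Function.Injective u := by
  have hne : ∀ i j, i < j → u i ≠ u j := by
    intro i j hij
    obtain ⟨j, rfl⟩ : ∃ k, j = k + 1 := ⟨j - 1, by omega⟩
    exact (hu.dartReach (Nat.le_of_lt_succ hij)).ne hac (hu.1 i)
  intro i j hij
  rcases lt_trichotomy i j with h | h | h
  · exact absurd hij (hne _ _ h)
  · exact h
  · exact absurd hij.symm (hne _ _ h)

theorem NBSeq.eventually_not_beyond (hac : T.IsAcyclic) {u : ℕ → V} (hu : NBSeq T u) (k : V) :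
    ∃ N, ∀ i, N ≤ i → ∀ w, ¬ DartReach T (u i, u (i + 1)) (w, k) := by
  by_contra hcon
  push Not at hcon
  have hall : ∀ i, ∃ p : T.Walk (u i) k, p.IsPath ∧ p.snd = u (i + 1) := by
    intro i
    obtain ⟨j, hij, w, hw⟩ := hcon i
    exact DartReach.exists_path hac ((hu.dartReach hij).trans hw) (hu.1 i)
  choose p hp hps using hall
  have hlen : ∀ i, (p (i + 1)).length + 1 = (p i).length := by
    intro i
    have hnil : ¬ (p i).Nil := by
      intro h
      have h1 := hps i
      have h2 : (p i).snd = u i := by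
        have := h.eq
        rw [SimpleGraph.Walk.snd, SimpleGraph.Walk.getVert_of_length_le _
          (by rw [SimpleGraph.Walk.length_eq_zero_iff.2 h]; omega)]
        exact this.symm
      exact (hu.1 i).ne (h2.symm.trans h1)
    have h1 : (p i).tail.copy (hps i) rfl = p (i + 1) := by
      have := (hac.subsingleton_path (u (i + 1)) k).elim
        ⟨(p i).tail.copy (hps i) rfl, by simpa using (hp i).tail⟩ ⟨p (i + 1), hp (i + 1)⟩
      simpa using this
    rw [← h1, SimpleGraph.Walk.length_copy]
    exact SimpleGraph.Walk.length_tail_add_one hnil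
  have : ∀ i, (p i).length + i = (p 0).length := by
    intro i
    induction i with
    | zero => rfl
    | succ i ih =>
      have := hlen i
      omega
  have := this ((p 0).length + 1)
  omega

theorem exists_nbSeq_of_infinite (hlf : ∀ x, (T.neighborSet x).Finite)
    (hconn : ∀ u v, T.Reachable u v) (x : V) {D : Set V} (hD : D.Infinite) :
    ∃ u, NBSeq T u ∧ u 0 = x ∧ ∀ i, ∃ v ∈ D, ∃ w, DartReach T (u i, u (i + 1)) (w, v) := by
  have hstart : ∃ y, T.Adj x y ∧ {v | v ∈ D ∧ ∃ w, DartReach T (x, y) (w, v)}.Infinite := by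
    by_contra hcon
    push Not at hcon
    refine hD (((finite_singleton x).union ((hlf x).biUnion
      (t := fun y => {v | v ∈ D ∧ ∃ w, DartReach T (x, y) (w, v)}) fun y hy =>
        hcon y hy)).subset ?_)
    intro v hv
    rcases exists_dartReach_of_reachable (hconn x v) with h | ⟨y, u, hy, hu⟩
    · exact Or.inl h
    · exact Or.inr (mem_biUnion (x := y) hy ⟨hv, u, hu⟩)
  obtain ⟨y, hxy, hy⟩ := hstart
  obtain ⟨s, hs0, hs⟩ := exists_seq_of_next (P := DartStep T)
    (Q := fun d => {v | v ∈ D ∧ ∃ w, DartReach T d (w, v)}.Infinite) (fun d hd => by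
      by_contra hcon
      push Not at hcon
      refine hd (((finite_singleton d.2).union ((dartStep_finite hlf d).biUnion
        (t := fun e => {v | v ∈ D ∧ ∃ w, DartReach T e (w, v)}) fun e he => hcon e he)).subset ?_)
      rintro v ⟨hv, w, hw⟩
      rcases ReflTransGen.cases_head hw with h | ⟨e, he, hew⟩
      · exact Or.inl (by rw [h]; rfl)
      · exact Or.inr (mem_biUnion (x := e) he ⟨hv, w, hew⟩)) (x := (x, y)) hy
  have hsnd : ∀ i, s i = ((s i).1, (s (i + 1)).1) := fun i => by rw [(hs i).2.1]
  have hadj : ∀ i, T.Adj (s i).1 (s (i + 1)).1 := by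
    intro i
    cases i with
    | zero => rw [(hs 0).2.1, hs0]; exact hxy
    | succ i => rw [(hs (i + 1)).2.1, (hs i).2.1]; exact (hs i).2.2.1
  refine ⟨fun i => (s i).1, ⟨hadj, fun i => ?_⟩, congrArg Prod.fst hs0, fun i => ?_⟩
  · change (s (i + 1 + 1)).1 ≠ _
    rw [(hs (i + 1)).2.1]
    exact (hs i).2.2.2
  · obtain ⟨v, hv, w, hw⟩ := (hs i).1.nonempty
    refine ⟨v, hv, w, ?_⟩
    change DartReach T ((s i).1, (s (i + 1)).1) _
    rwa [← hsnd i]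

end TwoRays

section TwoEnds

open Relation Set

variable {V : Type*} {T G : SimpleGraph V}

/-- The edges of `T` other than `s(x, y)` together with the edges of `G` outside `K`. -/
def sepGraph (T G : SimpleGraph V) (K : Set V) (x y : V) : SimpleGraph V where
  Adj u v := (T.Adj u v ∧ s(u, v) ≠ s(x, y)) ∨ (G.Adj u v ∧ u ∉ K ∧ v ∉ K)
  symm := ⟨fun u v h => h.imp (fun h => ⟨h.1.symm, by rw [Sym2.eq_swap]; exact h.2⟩)
    fun h => ⟨h.1.symm, h.2.2, h.2.1⟩⟩
  loopless := ⟨fun u h => h.elim (fun h => h.1.ne rfl) fun h => h.1.ne rfl⟩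

theorem not_reachable_sepGraph (hTG : T ≤ G) (hac : T.IsAcyclic) {K : Set V} {x y : V}
    (hxy : T.Adj x y) (hK : ∀ S, BiconnSet G S → x ∈ S → y ∈ S → S ⊆ K) :
    ¬ (sepGraph T G K x y).Reachable x y := by
  intro h
  obtain ⟨p, hp⟩ := h.exists_isPath
  have hG : ∀ u v, (sepGraph T G K x y).Adj u v → G.Adj u v := fun u v h =>
    h.elim (fun h => hTG h.1) fun h => h.1
  have hsub : {z | ∃ i ≤ p.length, z = p.getVert i} ⊆ K := by
    refine hK _ (BiconnSet.of_cycle (fun i j hi hj hij => hp.getVert_injOn hi hj hij)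
      (fun i hi => hG _ _ (p.adj_getVert_succ hi)) ?_) ⟨0, Nat.zero_le _, by simp⟩
      ⟨p.length, le_rfl, by simp⟩
    simpa using hTG hxy
  have hedge : ∀ e ∈ p.edges, e ∈ T.edgeSet ∧ e ≠ s(x, y) := by
    intro e
    induction e with
    | _ c d =>
      intro he
      rcases p.adj_of_mem_edges he with h | h
      · exact h
      · obtain ⟨i, hi, hil⟩ := SimpleGraph.Walk.mem_support_iff_exists_getVert.1
          (p.fst_mem_support_of_mem_edges he)
        exact absurd (hsub ⟨i, hil, hi.symm⟩) h.2.1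
  have hq := hp.transfer fun e he => (hedge e he).1
  have := (hac.subsingleton_path x y).elim
    ⟨_, hq⟩ ⟨hxy.toWalk, by simp [hxy.ne]⟩
  simp only [Subtype.mk.injEq] at this
  have h2 := congrArg SimpleGraph.Walk.edges this
  rw [SimpleGraph.Walk.edges_transfer] at h2
  exact (hedge s(x, y) (by rw [h2]; simp)).2 rfl

theorem DartReach.mem_component (hTG : T ≤ G) {K : Set V} {C : G.ComponentCompl K} {d e : V × V}
    (h : DartReach T d e) (hK : ∀ f, DartReach T d f → f.2 ∉ K) (he : e.2 ∈ C) : d.2 ∈ C := by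
  induction h using ReflTransGen.head_induction_on with
  | refl => exact he
  | @head a c hac hce ih =>
    refine SimpleGraph.ComponentCompl.mem_of_adj c.2 a.2
      (ih fun f hf => hK f (ReflTransGen.head hac hf)) (hK a ReflTransGen.refl) ?_
    exact (hTG hac.2.1).symm

theorem sepGraph_reachable_tail {K : Set V} {a : ℕ → V} (ha : ∀ i, T.Adj (a i) (a (i + 1)))
    {x y : V} {m : ℕ} (hne : ∀ i, m ≤ i → s(a i, a (i + 1)) ≠ s(x, y)) {i : ℕ} (hi : m ≤ i) :
    (sepGraph T G K x y).Reachable (a m) (a i) := by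
  induction i, hi using Nat.le_induction with
  | base => rfl
  | succ i hi ih =>
    have h : (sepGraph T G K x y).Adj (a i) (a (i + 1)) := Or.inl ⟨ha i, hne i hi⟩
    exact ih.trans h.reachable

theorem ncard_end_eq_two_of_forest (hlf : ∀ x, (T.neighborSet x).Finite) (hTG : T ≤ G)
    (hac : T.IsAcyclic) (hconn : ∀ u v, T.Reachable u v) {a b : ℕ → V} (ha : NBSeq T a)
    (hb : NBSeq T b) (h0 : a 0 = b 0) (h1 : a 1 ≠ b 1)
    (huniq : ∀ u, NBSeq T u → u 0 = a 0 → u = a ∨ u = b) (K₀ : Finset V)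
    (hK₀ : ∀ S, BiconnSet G S → a 0 ∈ S → b 1 ∈ S → S ⊆ K₀) : G.end.ncard = 2 := by
  have hai := ha.injective hac
  have hbi := hb.injective hac
  refine ncard_end_eq_two hai (fun i => hTG (ha.1 i)) hbi (fun i => hTG (hb.1 i)) ?_ K₀ ?_
  · intro K C hC
    obtain ⟨u, hu, hu0, hbey⟩ := exists_nbSeq_of_infinite hlf hconn (a 0) hC
    have hmain : ∃ N, ∀ i, N ≤ i → u i ∈ C := by
      choose N hN using fun k => hu.eventually_not_beyond hac k
      refine ⟨K.sup N + 1, fun i hi => ?_⟩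
      obtain ⟨j, rfl⟩ : ∃ j, i = j + 1 := ⟨i - 1, by omega⟩
      obtain ⟨v, hv, w, hw⟩ := hbey j
      refine DartReach.mem_component hTG hw (fun f hf hfK => ?_) hv
      have := Finset.le_sup (f := N) hfK
      exact hN f.2 j (by omega) f.1 hf
    rcases huniq u hu hu0 with rfl | rfl
    · exact Or.inl hmain
    · exact Or.inr hmain
  · intro heq
    have hbadj : T.Adj (a 0) (b 1) := h0 ▸ hb.1 0
    refine not_reachable_sepGraph hTG hac hbadj hK₀ ?_
    obtain ⟨N, hN⟩ := rayComp_tail hai (fun i => hTG (ha.1 i)) K₀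
    obtain ⟨M, hM⟩ := rayComp_tail hbi (fun i => hTG (hb.1 i)) K₀
    have hra : (sepGraph T G K₀ (a 0) (b 1)).Reachable (a 0) (a N) := by
      refine sepGraph_reachable_tail ha.1 (fun i _ h => ?_) (Nat.zero_le N)
      rcases Sym2.eq_iff.1 h with ⟨h, h'⟩ | ⟨h, h'⟩
      · have := hai h
        subst this
        exact h1 h'
      · exact absurd (hai h') (by omega)
    have hrb : (sepGraph T G K₀ (a 0) (b 1)).Reachable (b 1) (b (M + 1)) := by
      refine sepGraph_reachable_tail hb.1 (fun i hi h => ?_) (Nat.le_add_left 1 M)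
      rw [h0] at h
      rcases Sym2.eq_iff.1 h with ⟨h, h'⟩ | ⟨h, h'⟩
      · exact absurd (hbi h) (by omega)
      · exact absurd (hbi h') (by omega)
    obtain ⟨hn, hn'⟩ := hN N le_rfl
    obtain ⟨hm, hm'⟩ := hM (M + 1) (by omega)
    rw [← heq, ← hn'] at hm'
    have hreach := (SimpleGraph.ConnectedComponent.exact hm').symm
    have hmid : (sepGraph T G K₀ (a 0) (b 1)).Reachable (a N) (b (M + 1)) :=
      hreach.map (G' := sepGraph T G K₀ (a 0) (b 1))
        (⟨Subtype.val, fun {c d} h => Or.inr ⟨h, c.2, d.2⟩⟩ : G.induce (K₀ : Set V)ᶜ →g _)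
    exact (hra.trans hmid).trans hrb.symm

end TwoEnds

section StraightLine

open Relation Set

variable {V : Type*} {T G : SimpleGraph V}

theorem exists_nbSeq_of_leafless {C : SimpleGraph V}
    (hC : ∀ x y, C.Adj x y → ∃ z, z ≠ x ∧ C.Adj y z) {x y : V} (hxy : C.Adj x y) :
    ∃ u, NBSeq C u ∧ u 0 = x ∧ u 1 = y := by
  obtain ⟨s, hs0, hs⟩ := exists_seq_of_next (P := DartStep C) (Q := fun d => C.Adj d.1 d.2)
    (fun d hd => by
      obtain ⟨z, hz, hdz⟩ := hC _ _ hd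
      exact ⟨(d.2, z), ⟨rfl, hdz, hz⟩, hdz⟩) (x := (x, y)) hxy
  have h2 : ∀ i, (s (i + 1)).1 = (s i).2 := fun i => (hs i).2.1
  refine ⟨fun i => (s i).1, ⟨fun i => ?_, fun i => ?_⟩, congrArg Prod.fst hs0, ?_⟩
  · change C.Adj (s i).1 (s (i + 1)).1
    rw [h2]
    exact (hs i).1
  · change (s (i + 1 + 1)).1 ≠ (s i).1
    rw [h2]
    exact (hs i).2.2.2
  · exact (h2 0).trans (congrArg Prod.snd hs0)

theorem NBSeq.infDart {u : ℕ → V} (hu : NBSeq T u) (i : ℕ) : InfDart T (u i, u (i + 1)) := by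
  refine ⟨hu.1 i, fun n => ?_⟩
  exact chainLen_of_seq n (fun j => (u (i + j), u (i + j + 1))) fun j => hu.step (i + j)

theorem NBSeq.mono {C : SimpleGraph V} (hCT : C ≤ T) {u : ℕ → V} (hu : NBSeq C u) : NBSeq T u :=
  ⟨fun i => hCT (hu.1 i), hu.2⟩

/-- A nonbacktracking walk starting at a vertex with two core neighbors stays in the core. -/
theorem NBSeq.coreGraph {u : ℕ → V} (hu : NBSeq T u) {y z : V} (hyz : y ≠ z)
    (hy : (coreGraph T).Adj (u 0) y) (hz : (coreGraph T).Adj (u 0) z) : NBSeq (coreGraph T) u := by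
  refine ⟨fun i => ⟨hu.infDart i, ?_⟩, hu.2⟩
  induction i with
  | zero =>
    by_cases h : u 1 = y
    · exact InfDart.prev (hu.1 0).symm (by rw [zero_add, h]; exact hyz.symm) hz.1
    · exact InfDart.prev (hu.1 0).symm (Ne.symm h) hy.1
  | succ i ih => exact InfDart.prev (hu.1 (i + 1)).symm (hu.2 i).symm ih

theorem NBSeq.eq_of_not_isNode {C : SimpleGraph V} (hlf : ∀ x, (C.neighborSet x).Finite)
    {u v : ℕ → V} (hu : NBSeq C u) (hv : NBSeq C v) (h0 : u 0 = v 0) (h1 : u 1 = v 1)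
    (hno : ∀ i, ¬ IsNode C (v (i + 1))) : u = v := by
  have key : ∀ i, u i = v i ∧ u (i + 1) = v (i + 1) := by
    intro i
    induction i with
    | zero => exact ⟨h0, h1⟩
    | succ i ih =>
      refine ⟨ih.2, _root_.eq_of_not_isNode hlf (hno i) (hv.1 i).symm ?_ (hv.1 (i + 1)) ?_ ?_⟩
      · rw [← ih.2]
        exact hu.1 (i + 1)
      · rw [← ih.1]
        exact (hu.2 i).symm
      · exact (hv.2 i).symm
  exact funext fun i => (key i).1

theorem BiconnSet.image_val {s : Set V} {S : Set s} (h : BiconnSet (G.induce s) S) :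
    BiconnSet G (Subtype.val '' S) := by
  have hlift : ∀ {S : Set s} {p q : s}, Rch (G.induce s) S p q →
      Rch G (Subtype.val '' S) p q := fun h =>
    ReflTransGen.lift (p := fun a b => G.Adj a b ∧ a ∈ Subtype.val '' _ ∧ b ∈ Subtype.val '' _)
      Subtype.val (fun a b hab => ⟨hab.1, ⟨a, hab.2.1, rfl⟩, ⟨b, hab.2.2, rfl⟩⟩) _ _ h
  refine ⟨h.1.image _, ?_, fun x => ?_⟩
  · rintro _ ⟨p, hp, rfl⟩ _ ⟨q, hq, rfl⟩
    exact hlift (h.2.1 p hp q hq)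
  · rintro _ ⟨⟨p, hp, rfl⟩, hpx⟩ _ ⟨⟨q, hq, rfl⟩, hqx⟩
    by_cases hx : x ∈ s
    · refine (hlift (h.2.2 ⟨x, hx⟩ p ⟨hp, ?_⟩ q ⟨hq, ?_⟩)).mono ?_
      · rintro rfl
        exact hpx rfl
      · rintro rfl
        exact hqx rfl
      · rintro _ ⟨r, ⟨hr, hrx⟩, rfl⟩
        exact ⟨⟨r, hr, rfl⟩, fun h => hrx (Subtype.ext h)⟩
    · refine (hlift (h.2.1 p hp q hq)).mono ?_
      rintro _ ⟨r, hr, rfl⟩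
      exact ⟨⟨r, hr, rfl⟩, fun h => hx (h ▸ r.2)⟩

theorem ncard_end_eq_two_of_straightDart (hlf : ∀ x, (G.neighborSet x).Finite) (hTG : T ≤ G)
    (hac : T.IsAcyclic) {x y : V} (hreach : ∀ v, G.Reachable x v → T.Reachable x v)
    (hblock : ∀ S, BiconnSet G S → x ∈ S → S.Finite) (h : StraightDart (coreGraph T) (x, y))
    (h' : StraightDart (coreGraph T) (y, x)) :
    (SimpleGraph.end (G.induce (G.connectedComponentMk x).supp)).ncard = 2 := by
  have hTlf : ∀ x, (T.neighborSet x).Finite := fun x => (hlf x).subset fun _ h => hTG h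
  have hClf : ∀ x, ((coreGraph T).neighborSet x).Finite := fun x =>
    (hTlf x).subset fun _ h => coreGraph_le h
  obtain ⟨b, hb, hb0, hb1⟩ := exists_nbSeq_of_leafless
    (fun x y h => coreGraph_leafless hTlf h) (x := x) (y := y) h.1
  obtain ⟨a', ha', ha0', ha1'⟩ := exists_nbSeq_of_leafless
    (fun x y h => coreGraph_leafless hTlf h) (x := y) (y := x) h'.1
  obtain ⟨a, ha⟩ : ∃ a : ℕ → V, ∀ i, a i = a' (i + 1) := ⟨_, fun _ => rfl⟩
  have hanb : NBSeq (coreGraph T) a := by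
    refine ⟨fun i => ?_, fun i => ?_⟩
    · rw [ha, ha]
      exact ha'.1 (i + 1)
    · rw [ha, ha]
      exact ha'.2 (i + 1)
  have ha0 : a 0 = x := (ha 0).trans ha1'
  have hab : a 1 ≠ b 1 := by
    rw [hb1, ← ha0', ha]
    exact ha'.2 0
  have hano : ∀ i, ¬ IsNode (coreGraph T) (a i) := by
    intro i hi
    refine h'.2 ⟨(a' i, a' (i + 1)), ?_, ha i ▸ hi⟩
    have := ha'.dartReach (Nat.zero_le i)
    rwa [zero_add, ha0', ha1'] at this
  have hbno : ∀ i, ¬ IsNode (coreGraph T) (b (i + 1)) := by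
    intro i hi
    refine h.2 ⟨(b i, b (i + 1)), ?_, hi⟩
    have := hb.dartReach (Nat.zero_le i)
    rwa [zero_add, hb0, hb1] at this
  have hxa : (coreGraph T).Adj x (a 1) := ha0 ▸ hanb.1 0
  have hxb : (coreGraph T).Adj x (b 1) := by
    have := hb.1 0
    rwa [hb0] at this
  have huniq : ∀ u, NBSeq T u → u 0 = x → u = a ∨ u = b := by
    rintro u hu rfl
    have huC := hu.coreGraph hab hxa hxb
    by_cases h1 : u 1 = a 1
    · exact Or.inl (huC.eq_of_not_isNode hClf hanb ha0.symm h1 fun i => hano _)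
    · refine Or.inr (huC.eq_of_not_isNode hClf hb hb0.symm ?_ hbno)
      exact eq_of_not_isNode hClf (ha0 ▸ hano 0) hxa (huC.1 0) hxb (Ne.symm h1) hab
  have haT := hanb.mono coreGraph_le
  have hbT := hb.mono coreGraph_le
  obtain ⟨s, hs⟩ : ∃ s, s = (G.connectedComponentMk x).supp := ⟨_, rfl⟩
  rw [← hs]
  have hmem : ∀ v, v ∈ s ↔ G.Reachable x v := by
    intro v
    rw [hs, SimpleGraph.ConnectedComponent.mem_supp_iff, SimpleGraph.ConnectedComponent.eq]
    exact ⟨SimpleGraph.Reachable.symm, SimpleGraph.Reachable.symm⟩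
  have hadjmem : ∀ {u v}, u ∈ s → G.Adj u v → v ∈ s := fun hu huv =>
    (hmem _).2 (((hmem _).1 hu).trans huv.reachable)
  have hseq : ∀ u : ℕ → V, NBSeq T u → u 0 = x → ∀ i, u i ∈ s := by
    intro u hu hu0 i
    induction i with
    | zero => exact (hmem _).2 (hu0 ▸ SimpleGraph.Reachable.refl _)
    | succ i ih => exact hadjmem ih (hTG (hu.1 i))
  have hconn : (T.induce s).Preconnected := by
    rw [← connSet_iff]
    intro p hp q hq
    have := ((hreach p ((hmem p).1 hp)).symm).trans (hreach q ((hmem q).1 hq))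
    rw [SimpleGraph.reachable_iff_reflTransGen] at this
    induction this with
    | refl => exact ReflTransGen.refl
    | @tail c d _ hcd ih =>
      have hc : c ∈ s := hadjmem hq (hTG hcd).symm
      exact (ih hc).tail ⟨hcd, hc, hq⟩
  have hxy : x ≠ b 1 := hxb.ne
  have hfin : (⋃₀ {S | BiconnSet G S ∧ x ∈ S ∧ b 1 ∈ S}).Finite := by
    rcases {S | BiconnSet G S ∧ x ∈ S ∧ b 1 ∈ S}.eq_empty_or_nonempty with h | ⟨S, hS⟩
    · rw [h]
      simp
    · exact hblock _ (BiconnSet.sUnion hxy ⟨S, hS⟩ fun _ h => h) ⟨S, hS, hS.2.1⟩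
  refine ncard_end_eq_two_of_forest (T := T.induce s) (a := fun i => ⟨a i, hseq a haT ha0 i⟩)
    (b := fun i => ⟨b i, hseq b hbT hb0 i⟩) ?_ ?_ ?_ hconn ?_ ?_ ?_ ?_ ?_
    (hfin.preimage (f := (Subtype.val : s → V)) Subtype.val_injective.injOn).toFinset ?_
  · exact fun v => (hTlf v).preimage Subtype.val_injective.injOn
  · exact fun u v h => hTG h
  · exact hac.comap (SimpleGraph.Embedding.induce s).toHom Subtype.val_injective
  · exact ⟨haT.1, fun i h => haT.2 i (congrArg Subtype.val h)⟩
  · exact ⟨hbT.1, fun i h => hbT.2 i (congrArg Subtype.val h)⟩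
  · exact Subtype.ext (ha0.trans hb0.symm)
  · exact fun h => hab (congrArg Subtype.val h)
  · intro u hu hu0
    have hu' : NBSeq T (fun i => (u i : V)) :=
      ⟨hu.1, fun i h => hu.2 i (Subtype.ext h)⟩
    rcases huniq _ hu' ((congrArg Subtype.val hu0).trans ha0) with h | h
    · exact Or.inl (funext fun i => Subtype.ext (congrFun h i))
    · exact Or.inr (funext fun i => Subtype.ext (congrFun h i))
  · intro S hS h0 h1 v hv
    rw [Set.Finite.coe_toFinset]
    exact ⟨Subtype.val '' S, ⟨hS.image_val, ⟨_, h0, ha0⟩, ⟨_, h1, rfl⟩⟩, ⟨v, hv, rfl⟩⟩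

end StraightLine

section RealColoring

open Relation Set

theorem Unchoosable.of_reachable {V : Type*} {G : SimpleGraph V} {x y : V} (hx : Unchoosable G x)
    (h : G.Reachable x y) : Unchoosable G y :=
  fun K hK hKn hKy => hx K hK hKn fun z hz => h.trans (hKy z hz)

theorem card_residual {V : Type*} {G : SimpleGraph V} {L : Finset ℝ} {x : V} {A D : Set V}
    (hlf : ∀ x, (G.neighborSet x).Finite) (hAD : ∀ y ∈ A, y ∉ D) (c : V → ℝ) (hcard : (G.neighborSet x).ncard ≤ L.card) :
    degS G A x ≤ (L \ ((hlf x).inter_of_left D |>.image c).toFinset).card := by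
  have h1 : degS G A x + degS G D x ≤ (G.neighborSet x).ncard := by
    unfold degS
    rw [← ncard_union_eq (disjoint_left.2 fun y hy hy' => hAD y hy.2 hy'.2)
      ((hlf x).inter_of_left A) ((hlf x).inter_of_left D)]
    exact ncard_le_ncard (union_subset inter_subset_left inter_subset_left) (hlf x)
  have h2 : ((hlf x).inter_of_left D |>.image c).toFinset.card ≤ degS G D x := by
    rw [← ncard_eq_toFinset_card _ _]
    exact ncard_image_le ((hlf x).inter_of_left D)
  have h3 := Finset.le_card_sdiff ((hlf x).inter_of_left D |>.image c).toFinset L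
  omega

variable {X : Type*} [MeasurableSpace X] [StandardBorelSpace X] {G : SimpleGraph X}

theorem exists_noBack_unchoosable [Nonempty X] (hG : Measurable fun p : X × X => G.Adj p.1 p.2)
    (hlf : ∀ x, (G.neighborSet x).Finite)
    (hfin : ∀ c : G.ConnectedComponent, c.supp.Finite → ¬ GallaiTree (G.induce c.supp))
    (hinf : ∀ c : G.ConnectedComponent, c.supp.Infinite → GallaiTree (G.induce c.supp) →
      (SimpleGraph.end (G.induce c.supp)).ncard ≠ 2) (μ : Measure X) [IsProbabilityMeasure μ] :
    ∃ Z : Set X, (Measurable fun x => x ∈ Z) ∧ μ Z = 0 ∧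
      (∀ x y, G.Reachable x y → x ∈ Z → y ∈ Z) ∧ ∃ f : X → X, Measurable f ∧
        NoBack {x | Unchoosable G x ∧ x ∉ Z} f ∧
        ∀ x, Unchoosable G x → x ∉ Z → G.Adj x (f x) := by
  have hU := measurable_unchoosable hG hlf
  obtain ⟨T₀, hT₀, hT₀G, hac₀, hreach₀⟩ := exists_spanning_forest hG hlf
  let T : SimpleGraph X :=
    { Adj := fun x y => T₀.Adj x y ∧ Unchoosable G x ∧ Unchoosable G y
      symm := ⟨fun _ _ h => ⟨h.1.symm, h.2.2, h.2.1⟩⟩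
      loopless := ⟨fun _ h => h.1.ne rfl⟩ }
  have hTT₀ : T ≤ T₀ := fun _ _ h => h.1
  have hTG : T ≤ G := hTT₀.trans hT₀G
  have hT : Measurable fun p : X × X => T.Adj p.1 p.2 := by
    change Measurable fun p : X × X => T₀.Adj p.1 p.2 ∧ Unchoosable G p.1 ∧ Unchoosable G p.2
    fun_prop
  have hac : T.IsAcyclic := hac₀.anti hTT₀
  have hTlf : ∀ x, (T.neighborSet x).Finite := fun x => (hlf x).subset fun _ h => hTG h
  have hreach : ∀ x y, G.Reachable x y → Unchoosable G x → T.Reachable x y := by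
    intro x y hxy hx
    have := hreach₀ x y hxy hx
    rw [SimpleGraph.reachable_iff_reflTransGen] at this
    induction this using ReflTransGen.head_induction_on with
    | refl => rfl
    | @head a c hac' _ ih =>
      have hc := hx.of_reachable (hT₀G hac').reachable
      have hadj : T.Adj a c := ⟨hac', hx, hc⟩
      exact hadj.reachable.trans (ih ((hT₀G hac').reachable.symm.trans hxy) hc)
  have hgal : ∀ x, Unchoosable G x → GallaiTree (G.induce (G.connectedComponentMk x).supp) := by
    refine fun x hx => gallaiTree_of_unchoosable hlf fun y hy => hx.of_reachable ?_
    rw [SimpleGraph.ConnectedComponent.mem_supp_iff, SimpleGraph.ConnectedComponent.eq] at hy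
    exact hy.symm
  have hinf' : ∀ x, Unchoosable G x → (G.connectedComponentMk x).supp.Infinite :=
    fun x hx h => hfin _ h (hgal x hx)
  have hno : ∀ x y, StraightDart (coreGraph T) (x, y) → ¬ StraightDart (coreGraph T) (y, x) := by
    intro x y h h'
    have hx : Unchoosable G x := (coreGraph_le h.1).2.1
    exact hinf _ (hinf' x hx) (hgal x hx)
      (ncard_end_eq_two_of_straightDart hlf hTG hac (fun v hv => hreach x v hv hx)
        (fun S hS hxS => hx.biconn_finite hlf hS hxS) h h')
  obtain ⟨Z, hZ, hZ0, hZinv, f, hf, hnb, hadj⟩ := exists_noBack_of_forest hG hlf hTG hT hac hno μ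
  have hdart : ∀ x, Unchoosable G x → ∃ y, InfDart T (x, y) := by
    intro x hx
    refine exists_infDart hTlf ((hinf' x hx).mono fun v hv => hreach x v ?_ hx)
    rw [SimpleGraph.ConnectedComponent.mem_supp_iff, SimpleGraph.ConnectedComponent.eq] at hv
    exact hv.symm
  exact ⟨Z, hZ, hZ0, hZinv, f, hf, hnb.mono fun x hx => ⟨hdart x hx.1, hx.2⟩,
    fun x hx hxZ => hTG (hadj x (hdart x hx) hxZ)⟩

theorem exists_null_real_coloring (hG : Measurable fun p : X × X => G.Adj p.1 p.2)
    (hlf : ∀ x, (G.neighborSet x).Finite)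
    (hfin : ∀ c : G.ConnectedComponent, c.supp.Finite → ¬ GallaiTree (G.induce c.supp))
    (hinf : ∀ c : G.ConnectedComponent, c.supp.Infinite → GallaiTree (G.induce c.supp) →
      (SimpleGraph.end (G.induce c.supp)).ncard ≠ 2) (μ : Measure X) [IsProbabilityMeasure μ] :
    ∃ Z : Set X, (Measurable fun x => x ∈ Z) ∧ μ Z = 0 ∧
      (∀ x y, G.Reachable x y → x ∈ Z → y ∈ Z) ∧
      ∀ L : X → Finset ℝ, (Measurable fun p : X × ℝ => p.2 ∈ L p.1) →
        (∀ x, (G.neighborSet x).ncard ≤ (L x).card) →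
        ∃ c : X → ℝ, Measurable c ∧ ∀ x, x ∉ Z → c x ∈ L x ∧
          ∀ y, y ∉ Z → G.Adj x y → c x ≠ c y := by
  classical
  have hne : Nonempty X := μ.nonempty_of_neZero
  have hU := measurable_unchoosable hG hlf
  obtain ⟨Z, hZ, hZ0, hZinv, g, hg, hgnb, hgadj⟩ :=
    exists_noBack_unchoosable hG hlf hfin hinf μ
  obtain ⟨A, z, hA, hz, hAU, hUA, hAcol, hAfin, hAz⟩ := exists_choosable_clusters hG hlf
  obtain ⟨f, hf, hfnb, hfadj⟩ := exists_extension G hG hlf hA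
  refine ⟨Z, hZ, hZ0, hZinv, fun L hL hcard => ?_⟩
  have hDU : ∀ x, (∃ a, G.Reachable x a ∧ a ∈ A) → ¬ Unchoosable G x := by
    rintro x ⟨a, hxa, ha⟩ hx
    exact hAU a ha (hx.of_reachable hxa)
  have hAr := measurable_exists_reachable hG hlf hA
  obtain ⟨F, hF, hFnb, hFf, hFg⟩ := exists_glue_two
    (D := {x | x ∉ A ∧ ∃ a, G.Reachable x a ∧ a ∈ A}) (E := {x | Unchoosable G x ∧ x ∉ Z})
    (by simp only [mem_ofPred_eq]; fun_prop) (by simp only [mem_ofPred_eq]; fun_prop)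
    (fun x hx hx' => hDU x hx.2 hx'.1) hf hg hfnb hgnb
    (fun x hx hx' => hDU _ hx'.2 (hx.1.of_reachable (hgadj x hx.1 hx.2).reachable))
  obtain ⟨D, hDdef⟩ : ∃ D : Set X, ∀ x, x ∈ D ↔
      (x ∉ A ∧ ∃ a, G.Reachable x a ∧ a ∈ A) ∨ (Unchoosable G x ∧ x ∉ Z) :=
    ⟨{x | _}, fun _ => Iff.rfl⟩
  have hD : Measurable fun x => x ∈ D := by
    simp only [hDdef]
    fun_prop
  have hAD : ∀ x ∈ A, x ∉ D := fun x hx hxD =>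
    ((hDdef x).1 hxD).elim (fun h => h.1 hx) fun h => hAU x hx h.1
  have hFnb' : NoBack D F := hFnb.mono fun x hx => (hDdef x).1 hx
  have hFadj : ∀ x ∈ D, G.Adj x (F x) := by
    intro x hx
    rcases (hDdef x).1 hx with h | h
    · rw [hFf x h]
      exact hfadj x h.1 h.2
    · rw [hFg x h]
      exact hgadj x h.1 h.2
  obtain ⟨c₁, hc₁, hc₁L⟩ := exists_coloring_of_noBack G hG hlf hD hF hFadj hFnb' hL
    fun x _ => hcard x
  let L' : X → Finset ℝ := fun x => L x \ ((hlf x).inter_of_left D |>.image c₁).toFinset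
  have hmemL' : ∀ x t, t ∈ L' x ↔ t ∈ L x ∧ ∀ y, (G.Adj x y ∧ y ∈ D) → c₁ y ≠ t := by
    intro x t
    simp only [L', Finset.mem_sdiff, Set.Finite.mem_toFinset]
    refine and_congr_right fun _ => ⟨fun h y hy hyt => h ⟨y, hy, hyt⟩, ?_⟩
    rintro h ⟨y, hy, hyt⟩
    exact h y hy hyt
  have hL' : Measurable fun p : X × ℝ => p.2 ∈ L' p.1 := by
    simp only [hmemL']
    refine hL.and (measurable_forall_imp (X := X × ℝ)
      (R := fun p y => G.Adj p.1 y ∧ y ∈ D) (S := fun p y => c₁ y ≠ p.2) ?_ ?_ ?_)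
    · have h1 := hG.comp (f := fun q : (X × ℝ) × X => (q.1.1, q.2)) (by fun_prop)
      have h2 := hD.comp (f := fun q : (X × ℝ) × X => q.2) (by fun_prop)
      exact h1.and h2
    · fun_prop
    · exact fun p => (hlf p.1).subset fun y hy => hy.1
  obtain ⟨c₂, hc₂, hc₂L⟩ := exists_coloring_of_classes hG hlf hA hz hL' hAfin hAz
    (hAcol L' fun x _ => card_residual hlf hAD c₁ (hcard x))
  have hcov : ∀ x, x ∉ Z → x ∉ A → x ∈ D := by
    intro x hxZ hxA
    by_cases hx : Unchoosable G x
    · exact (hDdef x).2 (Or.inr ⟨hx, hxZ⟩)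
    · exact (hDdef x).2 (Or.inl ⟨hxA, hUA x hx⟩)
  refine ⟨fun x => if x ∈ A then c₂ x else c₁ x, Measurable.ite hA.setOf hc₂ hc₁, fun x hx => ?_⟩
  by_cases hxA : x ∈ A
  · have hx2 := (hmemL' x _).1 (hc₂L x hxA).1
    simp only [if_pos hxA]
    refine ⟨hx2.1, fun y hy hxy => ?_⟩
    by_cases hyA : y ∈ A
    · rw [if_pos hyA]
      exact (hc₂L x hxA).2 y hyA hxy
    · rw [if_neg hyA]
      exact (hx2.2 y ⟨hxy, hcov y hy hyA⟩).symm
  · have hxD := hcov x hx hxA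
    simp only [if_neg hxA]
    refine ⟨(hc₁L x hxD).1, fun y hy hxy => ?_⟩
    by_cases hyA : y ∈ A
    · rw [if_pos hyA]
      exact ((hmemL' y _).1 (hc₂L y hyA).1).2 x ⟨hxy.symm, hxD⟩
    · rw [if_neg hyA]
      exact (hc₁L x hxD).2 y (hcov y hy hyA) hxy

end RealColoring

section PolishLists

open Set TopologicalSpace

theorem measurableSet_mem_of_meets_open {Ω Y : Type*} [MeasurableSpace Ω] [TopologicalSpace Y]
    [MeasurableSpace Y] [OpensMeasurableSpace Y] [T1Space Y] [SecondCountableTopology Y]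
    {L : Ω → Finset Y}
    (hL : ∀ U : Set Y, IsOpen U → MeasurableSet {x | ∃ y ∈ L x, y ∈ U}) :
    MeasurableSet {p : Ω × Y | p.2 ∈ L p.1} := by
  have h : {p : Ω × Y | p.2 ∈ L p.1} =
      ⋂ U ∈ countableBasis Y, (Prod.snd ⁻¹' U)ᶜ ∪ Prod.fst ⁻¹' {x | ∃ y ∈ L x, y ∈ U} := by
    ext ⟨x, y⟩
    simp only [mem_ofPred_eq, mem_iInter, mem_union, mem_compl_iff, mem_preimage]
    refine ⟨fun hy U _ => or_iff_not_imp_left.2 fun hyU => ⟨y, hy, not_not.1 hyU⟩, fun h => ?_⟩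
    by_contra hy
    obtain ⟨U, hU, hyU, hUL⟩ := (isBasis_countableBasis Y).exists_subset_of_mem_open
      (show y ∈ ((L x : Set Y))ᶜ from hy) (L x).finite_toSet.isClosed.isOpen_compl
    rcases h U hU with h | ⟨y', hy', hyU'⟩
    · exact h hyU
    · exact hUL hyU' hy'
  rw [h]
  refine MeasurableSet.biInter (countable_countableBasis Y) fun U hU => ?_
  have hUo := isOpen_of_mem_countableBasis hU
  exact (measurable_snd hUo.measurableSet).compl.union (measurable_fst (hL U hUo))

theorem ncard_neighborSet_induce {V : Type*} {G : SimpleGraph V} {B : Set V}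
    (hB : GraphInvariant G B) (x : B) :
    ((G.induce B).neighborSet x).ncard = (G.neighborSet (x : V)).ncard := by
  rw [← ncard_image_of_injective _ Subtype.val_injective]
  congr 1
  ext y
  constructor
  · rintro ⟨y, hy, rfl⟩
    exact hy
  · intro hy
    exact ⟨⟨y, hB hy.reachable x.2⟩, hy, rfl⟩

end PolishLists

universe u

theorem stmt_17 {X : Type*} [MeasurableSpace X] [StandardBorelSpace X]
    (G : SimpleGraph X) (hGmeas : MeasurableSet {p : X × X | G.Adj p.1 p.2})
    (hlf : ∀ x : X, (G.neighborSet x).Finite)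
    (hfin : ∀ c : G.ConnectedComponent, c.supp.Finite →
      ¬ GallaiTree (G.induce c.supp))
    (hinf : ∀ c : G.ConnectedComponent, c.supp.Infinite →
      GallaiTree (G.induce c.supp) →
        (SimpleGraph.end (G.induce c.supp)).ncard ≠ 2)
    (μ : Measure X) [IsProbabilityMeasure μ] :
    ∃ B : Set X, MeasurableSet B ∧ μ Bᶜ = 0 ∧ GraphInvariant G B ∧
      ∀ (Y : Type u) [TopologicalSpace Y] [MeasurableSpace Y] [PolishSpace Y]
        [BorelSpace Y] (L : B → Finset Y),
        (∀ U : Set Y, IsOpen U → MeasurableSet {x : B | ∃ y ∈ L x, y ∈ U}) →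
        (∀ x : B, (L x).card = ((G.induce B).neighborSet x).ncard) →
        ∃ c : B → Y, Measurable c ∧ (∀ x : B, c x ∈ L x) ∧
          ∀ x y : B, G.Adj (x : X) (y : X) → c x ≠ c y := by
  classical
  have hG : Measurable fun p : X × X => G.Adj p.1 p.2 := hGmeas.mem
  obtain ⟨Z, hZ, hZ0, hZinv, hcol⟩ := exists_null_real_coloring hG hlf hfin hinf μ
  have hB : MeasurableSet Zᶜ := hZ.setOf.compl
  have hBinv : GraphInvariant G Zᶜ := fun x y hxy hx hy => hx (hZinv y x hxy.symm hy)
  refine ⟨Zᶜ, hB, by rwa [compl_compl], hBinv, ?_⟩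
  intro Y _ _ _ _ L hL hcard
  obtain ⟨e, he⟩ := exists_measurableEmbedding_real Y
  let L' : X → Finset ℝ := fun x => if h : x ∈ Zᶜ then (L ⟨x, h⟩).image e
    else (Finset.range (G.neighborSet x).ncard).image fun n : ℕ => (n : ℝ)
  have hemb : MeasurableEmbedding (Prod.map Subtype.val e : (Zᶜ : Set X) × Y → X × ℝ) :=
    (MeasurableEmbedding.subtype_coe hB).prodMap he
  have hS := hemb.measurableSet_image.2 (measurableSet_mem_of_meets_open hL)
  have hdeg := measurable_ncard_section hG hlf
  have hL' : Measurable fun p : X × ℝ => p.2 ∈ L' p.1 := by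
    have h : ∀ p : X × ℝ, p.2 ∈ L' p.1 ↔
        (p ∈ Prod.map Subtype.val e '' {p : (Zᶜ : Set X) × Y | p.2 ∈ L p.1}) ∨
          (p.1 ∈ Z ∧ ∃ n : ℕ, n < {y | G.Adj p.1 y}.ncard ∧ (n : ℝ) = p.2) := by
      rintro ⟨x, t⟩
      by_cases hx : x ∈ Zᶜ
      · have hx' : x ∉ Z := hx
        simp only [L', dif_pos hx, Finset.mem_image, hx', false_and, or_false]
        constructor
        · rintro ⟨y, hy, rfl⟩
          exact ⟨(⟨x, hx⟩, y), hy, rfl⟩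
        · rintro ⟨⟨⟨x', hx'⟩, y⟩, hy, hxy⟩
          obtain ⟨rfl, rfl⟩ := Prod.ext_iff.1 hxy
          exact ⟨y, hy, rfl⟩
      · have hx' : x ∈ Z := not_not.1 hx
        simp only [L', dif_neg hx, Finset.mem_image, Finset.mem_range, hx', true_and]
        refine ⟨Or.inr, ?_⟩
        rintro (⟨⟨⟨x'', hx''⟩, y⟩, hy, hxy⟩ | h)
        · obtain ⟨rfl, -⟩ := Prod.ext_iff.1 hxy
          exact absurd hx'' hx
        · exact h
    simp only [h]
    have h1 := hS.mem
    have h2 := hZ.comp (f := fun p : X × ℝ => p.1) (by fun_prop)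
    have h3 := hdeg.comp (f := fun p : X × ℝ => p.1) (by fun_prop)
    refine h1.or (h2.and (Measurable.exists fun n => ?_))
    refine Measurable.and ?_ ?_
    · exact (measurable_from_top (f := fun k : ℕ => n < k)).comp h3
    · fun_prop
  obtain ⟨c, hc, hcL⟩ := hcol L' hL' fun x => by
    by_cases hx : x ∈ Zᶜ
    · simp only [L', dif_pos hx]
      rw [Finset.card_image_of_injective _ he.injective, hcard, ncard_neighborSet_induce hBinv]
    · simp only [L', dif_neg hx]
      rw [Finset.card_image_of_injective _ Nat.cast_injective, Finset.card_range]
  have hex : ∀ x : (Zᶜ : Set X), ∃ y ∈ L x, e y = c x := by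
    intro x
    have := (hcL x x.2).1
    simpa only [L', dif_pos x.2, Finset.mem_image] using this
  choose c' hc' hec using hex
  refine ⟨c', ?_, hc', fun x y hxy h => ?_⟩
  · rw [← he.measurable_comp_iff]
    have : e ∘ c' = fun x : (Zᶜ : Set X) => c x := funext hec
    rw [this]
    exact hc.comp measurable_subtype_coe
  · refine (hcL x x.2).2 y y.2 hxy ?_
    rw [← hec, ← hec, h]
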